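/- Let K be a global function field of characteristic p containing a primitive q-th root of unity, where q ≠ p is prime, and let S be a nonempty finite set of primes of K. For x ∈ K^×, the following are equivalent: (i) x ∈ O_{K,S}; (ii) for all a ∈ 𝒱_{K,S} and all b ∈ U_{K,S} for which every element inverted below is nonzero, there exists y ∈ L_4(a^{1/q}) with N_{L_4(a^{1/q})/L_4}(y) = b x^q + b^q, where L_1 = K((1+(bx^q+b^q)^{-1})^{1/q}), L_3 = L_1((1+x^{-1})^{1/q}), and L_4 = L_3((1+(a+a^{-1})x^{-1})^{1/q}). -/

import Mathlib

noncomputable section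

/-- A normalized (surjective onto `ℤ`) discrete valuation on a field `K`, i.e. a
"prime" of a global function field. -/
structure FFPrime (K : Type) [Field K] where
  ord : K → WithTop ℤ
  ord_zero : ord 0 = ⊤
  ord_ne_top : ∀ x : K, x ≠ 0 → ord x ≠ ⊤
  ord_one : ord 1 = 0
  ord_mul : ∀ x y : K, ord (x * y) = ord x + ord y
  ord_add : ∀ x y : K, min (ord x) (ord y) ≤ ord (x + y)
  ord_surj : ∀ n : ℤ, ∃ x : K, ord x = (n : WithTop ℤ)

namespace FFPrime

variable {K L : Type} [Field K] [Field L]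

/-- `w` lies over `v` along `φ`, with ramification index `e`. -/
def LiesOverWith (w : FFPrime L) (v : FFPrime K) (φ : K →+* L) (e : ℕ) : Prop :=
  0 < e ∧ ∀ x : K, w.ord (φ x) = ((e : ℤ) : WithTop ℤ) * v.ord x

/-- `w` lies over `v` along `φ`. -/
def LiesOver (w : FFPrime L) (v : FFPrime K) (φ : K →+* L) : Prop :=
  ∃ e : ℕ, w.LiesOverWith v φ e

open Classical in
/-- The ramification index `e(w/v)`. -/
noncomputable def ramIdx (w : FFPrime L) (v : FFPrime K) (φ : K →+* L) : ℕ :=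
  if h : ∃ e : ℕ, w.LiesOverWith v φ e then h.choose else 0

/-- The residue field of `v` has exactly `n` elements. -/
def HasResidueCard (v : FFPrime K) (n : ℕ) : Prop :=
  ∃ s : Finset K, s.card = n ∧ (∀ x ∈ s, 0 ≤ v.ord x) ∧
    (∀ x ∈ s, ∀ y ∈ s, x ≠ y → ¬ 0 < v.ord (x - y)) ∧
    (∀ z : K, 0 ≤ v.ord z → ∃ x ∈ s, 0 < v.ord (z - x))

open Classical in
/-- The residue (relative) degree `f(w/v)`: the unique `f ≥ 1` with
`#κ_w = (#κ_v) ^ f` (residue fields of global function fields are finite). -/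
noncomputable def resDeg (w : FFPrime L) (v : FFPrime K) : ℕ :=
  if h : ∃ f : ℕ, 0 < f ∧ ∃ m n : ℕ, 1 < m ∧ v.HasResidueCard m ∧
      w.HasResidueCard n ∧ n = m ^ f then h.choose else 0

/-- `v` splits completely in the extension given by `φ`: every prime above it has
ramification index and residue degree `1`. -/
def SplitsCompletely (v : FFPrime K) (φ : K →+* L) : Prop :=
  ∀ w : FFPrime L, w.LiesOver v φ → w.ramIdx v φ = 1 ∧ w.resDeg v = 1

/-- `v` is inert in the finite extension `M/K`: there is a unique prime above it, with
ramification index `1` and residue degree `[M : K]`. -/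
def IsInert (v : FFPrime K) (M : Type) [Field M] [Algebra K M] : Prop :=
  (∃! w : FFPrime M, w.LiesOver v (algebraMap K M)) ∧
    ∀ w : FFPrime M, w.LiesOver v (algebraMap K M) →
      w.ramIdx v (algebraMap K M) = 1 ∧ w.resDeg v = Module.finrank K M

/-- `v` ramifies in the extension given by `φ`: some prime above it has ramification
index `> 1`. -/
def Ramifies (v : FFPrime K) (φ : K →+* L) : Prop :=
  ∃ w : FFPrime L, w.LiesOver v φ ∧ 2 ≤ w.ramIdx v φ

/-- `ord_v z ≡ 0 mod q`. -/
def OrdDvd (v : FFPrime K) (q : ℕ) (z : K) : Prop :=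
  ∃ n : ℤ, v.ord z = (((q : ℤ) * n : ℤ) : WithTop ℤ)

end FFPrime

/-- A nontrivial (rank one) valuation on a possibly infinite algebraic extension of a
global function field, with values in `ℚ ∪ {∞}`. -/
structure FFVal (B : Type) [Field B] where
  ord : B → WithTop ℚ
  ord_zero : ord 0 = ⊤
  ord_ne_top : ∀ x : B, x ≠ 0 → ord x ≠ ⊤
  ord_one : ord 1 = 0
  ord_mul : ∀ x y : B, ord (x * y) = ord x + ord y
  ord_add : ∀ x y : B, min (ord x) (ord y) ≤ ord (x + y)
  nontrivial : ∃ x : B, ord x ≠ 0 ∧ ord x ≠ ⊤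

/-- The valuation `V` of the big field restricts, up to a normalization factor `c`, to
the (normalized discrete) prime `v` of `K` along `φ`; i.e. `v` is the prime of `K`
lying below `V`. -/
def FFVal.RestrictsTo {K B : Type} [Field K] [Field B] (V : FFVal B) (v : FFPrime K)
    (φ : K →+* B) : Prop :=
  ∃ c : ℚ, 0 < c ∧
    ∀ x : K, V.ord (φ x) = ((c : ℚ) : WithTop ℚ) * WithTop.map (fun n : ℤ => (n : ℚ)) (v.ord x)

/-- The algebraic extension `B` of the rational function field `F0 = 𝔽_p(t)` is
`q`-bounded: for every valuation of `B`, the `q`-adic valuations of the ramification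
indices and residue degrees along every finite subextension are bounded. -/
def IsQBounded (q : ℕ) (F0 B : Type) [Field F0] [Field B] [Algebra F0 B] : Prop :=
  ∀ V : FFVal B, ∃ C : ℕ,
    ∀ L : IntermediateField F0 B, FiniteDimensional F0 L →
      ∀ v0 : FFPrime F0, ∀ vL : FFPrime L,
        V.RestrictsTo v0 (algebraMap F0 B) →
        V.RestrictsTo vL L.val.toRingHom →
        padicValNat q (vL.ramIdx v0 (algebraMap F0 L)) ≤ C ∧
        padicValNat q (vL.resDeg v0) ≤ C

/-- The prime `v` of `K` has uniformly `q`-bounded ramification in `B`. -/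
def UnifQBoundedRam (q : ℕ) {K : Type} [Field K] (B : Type) [Field B] [Algebra K B]
    (v : FFPrime K) : Prop :=
  ∃ C : ℕ, ∀ F : IntermediateField K B, FiniteDimensional K F →
    ∀ w : FFPrime F, w.LiesOver v (algebraMap K F) →
      padicValNat q (w.ramIdx v (algebraMap K F)) ≤ C

/-- The prime `v` of `K` has uniformly absolutely bounded ramification in `B`. -/
def UnifAbsBoundedRam {K : Type} [Field K] (B : Type) [Field B] [Algebra K B]
    (v : FFPrime K) : Prop :=
  ∃ C : ℕ, ∀ F : IntermediateField K B, FiniteDimensional K F →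
    ∀ w : FFPrime F, w.LiesOver v (algebraMap K F) →
      w.ramIdx v (algebraMap K F) ≤ C

/-- The prime `v` of `K` has uniformly `q`-bounded relative (residue) degree in `B`. -/
def UnifQBoundedRes (q : ℕ) {K : Type} [Field K] (B : Type) [Field B] [Algebra K B]
    (v : FFPrime K) : Prop :=
  ∃ C : ℕ, ∀ F : IntermediateField K B, FiniteDimensional K F →
    ∀ w : FFPrime F, w.LiesOver v (algebraMap K F) →
      padicValNat q (w.resDeg v) ≤ C

/-- The prime `v` of `K` is uniformly `q`-bounded in `B`. -/
def UniformlyQBoundedAt (q : ℕ) {K : Type} [Field K] (B : Type) [Field B] [Algebra K B]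
    (v : FFPrime K) : Prop :=
  UnifQBoundedRam q B v ∧ UnifQBoundedRes q B v

/-- The integral closure in `B` of the valuation ring `O_v = {x ∈ K : ord_v x ≥ 0}`. -/
def valIntegralClosure {K : Type} [Field K] (v : FFPrime K) (B : Type) [Field B]
    [Algebra K B] : Set B :=
  {x : B | ∃ P : Polynomial K, P.Monic ∧ (∀ n : ℕ, 0 ≤ v.ord (P.coeff n)) ∧
    Polynomial.aeval x P = 0}

/-- The integral closure in `B` of the ring `O_{K,S}` of `S`-integers of `K`. -/
def sIntegralClosure {K : Type} [Field K] (S : Set (FFPrime K)) (B : Type) [Field B]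
    [Algebra K B] : Set B :=
  {x : B | ∃ P : Polynomial K, P.Monic ∧
    (∀ n : ℕ, ∀ v : FFPrime K, v ∉ S → 0 ≤ v.ord (P.coeff n)) ∧
    Polynomial.aeval x P = 0}

/-- Elements of `B` that are units at every prime of `B` lying over a prime of `S`. -/
def unitsAtS {K : Type} [Field K] (S : Set (FFPrime K)) (B : Type) [Field B]
    [Algebra K B] : Set B :=
  {x : B | ∀ V : FFVal B, (∃ v ∈ S, V.RestrictsTo v (algebraMap K B)) → V.ord x = 0}

/-- Elements `x` of `B` with `ord (x - 1) > 0` at every prime of `B` lying over a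
prime of `S`. -/
def onesAtS {K : Type} [Field K] (S : Set (FFPrime K)) (B : Type) [Field B]
    [Algebra K B] : Set B :=
  {x : B | ∀ V : FFVal B, (∃ v ∈ S, V.RestrictsTo v (algebraMap K B)) → 0 < V.ord (x - 1)}

/-- A subset of a commutative ring is first-order definable in the language of rings
`{0, 1, +, ·}` with parameters from the ring. -/
def FODefinable {R : Type} [CommRing R] (X : Set R) : Prop :=
  letI : FirstOrder.Ring.CompatibleRing R := FirstOrder.Ring.compatibleRingOfRing R
  Set.Definable₁ (Set.univ : Set R) FirstOrder.Language.ring X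

/-- A subset of a commutative ring is existentially (diophantine) definable: it is cut
out by a block of existential quantifiers followed by a system of polynomial equations,
with parameters (coefficients) from the ring. -/
def ExistDefinable {R : Type} [CommRing R] (X : Set R) : Prop :=
  ∃ (k m : ℕ) (P : Fin m → MvPolynomial (Fin (k + 1)) R),
    ∀ x : R, x ∈ X ↔ ∃ y : Fin k → R, ∀ i : Fin m,
      MvPolynomial.eval (Fin.cons x y) (P i) = 0

/-- Solvability of the norm equation `N(y) = b·x^q + b^q` over (every realization of)
the tower `L₂(a^{1/q})/L₂`, where `L₁ = F((1+(b x^q+b^q)⁻¹)^{1/q})` and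
`L₂ = L₁((1+(a+a⁻¹)b⁻¹)^{1/q})`. -/
def NormTower2Solvable (q : ℕ) (F : Type) [Field F] (a b x : F) : Prop :=
  ∀ (M1 : Type) [Field M1] [Algebra F M1] (α1 : M1),
    α1 ^ q = algebraMap F M1 (1 + (b * x ^ q + b ^ q)⁻¹) →
    IntermediateField.adjoin F {α1} = ⊤ →
    ∀ (M2 : Type) [Field M2] [Algebra M1 M2] (α2 : M2),
      α2 ^ q = algebraMap M1 M2 (algebraMap F M1 (1 + (a + a⁻¹) * b⁻¹)) →
      IntermediateField.adjoin M1 {α2} = ⊤ →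
      ∀ (M3 : Type) [Field M3] [Algebra M2 M3] (α3 : M3),
        α3 ^ q = algebraMap M2 M3 (algebraMap M1 M2 (algebraMap F M1 a)) →
        IntermediateField.adjoin M2 {α3} = ⊤ →
        ∃ y : M3, Algebra.norm M2 y = algebraMap M1 M2 (algebraMap F M1 (b * x ^ q + b ^ q))

/-- Solvability of the norm equation `N(y) = b·x^q + b^q` over (every realization of)
the tower `L₄(a^{1/q})/L₄`, where `L₁ = F((1+(b x^q+b^q)⁻¹)^{1/q})`,
`L₃ = L₁((1+x⁻¹)^{1/q})` and `L₄ = L₃((1+(a+a⁻¹)x⁻¹)^{1/q})`. -/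
def NormTower4Solvable (q : ℕ) (F : Type) [Field F] (a b x : F) : Prop :=
  ∀ (M1 : Type) [Field M1] [Algebra F M1] (α1 : M1),
    α1 ^ q = algebraMap F M1 (1 + (b * x ^ q + b ^ q)⁻¹) →
    IntermediateField.adjoin F {α1} = ⊤ →
    ∀ (M3 : Type) [Field M3] [Algebra M1 M3] (α3 : M3),
      α3 ^ q = algebraMap M1 M3 (algebraMap F M1 (1 + x⁻¹)) →
      IntermediateField.adjoin M1 {α3} = ⊤ →
      ∀ (M4 : Type) [Field M4] [Algebra M3 M4] (α4 : M4),
        α4 ^ q = algebraMap M3 M4 (algebraMap M1 M3 (algebraMap F M1 (1 + (a + a⁻¹) * x⁻¹))) →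
        IntermediateField.adjoin M3 {α4} = ⊤ →
        ∀ (M5 : Type) [Field M5] [Algebra M4 M5] (α5 : M5),
          α5 ^ q = algebraMap M4 M5 (algebraMap M3 M4 (algebraMap M1 M3 (algebraMap F M1 a))) →
          IntermediateField.adjoin M4 {α5} = ⊤ →
          ∃ y : M5, Algebra.norm M4 y =
            algebraMap M3 M4 (algebraMap M1 M3 (algebraMap F M1 (b * x ^ q + b ^ q)))

/-- Unsolvability of the norm equation `N(y) = b·x^q + b^q` over (every realization of)
the tower `L₄(a^{1/q})/L₄` as in `NormTower4Solvable`. -/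
def NormTower4Unsolvable (q : ℕ) (F : Type) [Field F] (a b x : F) : Prop :=
  ∀ (M1 : Type) [Field M1] [Algebra F M1] (α1 : M1),
    α1 ^ q = algebraMap F M1 (1 + (b * x ^ q + b ^ q)⁻¹) →
    IntermediateField.adjoin F {α1} = ⊤ →
    ∀ (M3 : Type) [Field M3] [Algebra M1 M3] (α3 : M3),
      α3 ^ q = algebraMap M1 M3 (algebraMap F M1 (1 + x⁻¹)) →
      IntermediateField.adjoin M1 {α3} = ⊤ →
      ∀ (M4 : Type) [Field M4] [Algebra M3 M4] (α4 : M4),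
        α4 ^ q = algebraMap M3 M4 (algebraMap M1 M3 (algebraMap F M1 (1 + (a + a⁻¹) * x⁻¹))) →
        IntermediateField.adjoin M3 {α4} = ⊤ →
        ∀ (M5 : Type) [Field M5] [Algebra M4 M5] (α5 : M5),
          α5 ^ q = algebraMap M4 M5 (algebraMap M3 M4 (algebraMap M1 M3 (algebraMap F M1 a))) →
          IntermediateField.adjoin M4 {α5} = ⊤ →
          ¬ ∃ y : M5, Algebra.norm M4 y =
            algebraMap M3 M4 (algebraMap M1 M3 (algebraMap F M1 (b * x ^ q + b ^ q)))

noncomputable section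

namespace FFPrime

section Basics

variable {K : Type} [Field K] (v : FFPrime K)

/-- Integer valued order (junk value `0` at `0`). -/
def z (x : K) : ℤ := (v.ord x).untopD 0

/-- `ord_v x ≥ n`. -/
def Ge (n : ℤ) (x : K) : Prop := (n : WithTop ℤ) ≤ v.ord x

lemma ord_eq_z {x : K} (hx : x ≠ 0) : v.ord x = (v.z x : WithTop ℤ) := by
  unfold z
  obtain ⟨n, hn⟩ := WithTop.ne_top_iff_exists.mp (v.ord_ne_top x hx)
  rw [← hn]; rfl

lemma ge_iff {n : ℤ} {x : K} : v.Ge n x ↔ x = 0 ∨ n ≤ v.z x := by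
  by_cases hx : x = 0
  · subst hx; simp [Ge, v.ord_zero]
  · simp [Ge, v.ord_eq_z hx, hx]

lemma ge_iff' {n : ℤ} {x : K} (hx : x ≠ 0) : v.Ge n x ↔ n ≤ v.z x := by
  simp [ge_iff, hx]

lemma ge_zero' (n : ℤ) : v.Ge n 0 := by simp [ge_iff]

lemma ge_z (x : K) : v.Ge (v.z x) x := by simp [ge_iff]

lemma z_mul {x y : K} (hx : x ≠ 0) (hy : y ≠ 0) : v.z (x * y) = v.z x + v.z y := by
  have := v.ord_mul x y
  rw [v.ord_eq_z hx, v.ord_eq_z hy, v.ord_eq_z (mul_ne_zero hx hy)] at this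
  exact_mod_cast this

@[simp] lemma z_one : v.z 1 = 0 := by simp [z, v.ord_one]

lemma z_inv (x : K) : v.z x⁻¹ = - v.z x := by
  by_cases hx : x = 0
  · subst hx; simp [z, v.ord_zero]
  have := v.z_mul hx (inv_ne_zero hx)
  rw [mul_inv_cancel₀ hx, z_one] at this
  linarith

lemma z_div {x y : K} (hx : x ≠ 0) (hy : y ≠ 0) : v.z (x / y) = v.z x - v.z y := by
  rw [div_eq_mul_inv, v.z_mul hx (inv_ne_zero hy), z_inv]; ring

lemma z_pow (x : K) (n : ℕ) : v.z (x ^ n) = n * v.z x := by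
  by_cases hx : x = 0
  · subst hx
    cases n <;> simp [z, v.ord_zero, v.ord_one]
  induction n with
  | zero => simp
  | succ n ih => rw [pow_succ, v.z_mul (pow_ne_zero _ hx) hx, ih]; push_cast; ring

lemma z_zpow (x : K) (n : ℤ) : v.z (x ^ n) = n * v.z x := by
  cases n with
  | ofNat n => simp [z_pow]
  | negSucc n => rw [zpow_negSucc, z_inv, z_pow, Int.negSucc_eq]; push_cast; ring

lemma z_neg (x : K) : v.z (-x) = v.z x := by
  have h1 : v.z (-1 : K) = 0 := by
    have h := v.z_pow (-1 : K) 2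
    simp at h
    exact h
  by_cases hx : x = 0
  · simp [hx]
  rw [← neg_one_mul, v.z_mul (by simp) hx, h1, zero_add]

lemma z_prod {ι : Type*} (s : Finset ι) (f : ι → K) (h : ∀ i ∈ s, f i ≠ 0) :
    v.z (∏ i ∈ s, f i) = ∑ i ∈ s, v.z (f i) := by
  classical
  induction s using Finset.induction_on with
  | empty => simp
  | insert a s ha ih =>
    rw [Finset.prod_insert ha, Finset.sum_insert ha, v.z_mul (h _ (by simp)), ih]
    · exact fun i hi => h i (by simp [hi])
    · exact Finset.prod_ne_zero_iff.mpr (fun i hi => h i (by simp [hi]))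

variable {v}

lemma Ge.mono {m n : ℤ} {x : K} (h : v.Ge n x) (hmn : m ≤ n) : v.Ge m x := by
  rw [ge_iff] at *; rcases h with h | h
  · exact Or.inl h
  · exact Or.inr (hmn.trans h)

lemma Ge.neg {n : ℤ} {x : K} (h : v.Ge n x) : v.Ge n (-x) := by
  rw [ge_iff] at *; rw [z_neg, neg_eq_zero]; exact h

lemma Ge.add {n : ℤ} {x y : K} (h : v.Ge n x) (h' : v.Ge n y) : v.Ge n (x + y) :=
  (le_min h h').trans (v.ord_add x y)

lemma Ge.sub {n : ℤ} {x y : K} (h : v.Ge n x) (h' : v.Ge n y) : v.Ge n (x - y) := by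
  rw [sub_eq_add_neg]; exact h.add h'.neg

lemma Ge.mul {m n : ℤ} {x y : K} (h : v.Ge m x) (h' : v.Ge n y) : v.Ge (m + n) (x * y) := by
  rw [ge_iff] at *
  by_cases hx : x = 0
  · simp [hx]
  by_cases hy : y = 0
  · simp [hy]
  rw [v.z_mul hx hy]
  simp [hx, hy] at *
  omega

lemma Ge.pow {m : ℤ} {x : K} (h : v.Ge m x) (n : ℕ) : v.Ge (n * m) (x ^ n) := by
  rw [ge_iff] at *
  by_cases hn : n = 0
  · subst hn; simp
  rcases h with h | h
  · left; simp [h, hn]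
  · right; rw [z_pow]; gcongr

lemma Ge.sum {ι : Type*} {s : Finset ι} {f : ι → K} {n : ℤ} (h : ∀ i ∈ s, v.Ge n (f i)) :
    v.Ge n (∑ i ∈ s, f i) := by
  classical
  induction s using Finset.induction_on with
  | empty => simpa using v.ge_zero' n
  | insert a s ha ih =>
    rw [Finset.sum_insert ha]
    exact (h _ (by simp)).add (ih fun i hi => h i (by simp [hi]))

variable (v)

lemma ge_one' : v.Ge 0 1 := by simp [ge_iff]

lemma ge_pos_iff {x : K} : v.Ge 1 x ↔ 0 < v.ord x := by
  by_cases hx : x = 0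
  · subst hx; simp [Ge, v.ord_zero]
  · rw [v.ge_iff' hx, v.ord_eq_z hx]
    norm_cast

lemma ge_nonneg_iff {x : K} : v.Ge 0 x ↔ 0 ≤ v.ord x := Iff.rfl

lemma ord_eq_zero_iff {x : K} : v.ord x = 0 ↔ x ≠ 0 ∧ v.z x = 0 := by
  by_cases hx : x = 0
  · subst hx; simp [v.ord_zero]
  · rw [v.ord_eq_z hx]; simp [hx]

lemma ne_zero_of_z {x : K} (h : v.z x ≠ 0) : x ≠ 0 := by
  rintro rfl; exact h (by simp [z, v.ord_zero])

/-- The ultrametric equality. -/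
lemma z_add_eq {x y : K} (hx : x ≠ 0) (hy : v.Ge (v.z x + 1) y) :
    x + y ≠ 0 ∧ v.z (x + y) = v.z x := by
  have h1 : ¬ v.Ge (v.z x + 1) (x + y) := by
    intro h
    have := h.sub hy
    rw [add_sub_cancel_right, v.ge_iff' hx] at this
    omega
  have h2 : v.Ge (v.z x) (x + y) := (v.ge_z x).add (hy.mono (by omega))
  rw [ge_iff] at h1 h2
  push Not at h1
  refine ⟨h1.1, ?_⟩
  rcases h2 with h2 | h2
  · exact absurd h2 h1.1
  · omega

lemma z_eq_of_ge {x : K} {n : ℤ} (h1 : v.Ge n x) (h2 : ¬ v.Ge (n + 1) x) :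
    x ≠ 0 ∧ v.z x = n := by
  rw [ge_iff] at h1 h2
  push Not at h2
  refine ⟨h2.1, ?_⟩
  rcases h1 with h | h
  · exact absurd h h2.1
  · omega

lemma z_eq_of_sub {x y : K} (hx : x ≠ 0) (h : v.Ge (v.z x + 1) (y - x)) :
    y ≠ 0 ∧ v.z y = v.z x := by
  have := v.z_add_eq hx h
  simpa using this

lemma z_unit_of_sub_one {y : K} (h : v.Ge 1 (y - 1)) : y ≠ 0 ∧ v.z y = 0 := by
  have := v.z_eq_of_sub (x := 1) (y := y) one_ne_zero (by simpa using h)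
  simpa using this

lemma exists_z (n : ℤ) : ∃ x : K, x ≠ 0 ∧ v.z x = n := by
  obtain ⟨x, hx⟩ := v.ord_surj n
  have hx0 : x ≠ 0 := by
    rintro rfl; rw [v.ord_zero] at hx; exact WithTop.top_ne_coe hx
  refine ⟨x, hx0, ?_⟩
  rw [v.ord_eq_z hx0] at hx
  exact_mod_cast hx

lemma ext_ord {v w : FFPrime K} (h : v.ord = w.ord) : v = w := by
  cases v; cases w; cases h; rfl

lemma ext_z {v w : FFPrime K} (h : ∀ x : K, x ≠ 0 → v.z x = w.z x) : v = w := by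
  apply ext_ord
  funext x
  by_cases hx : x = 0
  · subst hx; rw [v.ord_zero, w.ord_zero]
  · rw [v.ord_eq_z hx, w.ord_eq_z hx, h x hx]

lemma eq_of_ge {v w : FFPrime K} (h : ∀ x : K, v.Ge 0 x → w.Ge 0 x) : v = w := by
  have hu : ∀ x : K, x ≠ 0 → v.z x = 0 → w.z x = 0 := by
    intro x hx h0
    have h1 := h x ((v.ge_iff' hx).mpr h0.ge)
    have h2 := h x⁻¹ ((v.ge_iff' (inv_ne_zero hx)).mpr (by rw [z_inv, h0, neg_zero]))
    rw [w.ge_iff' hx] at h1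
    rw [w.ge_iff' (inv_ne_zero hx), z_inv] at h2
    omega
  obtain ⟨π, hπ0, hπ⟩ := v.exists_z 1
  have hw : ∀ x : K, x ≠ 0 → w.z x = v.z x * w.z π := by
    intro x hx
    have hp : π ^ (v.z x) ≠ 0 := zpow_ne_zero _ hπ0
    have := hu (x / π ^ (v.z x)) (div_ne_zero hx hp)
      (by rw [v.z_div hx hp, z_zpow, hπ]; ring)
    rw [w.z_div hx hp, z_zpow] at this
    linarith
  obtain ⟨y, hy0, hy⟩ := w.exists_z 1
  have h0 : 0 ≤ w.z π := by
    have := h π ((v.ge_iff' hπ0).mpr (by omega))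
    rwa [w.ge_iff' hπ0] at this
  have h1 : w.z π = 1 := by
    have := hw y hy0
    rw [hy] at this
    have := Int.isUnit_iff.mp (IsUnit.of_mul_eq_one _ ((mul_comm _ _).trans this.symm))
    omega
  apply ext_z
  intro x hx
  rw [hw x hx, h1, mul_one]

lemma exists_sep {v w : FFPrime K} (h : v ≠ w) : ∃ x : K, x ≠ 0 ∧ v.z x < 0 ∧ 0 < w.z x := by
  have h1 : ∃ x, v.Ge 0 x ∧ ¬ w.Ge 0 x := by
    by_contra hc; push Not at hc; exact h (eq_of_ge hc)
  have h2 : ∃ x, w.Ge 0 x ∧ ¬ v.Ge 0 x := by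
    by_contra hc; push Not at hc; exact h (eq_of_ge hc).symm
  obtain ⟨x, hx1, hx2⟩ := h1
  obtain ⟨y, hy1, hy2⟩ := h2
  have hx0 : x ≠ 0 := by rintro rfl; exact hx2 (w.ge_zero' 0)
  have hy0 : y ≠ 0 := by rintro rfl; exact hy2 (v.ge_zero' 0)
  rw [ge_iff' _ hx0] at hx1 hx2
  rw [ge_iff' _ hy0] at hy1 hy2
  refine ⟨y / x, div_ne_zero hy0 hx0, ?_, ?_⟩
  · rw [z_div _ hy0 hx0]; omega
  · rw [z_div _ hy0 hx0]; omega

lemma z_one_add_of_neg {x : K} (h : v.z x < 0) : 1 + x ≠ 0 ∧ v.z (1 + x) = v.z x := by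
  rw [add_comm]
  refine v.z_add_eq (v.ne_zero_of_z h.ne) ?_
  exact v.ge_one'.mono (by omega)

lemma z_one_add_of_pos {x : K} (h : v.Ge 1 x) : 1 + x ≠ 0 ∧ v.z (1 + x) = 0 := by
  have := v.z_add_eq (x := 1) (y := x) one_ne_zero (by simpa using h)
  simpa using this

lemma exists_sep_finset (v : FFPrime K) (S : Finset (FFPrime K)) (hv : v ∉ S) :
    ∃ x : K, x ≠ 0 ∧ v.z x < 0 ∧ ∀ w ∈ S, 0 < w.z x := by
  classical
  induction S using Finset.induction_on with
  | empty =>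
    obtain ⟨x, hx, h⟩ := v.exists_z (-1)
    exact ⟨x, hx, by omega, by simp⟩
  | insert w S hw ih =>
    simp only [Finset.mem_insert, not_or] at hv
    obtain ⟨x, hx0, hxv, hxS⟩ := ih hv.2
    obtain ⟨y, hy0, hyv, hyw⟩ := exists_sep hv.1
    set n : ℕ := 1 + ∑ u ∈ S, (u.z y).natAbs with hn
    have hnb : ∀ u ∈ S, (1 : ℤ) ≤ n * u.z x + u.z y := by
      intro u hu
      have h1 : (u.z y).natAbs ≤ ∑ u ∈ S, (u.z y).natAbs :=
        Finset.single_le_sum (f := fun u : FFPrime K => (u.z y).natAbs)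
          (fun _ _ => Nat.zero_le _) hu
      have h2 : (n : ℤ) ≤ n * u.z x := by
        have := hxS u hu
        nlinarith
      have h3 : (1 : ℤ) + (u.z y).natAbs ≤ n := by rw [hn]; exact_mod_cast Nat.add_le_add_left h1 1
      omega
    rcases lt_trichotomy (w.z x) 0 with h | h | h
    · have hneg : ∀ u : FFPrime K, u.z x < 0 → u.z (x ^ n) < 0 := by
        intro u hu; rw [z_pow]; have : (0:ℤ) < n := by omega
        nlinarith
      have hv1 := v.z_one_add_of_neg (hneg v hxv)
      have hw1 := w.z_one_add_of_neg (hneg w h)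
      have hxn : x ^ n ≠ 0 := pow_ne_zero _ hx0
      have hd : x ^ n / (1 + x ^ n) ≠ 0 := div_ne_zero hxn hv1.1
      refine ⟨y * (x ^ n / (1 + x ^ n)), mul_ne_zero hy0 hd, ?_, ?_⟩
      · rw [v.z_mul hy0 hd, v.z_div hxn hv1.1, hv1.2]; omega
      · intro u hu
        rw [u.z_mul hy0 hd, u.z_div hxn hv1.1]
        rcases Finset.mem_insert.mp hu with rfl | hu
        · rw [hw1.2]; omega
        · have h1 := u.z_one_add_of_pos (x := x ^ n) (by
            rw [ge_iff' _ hxn, z_pow]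
            have := hxS u hu
            have : (1:ℤ) ≤ n := by omega
            nlinarith)
          rw [h1.2, z_pow]
          have := hnb u hu
          omega
    · refine ⟨x ^ n * y, mul_ne_zero (pow_ne_zero _ hx0) hy0, ?_, ?_⟩
      · rw [z_mul _ (pow_ne_zero _ hx0) hy0, z_pow]
        have : (0:ℤ) ≤ n := by omega
        nlinarith
      · intro u hu
        rw [z_mul _ (pow_ne_zero _ hx0) hy0, z_pow]
        rcases Finset.mem_insert.mp hu with rfl | hu
        · rw [h]; omega
        · have := hnb u hu; omega
    · exact ⟨x, hx0, hxv, by simpa using ⟨h, hxS⟩⟩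

lemma approx_idem (v : FFPrime K) (S : Finset (FFPrime K)) (hv : v ∉ S) (n : ℕ) :
    ∃ e : K, v.Ge n (e - 1) ∧ ∀ w ∈ S, w.Ge n e := by
  obtain ⟨x, hx0, hxv, hxS⟩ := exists_sep_finset v S hv
  have hxn : x ^ (n + 1) ≠ 0 := pow_ne_zero _ hx0
  have h1 := v.z_one_add_of_neg (x := x ^ (n + 1)) (by
    rw [z_pow]; push_cast; nlinarith)
  refine ⟨x ^ (n + 1) / (1 + x ^ (n + 1)), ?_, ?_⟩
  · have : x ^ (n + 1) / (1 + x ^ (n + 1)) - 1 = -(1 + x ^ (n + 1))⁻¹ := by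
      have := h1.1
      field_simp
      ring
    rw [this]
    apply Ge.neg
    rw [ge_iff' _ (inv_ne_zero h1.1), z_inv, h1.2, z_pow]
    push_cast
    nlinarith
  · intro w hw
    have h2 := hxS w hw
    have h3 : w.Ge (n + 1) (x ^ (n + 1)) := by
      rw [ge_iff' _ hxn, z_pow]; push_cast; nlinarith
    have h4 := w.z_one_add_of_pos (x := x ^ (n + 1)) (h3.mono (by omega))
    rw [ge_iff' _ (div_ne_zero hxn h4.1), z_div _ hxn h4.1, h4.2]
    rw [ge_iff' _ hxn] at h3
    omega

/-- Weak approximation. -/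
lemma approx (S : Finset (FFPrime K)) (f : FFPrime K → K) (n : ℤ) :
    ∃ x : K, ∀ v ∈ S, v.Ge n (x - f v) := by
  classical
  set N : ℕ := n.natAbs + ∑ v ∈ S, ∑ u ∈ S, (v.z (f u)).natAbs with hN
  have hNb : ∀ v ∈ S, ∀ u ∈ S, n ≤ N + v.z (f u) := by
    intro v hv u hu
    have h1 : (v.z (f u)).natAbs ≤ ∑ u ∈ S, (v.z (f u)).natAbs :=
      Finset.single_le_sum (f := fun u : FFPrime K => (v.z (f u)).natAbs)
          (fun _ _ => Nat.zero_le _) hu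
    have h2 : ∑ u ∈ S, (v.z (f u)).natAbs ≤ ∑ v ∈ S, ∑ u ∈ S, (v.z (f u)).natAbs :=
      Finset.single_le_sum (f := fun v : FFPrime K => ∑ u ∈ S, (v.z (f u)).natAbs)
          (fun _ _ => Nat.zero_le _) hv
    omega
  have h : ∀ v : FFPrime K, ∃ e : K, v.Ge N (e - 1) ∧ ∀ w ∈ S.erase v, w.Ge N e := fun v =>
    approx_idem v (S.erase v) (by simp) N
  choose e he1 he2 using h
  refine ⟨∑ u ∈ S, e u * f u, fun v hv => ?_⟩
  rw [← Finset.add_sum_erase S _ hv]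
  have : e v * f v + ∑ u ∈ S.erase v, e u * f u - f v =
    (e v - 1) * f v + ∑ u ∈ S.erase v, e u * f u := by ring
  rw [this]
  apply Ge.add
  · exact ((he1 v).mul (v.ge_z (f v))).mono (hNb v hv v hv)
  · apply Ge.sum
    intro u hu
    have hu' := Finset.mem_erase.mp hu
    exact ((he2 u v (by simp [hv, hu'.1.symm])).mul (v.ge_z (f u))).mono (hNb v hv u hu'.2)

lemma exists_z_finset (S : Finset (FFPrime K)) (m : FFPrime K → ℤ) :
    ∃ x : K, x ≠ 0 ∧ ∀ v ∈ S, v.z x = m v := by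
  classical
  rcases S.eq_empty_or_nonempty with rfl | ⟨v0, hv0⟩
  · exact ⟨1, one_ne_zero, by simp⟩
  choose f hf0 hf using fun v : FFPrime K => v.exists_z (m v)
  set N : ℤ := ∑ v ∈ S, |m v| + 1
  obtain ⟨x, hx⟩ := approx S f N
  have key : ∀ v ∈ S, x ≠ 0 ∧ v.z x = m v := by
    intro v hv
    have h1 : |m v| ≤ ∑ v ∈ S, |m v| :=
      Finset.single_le_sum (f := fun v : FFPrime K => |m v|) (fun _ _ => abs_nonneg _) hv
    have := v.z_eq_of_sub (hf0 v) ((hx v hv).mono (by rw [hf]; have := le_abs_self (m v); omega))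
    rwa [hf] at this
  exact ⟨x, (key v0 hv0).1, fun v hv => (key v hv).2⟩

/-- Pull back along a field automorphism. -/
def comap {L : Type} [Field L] (w : FFPrime L) (τ : K ≃+* L) : FFPrime K where
  ord x := w.ord (τ x)
  ord_zero := by simp [w.ord_zero]
  ord_ne_top x hx := w.ord_ne_top _ (by simpa using hx)
  ord_one := by simp [w.ord_one]
  ord_mul x y := by simp [w.ord_mul]
  ord_add x y := by simp only [map_add]; exact w.ord_add _ _
  ord_surj n := by
    obtain ⟨x, hx⟩ := w.ord_surj n
    exact ⟨τ.symm x, by simpa using hx⟩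

@[simp] lemma comap_z {L : Type} [Field L] (w : FFPrime L) (τ : K ≃+* L) (x : K) :
    (w.comap τ).z x = w.z (τ x) := rfl

@[simp] lemma comap_ge {L : Type} [Field L] (w : FFPrime L) (τ : K ≃+* L) (n : ℤ) (x : K) :
    (w.comap τ).Ge n x ↔ w.Ge n (τ x) := Iff.rfl

end Basics

end FFPrime

end

noncomputable section
namespace FFPrime

/-- `w` lies over `v` with (integer) ramification index `e`. -/
def Ov {K L : Type} [Field K] [Field L] [Algebra K L] (w : FFPrime L) (v : FFPrime K) (e : ℤ) :
    Prop := 0 < e ∧ ∀ x : K, w.z (algebraMap K L x) = e * v.z x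

section ov
variable {K L : Type} [Field K] [Field L] [Algebra K L] {w : FFPrime L} {v : FFPrime K} {e : ℤ}

lemma Ov.z (h : Ov w v e) (x : K) : w.z (algebraMap K L x) = e * v.z x := h.2 x

lemma Ov.ge_mul_iff (h : Ov w v e) (n : ℤ) (x : K) :
    w.Ge (e * n) (algebraMap K L x) ↔ v.Ge n x := by
  rw [ge_iff, ge_iff, h.z, mul_le_mul_iff_of_pos_left h.1]
  simp

lemma Ov.ge_zero_iff (h : Ov w v e) (x : K) :
    w.Ge 0 (algebraMap K L x) ↔ v.Ge 0 x := by
  simpa using h.ge_mul_iff 0 x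

lemma Ov.ge_one_iff (h : Ov w v e) (x : K) :
    w.Ge 1 (algebraMap K L x) ↔ v.Ge 1 x := by
  rw [ge_iff, ge_iff, h.z]
  simp only [map_eq_zero]
  have := h.1
  refine or_congr Iff.rfl ⟨fun h => ?_, fun h => ?_⟩ <;> nlinarith

lemma Ov.e_eq (h : Ov w v e) {e' : ℤ} (h' : Ov w v e') : e = e' := by
  obtain ⟨x, hx, hx1⟩ := v.exists_z 1
  have := h.z x
  rw [h'.z x, hx1] at this
  linarith

lemma Ov.v_eq (h : Ov w v e) {v' : FFPrime K} {e' : ℤ} (h' : Ov w v' e') : v = v' := by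
  apply eq_of_ge
  intro x hx
  rwa [← h'.ge_zero_iff, h.ge_zero_iff]

lemma Ov.trans {M : Type} [Field M] [Algebra L M] [Algebra K M] [IsScalarTower K L M]
    {u : FFPrime M} {e' : ℤ} (h' : Ov u w e') (h : Ov w v e) : Ov u v (e' * e) := by
  refine ⟨mul_pos h'.1 h.1, fun x => ?_⟩
  rw [IsScalarTower.algebraMap_apply K L M, h'.z, h.z, mul_assoc]

end ov

section ofFun
variable {K : Type} [Field K]

theorem ofFun (f : K → ℤ) (hmul : ∀ x y, x ≠ 0 → y ≠ 0 → f (x * y) = f x + f y)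
    (hadd : ∀ x y n, x ≠ 0 → y ≠ 0 → x + y ≠ 0 → n ≤ f x → n ≤ f y → n ≤ f (x + y))
    (hnt : ∃ x, x ≠ 0 ∧ f x ≠ 0) :
    ∃ (v : FFPrime K) (e : ℤ), 0 < e ∧ ∀ x, x ≠ 0 → f x = e * v.z x := by
  have h1 : f 1 = 0 := by
    have := hmul 1 1 one_ne_zero one_ne_zero
    simp at this; exact this
  have hinv : ∀ x, x ≠ 0 → f x⁻¹ = - f x := by
    intro x hx
    have := hmul x x⁻¹ hx (inv_ne_zero hx)
    rw [mul_inv_cancel₀ hx, h1] at this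
    linarith
  let G : AddSubgroup ℤ :=
    { carrier := {n | ∃ x, x ≠ 0 ∧ f x = n}
      zero_mem' := ⟨1, one_ne_zero, h1⟩
      add_mem' := by
        rintro _ _ ⟨x, hx, rfl⟩ ⟨y, hy, rfl⟩
        exact ⟨x * y, mul_ne_zero hx hy, hmul x y hx hy⟩
      neg_mem' := by
        rintro _ ⟨x, hx, rfl⟩
        exact ⟨x⁻¹, inv_ne_zero hx, hinv x hx⟩ }
  obtain ⟨g, hg⟩ := Int.subgroup_cyclic G
  have hG : ∀ n, n ∈ G ↔ g ∣ n := by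
    intro n
    rw [hg, AddSubgroup.mem_closure_singleton, dvd_def]
    simp [eq_comm, mul_comm]
  obtain ⟨x0, hx0, hfx0⟩ := hnt
  have hg0 : g ≠ 0 := by
    rintro rfl
    have := (hG (f x0)).1 ⟨x0, hx0, rfl⟩
    exact hfx0 (by simpa using this)
  have he : 0 < |g| := abs_pos.2 hg0
  have hdvd : ∀ x, x ≠ 0 → |g| * (f x / |g|) = f x := by
    intro x hx
    apply Int.mul_ediv_cancel'
    rw [abs_dvd]
    exact (hG _).1 ⟨x, hx, rfl⟩
  classical
  let v : FFPrime K :=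
    { ord := fun x => if x = 0 then ⊤ else ((f x / |g| : ℤ) : WithTop ℤ)
      ord_zero := by simp
      ord_ne_top := by intro x hx; simp [hx]
      ord_one := by simp [h1]
      ord_mul := by
        intro x y
        by_cases hx : x = 0
        · simp [hx]
        by_cases hy : y = 0
        · simp [hy]
        simp only [mul_eq_zero, hx, hy, or_self, if_false]
        rw [← WithTop.coe_add]
        congr 1
        apply mul_left_cancel₀ he.ne'
        rw [hdvd _ (mul_ne_zero hx hy), mul_add, hdvd x hx, hdvd y hy, hmul x y hx hy]
      ord_add := by
        intro x y
        by_cases hxy : x + y = 0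
        · simp [hxy]
        by_cases hx : x = 0
        · simp [hx]
        by_cases hy : y = 0
        · simp [hy]
        simp only [hx, hy, hxy, if_false]
        rw [← WithTop.coe_min, WithTop.coe_le_coe]
        apply le_of_mul_le_mul_left _ he
        rw [hdvd _ hxy]
        apply hadd x y _ hx hy hxy
        · conv_rhs => rw [← hdvd x hx]
          exact mul_le_mul_of_nonneg_left (min_le_left _ _) he.le
        · conv_rhs => rw [← hdvd y hy]
          exact mul_le_mul_of_nonneg_left (min_le_right _ _) he.le
      ord_surj := by
        intro n
        obtain ⟨x, hx, hfx⟩ := (hG (|g| * n)).2 ((dvd_abs g g).2 (dvd_refl g) |>.mul_right n)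
        refine ⟨x, ?_⟩
        simp only [hx, if_false]
        rw [hfx, Int.mul_ediv_cancel_left _ he.ne'] }
  refine ⟨v, |g|, he, fun x hx => ?_⟩
  have : v.z x = f x / |g| := by
    simp [FFPrime.z, v, hx]
  rw [this, hdvd x hx]

end ofFun

section restr
variable {K L : Type} [Field K] [Field L] [Algebra K L]

lemma ge_zero_of_monic (w : FFPrime L) (P : Polynomial K) (hP : P.Monic)
    (hc : ∀ i, w.Ge 0 (algebraMap K L (P.coeff i))) {y : L} (hy : Polynomial.aeval y P = 0) :
    w.Ge 0 y := by
  by_contra hcon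
  rw [ge_iff] at hcon
  push Not at hcon
  obtain ⟨hy0, hlt⟩ := hcon
  rw [hP.as_sum, map_add, map_sum] at hy
  simp only [map_mul, map_pow, Polynomial.aeval_X, Polynomial.aeval_C] at hy
  have hpow : y ^ P.natDegree ≠ 0 := pow_ne_zero _ hy0
  have hge : w.Ge (w.z (y ^ P.natDegree) + 1)
      (∑ i ∈ Finset.range P.natDegree, algebraMap K L (P.coeff i) * y ^ i) := by
    apply Ge.sum
    intro i hi
    rw [Finset.mem_range] at hi
    have h1 : w.Ge (w.z (y ^ i)) (y ^ i) := w.ge_z _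
    have h2 := (hc i).mul h1
    refine h2.mono ?_
    rw [w.z_pow, w.z_pow]
    have : (i : ℤ) + 1 ≤ P.natDegree := by exact_mod_cast hi
    nlinarith
  exact (w.z_add_eq hpow hge).1 hy

theorem exists_restrict [Algebra.IsAlgebraic K L] (w : FFPrime L) :
    ∃ (v : FFPrime K) (e : ℤ), Ov w v e := by
  have hinj : ∀ x : K, x ≠ 0 → algebraMap K L x ≠ 0 := fun x hx => by simpa using hx
  obtain ⟨v, e, he, h⟩ := ofFun (fun x : K => w.z (algebraMap K L x))
    (fun x y hx hy => by simp only [map_mul]; exact w.z_mul (hinj x hx) (hinj y hy))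
    (fun x y n hx hy hxy h1 h2 => by
      simp only [map_add]
      rw [← w.ge_iff' (by simpa using hinj _ hxy)]
      exact Ge.add ((w.ge_iff' (hinj x hx)).2 h1) ((w.ge_iff' (hinj y hy)).2 h2))
    (by
      by_contra hcon
      push Not at hcon
      obtain ⟨y, hy, hy1⟩ := w.exists_z (-1)
      have hIntg : IsIntegral K y := Algebra.IsIntegral.isIntegral y
      have := w.ge_zero_of_monic (minpoly K y) (minpoly.monic hIntg) (fun i => by
        rw [ge_iff]
        by_cases h : (minpoly K y).coeff i = 0
        · simp [h]
        · right; rw [hcon _ h]) (minpoly.aeval K y)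
      rw [w.ge_iff' hy, hy1] at this
      omega)
  refine ⟨v, e, he, fun x => ?_⟩
  by_cases hx : x = 0
  · subst hx; simp [FFPrime.z, FFPrime.ord_zero]
  · exact h x hx

/-- the valuation ring as a subring -/
def O (v : FFPrime K) : Subring K where
  carrier := {x | v.Ge 0 x}
  mul_mem' := fun {a b} ha hb => by simpa using Ge.mul ha hb
  one_mem' := v.ge_one'
  add_mem' := fun {a b} ha hb => Ge.add ha hb
  zero_mem' := v.ge_zero' 0
  neg_mem' := fun {a} ha => Ge.neg ha

lemma mem_O {v : FFPrime K} {x : K} : x ∈ v.O ↔ v.Ge 0 x := Iff.rfl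

lemma exists_valsubring (v : FFPrime K) : ∃ B : ValuationSubring L,
    (∀ x : K, v.Ge 0 x → B.valuation (algebraMap K L x) ≤ 1) ∧
    (∀ x : K, v.Ge 1 x → B.valuation (algebraMap K L x) < 1) := by
  let A : Subring L := v.O.map (algebraMap K L)
  let I : Ideal A :=
    { carrier := {x | ∃ y : K, v.Ge 1 y ∧ algebraMap K L y = x}
      zero_mem' := ⟨0, v.ge_zero' 1, by simp⟩
      add_mem' := by
        rintro a b ⟨x, hx, hx'⟩ ⟨y, hy, hy'⟩
        exact ⟨x + y, hx.add hy, by simp [hx', hy']⟩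
      smul_mem' := by
        rintro ⟨c, x, hx, hx'⟩ b ⟨y, hy, hy'⟩
        refine ⟨x * y, by simpa using Ge.mul (mem_O.1 hx) hy, ?_⟩
        simp [hx', hy'] }
  have hI : I ≠ ⊤ := by
    intro h
    have : (1 : A) ∈ I := by rw [h]; trivial
    obtain ⟨y, hy, hy'⟩ := this
    have : y = 1 := by
      apply (algebraMap K L).injective; rw [hy']; simp
    rw [this, v.ge_iff' one_ne_zero, v.z_one] at hy
    omega
  obtain ⟨B, hB1, hB2⟩ := Ideal.image_subset_nonunits_valuationSubring I hI
  refine ⟨B, fun x hx => ?_, fun x hx => ?_⟩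
  · rw [B.valuation_le_one_iff]
    exact hB1 ⟨x, hx, rfl⟩
  · rw [← ValuationSubring.mem_nonunits_iff]
    exact hB2 ⟨⟨algebraMap K L x, x, hx.mono (by norm_num), rfl⟩, ⟨x, hx, rfl⟩, rfl⟩

theorem exists_extend [FiniteDimensional K L] (v : FFPrime K) :
    ∃ (w : FFPrime L) (e : ℤ), Ov w v e := by
  obtain ⟨B, hB0, hB1⟩ := exists_valsubring (L := L) v
  set val := B.valuation with hval
  have hunit : ∀ x : K, x ≠ 0 → v.z x = 0 → val (algebraMap K L x) = 1 := by
    intro x hx h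
    apply le_antisymm (hB0 x (by rw [v.ge_iff' hx, h]))
    have := hB0 x⁻¹ (by rw [v.ge_iff' (inv_ne_zero hx), v.z_inv, h]; simp)
    rw [map_inv₀, map_inv₀] at this
    have hpos : 0 < val (algebraMap K L x) := by
      rw [Valuation.pos_iff]; simpa using hx
    exact (inv_le_one₀ hpos).1 this
  have hmono : ∀ x y : K, x ≠ 0 → y ≠ 0 →
      (val (algebraMap K L x) ≤ val (algebraMap K L y) ↔ v.z y ≤ v.z x) := by
    intro x y hx hy
    have hypos : 0 < val (algebraMap K L y) := by
      rw [Valuation.pos_iff]; simpa using hy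
    have key : val (algebraMap K L x) = val (algebraMap K L (x / y)) * val (algebraMap K L y) := by
      rw [← map_mul, ← map_mul, div_mul_cancel₀ _ hy]
    constructor
    · intro h
      by_contra hcon
      push Not at hcon
      have h1 := hB1 (y / x) (by rw [v.ge_iff' (div_ne_zero hy hx), v.z_div hy hx]; omega)
      rw [map_div₀, map_div₀, div_lt_one₀ (by rw [Valuation.pos_iff]; simpa using hx)] at h1
      exact absurd h (not_le.2 h1)
    · intro h
      rw [key]
      have := hB0 (x / y) (by rw [v.ge_iff' (div_ne_zero hx hy), v.z_div hx hy]; omega)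
      exact mul_le_of_le_one_left' this
  have hex : ∀ y : L, ∃ c : K, y ≠ 0 →
      c ≠ 0 ∧ val y ^ (Module.finrank K L).factorial = val (algebraMap K L c) := by
    intro y
    by_cases hy : y = 0
    · exact ⟨0, fun h => absurd hy h⟩
    set n := Module.finrank K L with hn
    have hdep : ¬ LinearIndependent K (fun i : Fin (n + 1) => y ^ (i : ℕ)) := by
      intro h
      have := h.fintype_card_le_finrank
      simp at this
      omega
    rw [Fintype.not_linearIndependent_iff] at hdep
    obtain ⟨g, hg, i0, hi0⟩ := hdep
    -- terms
    let t : Fin (n + 1) → L := fun i => algebraMap K L (g i) * y ^ (i : ℕ)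
    have ht : ∑ i, t i = 0 := by
      simpa [t, Algebra.smul_def] using hg
    obtain ⟨m, -, hm⟩ := Finset.exists_max_image Finset.univ (fun i => val (t i)) ⟨i0, Finset.mem_univ _⟩
    have ht0 : val (t i0) ≠ 0 := by
      rw [Valuation.ne_zero_iff]
      exact mul_ne_zero (by simpa using hi0) (pow_ne_zero _ hy)
    have hm0 : val (t m) ≠ 0 := fun h => ht0 (le_antisymm ((hm i0 (Finset.mem_univ _)).trans h.le) zero_le')
    have : ∃ j, j ≠ m ∧ val (t j) = val (t m) := by
      by_contra hcon
      push Not at hcon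
      have h1 : val (∑ j ∈ Finset.univ.erase m, t j) < val (t m) := by
        apply Valuation.map_sum_lt _ hm0
        intro j hj
        rw [Finset.mem_erase] at hj
        exact lt_of_le_of_ne (hm j (Finset.mem_univ _)) (hcon j hj.1)
      have h2 : t m + ∑ j ∈ Finset.univ.erase m, t j = 0 := by
        rw [Finset.add_sum_erase _ _ (Finset.mem_univ m), ht]
      have h3 : ∑ j ∈ Finset.univ.erase m, t j = - t m := by
        linear_combination h2
      rw [h3, Valuation.map_neg] at h1
      exact lt_irrefl _ h1
    obtain ⟨j, hjm, hj⟩ := this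
    have hgm : g m ≠ 0 := by
      intro h; apply hm0; simp [t, h]
    have hgj : g j ≠ 0 := by
      intro h; apply hm0; rw [← hj]; simp [t, h]
    have hmain : ∀ a b : Fin (n + 1), (a : ℕ) < b → g a ≠ 0 → g b ≠ 0 → val (t a) = val (t b) →
      ∃ c : K, y ≠ 0 → c ≠ 0 ∧ val y ^ n.factorial = val (algebraMap K L c) := by
      intro a b hab ha hb h
      have hvy : val y ≠ 0 := by rwa [Valuation.ne_zero_iff]
      have hstep : val y ^ ((b : ℕ) - a) = val (algebraMap K L (g a / g b)) := by
        simp only [t, map_mul, map_pow] at h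
        rw [map_div₀, map_div₀, eq_div_iff (by rw [Valuation.ne_zero_iff]; simpa using hb)]
        apply mul_right_cancel₀ (pow_ne_zero a hvy)
        rw [h, mul_right_comm, ← pow_add, Nat.sub_add_cancel hab.le, mul_comm]
      obtain ⟨d, hd⟩ : ((b : ℕ) - a) ∣ n.factorial :=
        Nat.dvd_factorial (by omega) (by have := b.2; omega)
      refine ⟨(g a / g b) ^ d, fun _ => ⟨pow_ne_zero _ (div_ne_zero ha hb), ?_⟩⟩
      rw [hd, pow_mul, hstep, map_pow, map_pow]
    rcases lt_or_gt_of_ne (fun h => hjm (Fin.ext h) : (j : ℕ) ≠ m) with h | h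
    · exact hmain j m h hgj hgm hj
    · exact hmain m j h hgm hgj hj.symm
  choose c hc using hex
  set N := (Module.finrank K L).factorial with hN
  have hNpos : N ≠ 0 := Nat.factorial_ne_zero _
  have heq : ∀ x y : K, x ≠ 0 → y ≠ 0 → val (algebraMap K L x) = val (algebraMap K L y) →
      v.z x = v.z y := fun x y hx hy h =>
    le_antisymm ((hmono y x hy hx).1 h.ge) ((hmono x y hx hy).1 h.le)
  have hfle : ∀ x y : L, x ≠ 0 → y ≠ 0 → val x ≤ val y → v.z (c y) ≤ v.z (c x) := by
    intro x y hx hy h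
    rw [← hmono _ _ (hc x hx).1 (hc y hy).1, ← (hc x hx).2, ← (hc y hy).2]
    exact pow_le_pow_left' h N
  have hfK : ∀ x : K, x ≠ 0 → v.z (c (algebraMap K L x)) = N * v.z x := by
    intro x hx
    have hx' : algebraMap K L x ≠ 0 := by simpa using hx
    rw [← v.z_pow]
    apply heq _ _ (hc _ hx').1 (pow_ne_zero _ hx)
    rw [← (hc _ hx').2, map_pow, map_pow]
  obtain ⟨w, e, he, h⟩ := ofFun (fun y => v.z (c y))
    (fun x y hx hy => by
      rw [← v.z_mul (hc x hx).1 (hc y hy).1]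
      apply heq _ _ (hc _ (mul_ne_zero hx hy)).1 (mul_ne_zero (hc x hx).1 (hc y hy).1)
      rw [← (hc _ (mul_ne_zero hx hy)).2, map_mul, map_mul, map_mul, ← (hc x hx).2, ← (hc y hy).2,
        mul_pow])
    (fun x y n hx hy hxy h1 h2 => by
      rcases le_total (val x) (val y) with h | h
      · exact h2.trans (hfle _ _ hxy hy ((val.map_add x y).trans (max_le h le_rfl)))
      · exact h1.trans (hfle _ _ hxy hx ((val.map_add x y).trans (max_le le_rfl h))))
    (by
      obtain ⟨x, hx, hx1⟩ := v.exists_z 1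
      refine ⟨algebraMap K L x, by simpa using hx, ?_⟩
      rw [hfK x hx, hx1]
      simpa using hNpos)
  have hk : ∀ x : K, x ≠ 0 → (N : ℤ) * v.z x = e * w.z (algebraMap K L x) := by
    intro x hx
    rw [← hfK x hx, h _ (by simpa using hx)]
  obtain ⟨x1, hx1, hx11⟩ := v.exists_z 1
  have h1 := hk x1 hx1
  rw [hx11, mul_one] at h1
  refine ⟨w, w.z (algebraMap K L x1), ?_, fun x => ?_⟩
  · have : (0 : ℤ) < N := by exact_mod_cast Nat.pos_of_ne_zero hNpos
    rw [h1] at this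
    exact (pos_iff_pos_of_mul_pos this).1 he
  · by_cases hx : x = 0
    · subst hx; simp [FFPrime.z, FFPrime.ord_zero]
    · have := hk x hx
      rw [h1, mul_assoc] at this
      exact (mul_left_cancel₀ he.ne' this).symm

end restr
end FFPrime

end

noncomputable section
set_option linter.all false
open Finset

/-- A cyclic Kummer datum: `τ` has order dividing `q`, fixed field `K`, and eigenvector `α`. -/
structure Cyc (q : ℕ) (K N : Type) [Field K] [Field N] [Algebra K N] (ζ : K) (τ : N ≃ₐ[K] N)
    (α : N) : Prop where
  hq : q.Prime
  prim : IsPrimitiveRoot ζ q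
  pow : τ ^ q = 1
  fix : ∀ x, τ x = x → ∃ y, algebraMap K N y = x
  ne : α ≠ 0
  act : τ α = algebraMap K N ζ * α

/-- product of conjugates -/
def nm {K N : Type} [Field K] [Field N] [Algebra K N] (q : ℕ) (τ : N ≃ₐ[K] N) (x : N) : N :=
  ∏ i ∈ range q, (τ ^ i) x

namespace Cyc

variable {q : ℕ} {K N : Type} [Field K] [Field N] [Algebra K N] {ζ : K} {τ : N ≃ₐ[K] N} {α : N}

lemma pow_mod (h : Cyc q K N ζ τ α) (n : ℕ) : τ ^ (n % q) = τ ^ n := by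
  conv_rhs => rw [← Nat.mod_add_div n q, pow_add, pow_mul, h.pow, one_pow, mul_one]

lemma act_pow (h : Cyc q K N ζ τ α) (i : ℕ) : (τ ^ i) α = algebraMap K N ζ ^ i * α := by
  induction i with
  | zero => simp
  | succ i ih => rw [pow_succ', AlgEquiv.mul_apply, ih, map_mul, map_pow, AlgEquiv.commutes, h.act]; ring

lemma act_zpow_pow (h : Cyc q K N ζ τ α) (i : ℕ) (j : ℤ) :
    (τ ^ i) (α ^ j) = (algebraMap K N ζ ^ i) ^ j * α ^ j := by
  rw [map_zpow₀, h.act_pow, mul_zpow]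

lemma exists_pow (h : Cyc q K N ζ τ α) : ∃ a : K, algebraMap K N a = α ^ q := by
  apply h.fix
  rw [map_pow, h.act, mul_pow, ← map_pow, h.prim.pow_eq_one]; simp

lemma qne (h : Cyc q K N ζ τ α) : (q : K) ≠ 0 := by
  haveI : NeZero q := ⟨h.hq.ne_zero⟩
  exact h.prim.neZero'.out

/-- any sum of conjugates is fixed -/
lemma sum_shift (h : Cyc q K N ζ τ α) {A : Type} [AddCommMonoid A] (f : (N ≃ₐ[K] N) → A) :
    ∑ i ∈ range q, f (τ ^ (i + 1)) = ∑ i ∈ range q, f (τ ^ i) := by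
  obtain ⟨m, rfl⟩ : ∃ m, q = m + 1 := ⟨q - 1, by have := h.hq.pos; omega⟩
  rw [sum_range_succ, h.pow, sum_range_succ' (fun i => f (τ ^ i))]
  simp

lemma prod_shift (h : Cyc q K N ζ τ α) {A : Type} [CommMonoid A] (f : (N ≃ₐ[K] N) → A) :
    ∏ i ∈ range q, f (τ ^ (i + 1)) = ∏ i ∈ range q, f (τ ^ i) := by
  obtain ⟨m, rfl⟩ : ∃ m, q = m + 1 := ⟨q - 1, by have := h.hq.pos; omega⟩
  rw [prod_range_succ, h.pow, prod_range_succ' (fun i => f (τ ^ i))]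
  simp

lemma exists_tr (h : Cyc q K N ζ τ α) (x : N) :
    ∃ y : K, algebraMap K N y = ∑ i ∈ range q, (τ ^ i) x := by
  apply h.fix
  rw [map_sum, ← h.sum_shift (fun g => g x)]
  apply sum_congr rfl
  intro i _
  rw [pow_succ', AlgEquiv.mul_apply]

lemma exists_nm (h : Cyc q K N ζ τ α) (x : N) :
    ∃ y : K, algebraMap K N y = nm q τ x := by
  apply h.fix
  rw [nm, map_prod, ← h.prod_shift (fun g => g x)]
  apply prod_congr rfl
  intro i _
  rw [pow_succ', AlgEquiv.mul_apply]

/-- coefficients -/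
def coef (h : Cyc q K N ζ τ α) (x : N) (j : ℕ) : K :=
  (q : K)⁻¹ * (h.exists_tr (x * (α ^ j)⁻¹)).choose

lemma coef_spec (h : Cyc q K N ζ τ α) (x : N) (j : ℕ) :
    algebraMap K N (h.coef x j) = (q : N)⁻¹ * ∑ i ∈ range q, (τ ^ i) (x * (α ^ j)⁻¹) := by
  rw [coef, map_mul, (h.exists_tr (x * (α ^ j)⁻¹)).choose_spec]
  simp

lemma qneN (h : Cyc q K N ζ τ α) : (q : N) ≠ 0 := by
  intro h0
  apply h.qne
  apply (algebraMap K N).injective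
  rw [map_natCast, h0, map_zero]

lemma primN (h : Cyc q K N ζ τ α) : IsPrimitiveRoot (algebraMap K N ζ) q :=
  h.prim.map_of_injective (algebraMap K N).injective

lemma zne (h : Cyc q K N ζ τ α) : algebraMap K N ζ ≠ 0 := h.primN.ne_zero h.hq.ne_zero

lemma geom (h : Cyc q K N ζ τ α) {i : ℕ} (hi : i < q) :
    ∑ j ∈ range q, (algebraMap K N ζ ^ i) ^ j = if i = 0 then (q : N) else 0 := by
  split_ifs with h0
  · simp [h0]
  · have hne : algebraMap K N ζ ^ i ≠ 1 := h.primN.pow_ne_one_of_pos_of_lt h0 hi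
    have := geom_sum_mul (algebraMap K N ζ ^ i) q
    rw [← pow_mul, mul_comm i q, pow_mul, h.primN.pow_eq_one, one_pow, sub_self] at this
    exact (mul_eq_zero.1 this).resolve_right (sub_ne_zero.2 hne)

lemma expand (h : Cyc q K N ζ τ α) (x : N) :
    x = ∑ j ∈ range q, algebraMap K N (h.coef x j) * α ^ j := by
  have h1 : ∀ j ∈ range q, algebraMap K N (h.coef x j) * α ^ j =
      ∑ i ∈ range q, (q : N)⁻¹ * (τ ^ i) x * ((algebraMap K N ζ ^ i) ^ j)⁻¹ := by
    intro j _
    rw [coef_spec, mul_sum, sum_mul]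
    apply sum_congr rfl
    intro i _
    have hα : α ^ j ≠ 0 := pow_ne_zero _ h.ne
    have hz : (algebraMap K N ζ ^ i) ^ j ≠ 0 := pow_ne_zero _ (pow_ne_zero _ h.zne)
    rw [map_mul, map_inv₀, map_pow (τ ^ i) α j, h.act_pow, mul_pow]
    field_simp
  rw [sum_congr rfl h1, sum_comm]
  have h2 : ∀ i ∈ range q, ∑ j ∈ range q, (q : N)⁻¹ * (τ ^ i) x * ((algebraMap K N ζ ^ i) ^ j)⁻¹ =
      if i = 0 then x else 0 := by
    intro i hi
    rw [mem_range] at hi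
    rw [← mul_sum]
    have : ∑ j ∈ range q, ((algebraMap K N ζ ^ i) ^ j)⁻¹ = if i = 0 then (q : N) else 0 := by
      have hprim : IsPrimitiveRoot (algebraMap K N ζ)⁻¹ q := h.primN.inv
      split_ifs with h0
      · simp [h0]
      · have hne : (algebraMap K N ζ)⁻¹ ^ i ≠ 1 := hprim.pow_ne_one_of_pos_of_lt h0 hi
        have := geom_sum_mul ((algebraMap K N ζ)⁻¹ ^ i) q
        rw [← pow_mul, mul_comm i q, pow_mul, hprim.pow_eq_one, one_pow, sub_self] at this
        have h3 := (mul_eq_zero.1 this).resolve_right (sub_ne_zero.2 hne)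
        simpa [inv_pow] using h3
    rw [this]
    split_ifs with h0
    · subst h0; simp [h.qneN]
      rw [mul_comm, ← mul_assoc, mul_inv_cancel₀ h.qneN, one_mul]
    · simp
  rw [sum_congr rfl h2]
  simp [h.hq.pos]

lemma coef_unique (h : Cyc q K N ζ τ α) (c : ℕ → K) {j : ℕ} (hj : j < q) :
    h.coef (∑ l ∈ range q, algebraMap K N (c l) * α ^ l) j = c j := by
  apply (algebraMap K N).injective
  rw [coef_spec]
  have h1 : ∀ i ∈ range q, (τ ^ i) ((∑ l ∈ range q, algebraMap K N (c l) * α ^ l) * (α ^ j)⁻¹) =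
      ∑ l ∈ range q, algebraMap K N (c l) * α ^ l * (α ^ j)⁻¹ *
        ((algebraMap K N ζ ^ i) ^ l * ((algebraMap K N ζ ^ i) ^ j)⁻¹) := by
    intro i _
    rw [map_mul, map_sum, sum_mul]
    apply sum_congr rfl
    intro l _
    rw [map_mul, AlgEquiv.commutes, map_inv₀, map_pow (τ ^ i) α, map_pow (τ ^ i) α, h.act_pow,
      mul_pow, mul_pow, mul_inv]
    ring
  rw [sum_congr rfl h1, sum_comm]
  have h2 : ∀ l ∈ range q, ∑ i ∈ range q, algebraMap K N (c l) * α ^ l * (α ^ j)⁻¹ *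
        ((algebraMap K N ζ ^ i) ^ l * ((algebraMap K N ζ ^ i) ^ j)⁻¹) =
        if l = j then q * algebraMap K N (c j) else 0 := by
    intro l hl
    rw [mem_range] at hl
    rw [← mul_sum]
    split_ifs with hlj
    · subst hlj
      have : ∀ i ∈ range q, (algebraMap K N ζ ^ i) ^ l * ((algebraMap K N ζ ^ i) ^ l)⁻¹ = 1 :=
        fun i _ => mul_inv_cancel₀ (pow_ne_zero _ (pow_ne_zero _ h.zne))
      rw [sum_congr rfl this, mul_assoc, mul_assoc, ← mul_assoc (α ^ l),
        mul_inv_cancel₀ (pow_ne_zero _ h.ne)]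
      simp [mul_comm]
    · set r := algebraMap K N ζ ^ l * (algebraMap K N ζ ^ j)⁻¹ with hr
      have hne : r ≠ 1 := by
        intro hr1
        rw [hr, mul_inv_eq_one₀ (pow_ne_zero _ h.zne)] at hr1
        exact hlj (h.primN.pow_inj hl hj hr1)
      have hrq : r ^ q = 1 := by
        rw [hr, mul_pow, inv_pow, ← pow_mul, ← pow_mul, mul_comm l, mul_comm j, pow_mul, pow_mul,
          h.primN.pow_eq_one]
        simp
      have h3 : ∀ i ∈ range q, (algebraMap K N ζ ^ i) ^ l * ((algebraMap K N ζ ^ i) ^ j)⁻¹ = r ^ i := by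
        intro i _
        rw [hr, mul_pow, inv_pow, ← pow_mul, ← pow_mul, ← pow_mul, ← pow_mul, mul_comm l, mul_comm j]
      rw [sum_congr rfl h3]
      have := geom_sum_mul r q
      rw [hrq, sub_self] at this
      rw [(mul_eq_zero.1 this).resolve_right (sub_ne_zero.2 hne), mul_zero]
  rw [sum_congr rfl h2]
  simp only [sum_ite_eq', mem_range, hj, if_true]
  rw [← mul_assoc, inv_mul_cancel₀ h.qneN, one_mul]

lemma finiteDim (h : Cyc q K N ζ τ α) : FiniteDimensional K N := by
  classical
  refine Module.finite_def.2 ⟨(range q).image (fun j => α ^ j), ?_⟩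
  rw [eq_top_iff]
  intro x _
  rw [h.expand x]
  apply Submodule.sum_mem
  intro j hj
  rw [← Algebra.smul_def]
  apply Submodule.smul_mem
  apply Submodule.subset_span
  simp only [coe_image, Set.mem_image]
  exact ⟨j, hj, rfl⟩

lemma ext_pow (h : Cyc q K N ζ τ α) {σ ρ : N ≃ₐ[K] N} (he : σ α = ρ α) : σ = ρ := by
  ext x
  rw [h.expand x, map_sum, map_sum]
  apply sum_congr rfl
  intro i _
  rw [map_mul, map_mul, map_pow, map_pow, he, AlgEquiv.commutes, AlgEquiv.commutes]

lemma norm_eq (h : Cyc q K N ζ τ α) (x : N) : algebraMap K N (Algebra.norm K x) = nm q τ x := by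
  haveI := h.finiteDim
  have hfix : IntermediateField.fixedField (⊤ : Subgroup (N ≃ₐ[K] N)) = ⊥ := by
    rw [eq_bot_iff]
    intro x hx
    rw [IntermediateField.mem_fixedField_iff] at hx
    obtain ⟨y, hy⟩ := h.fix x (hx τ trivial)
    exact IntermediateField.mem_bot.2 ⟨y, hy⟩
  haveI : IsGalois K N := IsGalois.of_fixedField_eq_bot K N hfix
  rw [Algebra.norm_eq_prod_automorphisms, nm]
  symm
  apply prod_bij (fun i _ => τ ^ i)
  · intro i _; exact mem_univ _
  · intro i hi j hj hij
    rw [mem_range] at hi hj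
    have := congrArg (fun g : N ≃ₐ[K] N => g α) hij
    simp only [h.act_pow] at this
    exact h.primN.pow_inj hi hj (mul_right_cancel₀ h.ne this)
  · intro g _
    have hgα : (g α) ^ q = α ^ q := by
      obtain ⟨a, ha⟩ := h.exists_pow
      rw [← map_pow, ← ha, AlgEquiv.commutes]
    have hone : (g α / α) ^ q = 1 := by
      rw [div_pow, hgα, div_self (pow_ne_zero _ h.ne)]
    haveI : NeZero q := ⟨h.hq.ne_zero⟩
    obtain ⟨i, hi, hi'⟩ := h.primN.eq_pow_of_pow_eq_one hone
    refine ⟨i, mem_range.2 hi, ?_⟩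
    apply h.ext_pow
    rw [h.act_pow, hi', div_mul_cancel₀ _ h.ne]
  · intro i _; rfl

lemma nm_mul (q : ℕ) (τ : N ≃ₐ[K] N) (x y : N) : nm q τ (x * y) = nm q τ x * nm q τ y := by
  simp [nm, prod_mul_distrib]

lemma nm_ne (q : ℕ) (τ : N ≃ₐ[K] N) {x : N} (hx : x ≠ 0) : nm q τ x ≠ 0 := by
  rw [nm, prod_ne_zero_iff]; intro i _; exact (map_ne_zero_iff _ (τ ^ i).injective).2 hx

lemma nm_div (q : ℕ) (τ : N ≃ₐ[K] N) (x y : N) : nm q τ (x / y) = nm q τ x / nm q τ y := by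
  simp [nm, prod_div_distrib]

lemma nm_algebraMap (q : ℕ) (τ : N ≃ₐ[K] N) (x : K) : nm q τ (algebraMap K N x) = algebraMap K N x ^ q := by
  simp [nm]

/-- construct a Kummer datum -/
theorem of_root {ζ : K} (hq : q.Prime) (hζ : IsPrimitiveRoot ζ q) {e : K} {θ : N}
    (hθ : θ ^ q = algebraMap K N e) (htop : IntermediateField.adjoin K {θ} = ⊤)
    (he0 : e ≠ 0) (he : ∀ r : K, r ^ q ≠ e) : ∃ τ : N ≃ₐ[K] N, Cyc q K N ζ τ θ := by
  have hirr : Irreducible (Polynomial.X ^ q - Polynomial.C e) := X_pow_sub_C_irreducible_of_prime hq he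
  haveI : NeZero q := ⟨hq.ne_zero⟩
  have hIntg : IsIntegral K θ := ⟨Polynomial.X ^ q - Polynomial.C e,
    Polynomial.monic_X_pow_sub_C _ hq.ne_zero, by simp [hθ]⟩
  have hprim : (primitiveRoots q K).Nonempty := ⟨ζ, (mem_primitiveRoots hq.pos).2 hζ⟩
  have hmin : minpoly K θ = Polynomial.X ^ q - Polynomial.C e :=
    (minpoly.eq_of_irreducible_of_monic hirr (by simp [hθ])
      (Polynomial.monic_X_pow_sub_C _ hq.ne_zero)).symm
  have hfd : FiniteDimensional K N := by
    have := IntermediateField.adjoin.finiteDimensional hIntg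
    rw [htop] at this
    exact (IntermediateField.topEquiv (F := K) (E := N)).toLinearEquiv.finiteDimensional
  have hfr : Module.finrank K N = q := by
    rw [← IntermediateField.finrank_top', ← htop, IntermediateField.adjoin.finrank hIntg, hmin,
      Polynomial.natDegree_X_pow_sub_C]
  haveI : Polynomial.IsSplittingField K N (Polynomial.X ^ q - Polynomial.C e) := by
    have := isSplittingField_X_pow_sub_C_of_root_adjoin_eq_top (K := K) (L := N) (a := e) (α := θ)
      (by rwa [hfr]) (by rwa [hfr]) htop
    rwa [hfr] at this
  have hθ0 : θ ≠ 0 := by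
    rintro rfl
    rw [zero_pow hq.ne_zero] at hθ
    exact he0 (by simpa using hθ.symm)
  set τ := (autEquivRootsOfUnity hprim hirr N).symm hζ.toRootsOfUnity with hτ
  have hact : τ θ = algebraMap K N ζ * θ := by
    rw [← autEquivRootsOfUnity_smul hprim hirr N (by simpa using hθ) τ, hτ, MulEquiv.apply_symm_apply]
    rw [← Algebra.smul_def]
    rfl
  have hspan : ∀ x : N, ∃ c : ℕ → K, x = ∑ l ∈ range q, algebraMap K N (c l) * θ ^ l := by
    intro x
    have hx : x ∈ (IntermediateField.adjoin K {θ}).toSubalgebra := by rw [htop]; trivial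
    rw [IntermediateField.adjoin_simple_toSubalgebra_of_isAlgebraic hIntg.isAlgebraic,
      Algebra.adjoin_singleton_eq_range_aeval] at hx
    obtain ⟨P, rfl⟩ := hx
    have hmon := Polynomial.monic_X_pow_sub_C e hq.ne_zero
    refine ⟨fun l => (P %ₘ (Polynomial.X ^ q - Polynomial.C e)).coeff l, ?_⟩
    have hdeg : (P %ₘ (Polynomial.X ^ q - Polynomial.C e)).natDegree < q := by
      have := Polynomial.natDegree_modByMonic_lt P hmon (by
        intro h1
        have := congrArg Polynomial.natDegree h1
        rw [Polynomial.natDegree_X_pow_sub_C] at this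
        simp at this
        exact hq.ne_zero this)
      rwa [Polynomial.natDegree_X_pow_sub_C] at this
    have hr : Polynomial.aeval θ (Polynomial.X ^ q - Polynomial.C e) = 0 := by simp [hθ]
    have := Polynomial.aeval_modByMonic_eq_self_of_root (p := P) hr
    change Polynomial.aeval θ P = _
    rw [← this, Polynomial.aeval_eq_sum_range' hdeg]
    simp [Algebra.smul_def]
  have hactp : ∀ i, (τ ^ i) θ = algebraMap K N ζ ^ i * θ := by
    intro i
    induction i with
    | zero => simp
    | succ i ih => rw [pow_succ', AlgEquiv.mul_apply, ih, map_mul, map_pow, AlgEquiv.commutes, hact]; ring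
  have hprimN : IsPrimitiveRoot (algebraMap K N ζ) q := hζ.map_of_injective (algebraMap K N).injective
  refine ⟨τ, hq, hζ, ?_, ?_, hθ0, hact⟩
  · ext x
    obtain ⟨c, hc⟩ := hspan x
    rw [hc, map_sum, map_sum]
    apply sum_congr rfl
    intro l _
    rw [map_mul, map_mul, map_pow, map_pow, AlgEquiv.commutes, AlgEquiv.commutes, hactp,
      hprimN.pow_eq_one]
    simp
  · intro x hx
    obtain ⟨c, hc⟩ := hspan x
    have hqK : (q : K) ≠ 0 := hζ.neZero'.out
    have hqN : (q : N) ≠ 0 := by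
      intro h0
      apply hqK
      apply (algebraMap K N).injective
      rw [map_natCast, h0, map_zero]
    have hxi : ∀ i, (τ ^ i) x = x := by
      intro i
      induction i with
      | zero => simp
      | succ i ih => rw [pow_succ', AlgEquiv.mul_apply, ih, hx]
    have h1 : (q : N) * x = ∑ i ∈ range q, (τ ^ i) x := by
      rw [sum_congr rfl (fun i _ => hxi i)]; simp
    refine ⟨c 0, ?_⟩
    apply mul_left_cancel₀ hqN
    rw [h1]
    have h2 : ∀ i ∈ range q, (τ ^ i) x = ∑ l ∈ range q, algebraMap K N (c l) * θ ^ l *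
        (algebraMap K N ζ ^ l) ^ i := by
      intro i _
      rw [hc, map_sum]
      apply sum_congr rfl
      intro l _
      rw [map_mul, AlgEquiv.commutes, map_pow, hactp]
      ring
    rw [sum_congr rfl h2, sum_comm]
    have h3 : ∀ l ∈ range q, ∑ i ∈ range q, algebraMap K N (c l) * θ ^ l *
        (algebraMap K N ζ ^ l) ^ i = if l = 0 then q * algebraMap K N (c 0) else 0 := by
      intro l hl
      rw [mem_range] at hl
      rw [← mul_sum]
      split_ifs with h0
      · subst h0; simp [mul_comm]
      · have hne : algebraMap K N ζ ^ l ≠ 1 := hprimN.pow_ne_one_of_pos_of_lt h0 hl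
        have := geom_sum_mul (algebraMap K N ζ ^ l) q
        rw [← pow_mul, mul_comm l q, pow_mul, hprimN.pow_eq_one, one_pow, sub_self] at this
        rw [(mul_eq_zero.1 this).resolve_right (sub_ne_zero.2 hne), mul_zero]
    rw [sum_congr rfl h3]
    simp [hq.pos]

end Cyc

/-- Hilbert 90 -/
theorem hilbert90 {K N : Type} [Field K] [Field N] [Algebra K N] {q : ℕ} (hq : q.Prime)
    (τ : N ≃ₐ[K] N) (hτq : τ ^ q = 1) (hτ1 : τ ≠ 1) {x : N} (hx : nm q τ x = 1) :
    ∃ w : N, w ≠ 0 ∧ x = τ w / w := by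
  have hx0 : x ≠ 0 := by
    rintro rfl
    rw [nm, prod_eq_zero (mem_range.2 hq.pos) (by simp)] at hx
    exact zero_ne_one hx
  have hord : orderOf τ = q := orderOf_eq_prime hτq hτ1 (hp := ⟨hq⟩)
  -- partial products of inverses
  let P : ℕ → N := fun i => ∏ j ∈ range i, (τ ^ j) x
  have hP0 : ∀ i, P i ≠ 0 := by
    intro i
    rw [prod_ne_zero_iff]
    intro j _
    exact (map_ne_zero_iff _ (τ ^ j).injective).2 hx0
  have hPs : ∀ i, P (i + 1) = x * τ (P i) := by
    intro i
    simp only [P]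
    rw [prod_range_succ', map_prod, mul_comm]
    simp only [pow_zero, AlgEquiv.one_apply]
    congr 1
    apply prod_congr rfl
    intro j _
    rw [pow_succ', AlgEquiv.mul_apply]
  have hli := linearIndependent_monoidHom N N
  have hinj : Function.Injective (fun i : Fin q => ((τ ^ (i : ℕ) : N ≃ₐ[K] N) : N →* N)) := by
    intro i j hij
    apply Fin.ext
    have : τ ^ (i : ℕ) = τ ^ (j : ℕ) := by
      ext y
      exact DFunLike.congr_fun hij y
    exact pow_injOn_Iio_orderOf (by simp [hord]) (by simp [hord]) this
  have hli2 := hli.comp _ hinj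
  rw [Fintype.linearIndependent_iff] at hli2
  have hex : ∃ y : N, ∑ i ∈ range q, P i * (τ ^ i) y ≠ 0 := by
    by_contra hcon
    push Not at hcon
    have := hli2 (fun i => P i) (by
      funext y
      have := hcon y
      rw [← Fin.sum_univ_eq_sum_range (fun i => P i * (τ ^ i) y)] at this
      simpa using this) ⟨0, hq.pos⟩
    exact hP0 0 this
  obtain ⟨y, hy⟩ := hex
  set w := ∑ i ∈ range q, P i * (τ ^ i) y with hw
  have hτw : x * τ w = w := by
    rw [hw, map_sum, mul_sum]
    have h1 : ∀ i ∈ range q, x * τ (P i * (τ ^ i) y) = P (i + 1) * (τ ^ (i + 1)) y := by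
      intro i _
      rw [map_mul, hPs, pow_succ', AlgEquiv.mul_apply]; ring
    rw [sum_congr rfl h1]
    obtain ⟨m, hm⟩ : ∃ m, q = m + 1 := ⟨q - 1, by have := hq.pos; omega⟩
    have hPq : P q = 1 := hx
    have hlast : P (m + 1) * (τ ^ (m + 1)) y = P 0 * (τ ^ 0) y := by
      rw [← hm, hPq, hτq]; simp [P]
    rw [hm, sum_range_succ, hlast, sum_range_succ' (fun i => P i * (τ ^ i) y)]
  refine ⟨w⁻¹, inv_ne_zero hy, ?_⟩
  have hτw0 : τ w ≠ 0 := (map_ne_zero_iff _ τ.injective).2 hy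
  rw [map_inv₀]
  field_simp
  exact hτw

end

noncomputable section
set_option linter.all false
open Finset

namespace FFPrime

lemma z_natCast {K : Type} [Field K] (p : ℕ) [Fact p.Prime] [CharP K p] (v : FFPrime K) (n : ℕ) :
    v.z (n : K) = 0 := by
  by_cases hn : (n : K) = 0
  · rw [hn]; simp [z, v.ord_zero]
  · have hn' : (n : ZMod p) ≠ 0 := by
      intro h0; apply hn
      rw [CharP.cast_eq_zero_iff K p, ← CharP.cast_eq_zero_iff (ZMod p) p]; exact h0
    have h1 := ZMod.pow_card_sub_one_eq_one hn'
    have h2 : (n : K) ^ (p - 1) = 1 := by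
      have := congrArg (ZMod.castHom (dvd_refl p) K) h1
      simpa using this
    have h3 := congrArg v.z h2
    rw [z_pow, z_one] at h3
    have : ((p - 1 : ℕ) : ℤ) ≠ 0 := by
      have := (Fact.out : p.Prime).two_le
      omega
    exact (mul_eq_zero.1 h3).resolve_left this

lemma z_of_pow_eq_one {K : Type} [Field K] (v : FFPrime K) {x : K} {n : ℕ} (hn : n ≠ 0)
    (h : x ^ n = 1) : v.z x = 0 := by
  have h3 := congrArg v.z h
  rw [z_pow, z_one] at h3
  exact (mul_eq_zero.1 h3).resolve_left (by exact_mod_cast hn)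

lemma Ge.pow_sub {K : Type} [Field K] {v : FFPrime K} {n : ℤ} {x y : K} (h : v.Ge n (x - y))
    (hx : v.Ge 0 x) (hy : v.Ge 0 y) (m : ℕ) : v.Ge n (x ^ m - y ^ m) := by
  rw [← (Commute.all x y).mul_geom_sum₂]
  have : v.Ge 0 (∑ i ∈ range m, x ^ i * y ^ (m - 1 - i)) := by
    apply Ge.sum
    intro i _
    have h1 := hx.pow i
    have h2 := hy.pow (m - 1 - i)
    rw [mul_zero] at h1 h2
    simpa using h1.mul h2
  simpa using h.mul this

/-- z of distinct-order sums -/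
lemma z_sum_distinct {K ι : Type} [Field K] (v : FFPrime K) (s : Finset ι) (t : ι → K)
    (hinj : ∀ i ∈ s, ∀ j ∈ s, t i ≠ 0 → t j ≠ 0 → v.z (t i) = v.z (t j) → i = j)
    (hne : ∃ i ∈ s, t i ≠ 0) :
    ∃ i ∈ s, t i ≠ 0 ∧ v.z (∑ j ∈ s, t j) = v.z (t i) ∧ (∀ j ∈ s, t j ≠ 0 → v.z (t i) ≤ v.z (t j)) := by
  classical
  obtain ⟨i0, hi0, ht0⟩ := hne
  obtain ⟨m, hm, hmin⟩ := exists_min_image (s.filter (fun i => t i ≠ 0)) (fun i => v.z (t i))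
    ⟨i0, mem_filter.2 ⟨hi0, ht0⟩⟩
  rw [mem_filter] at hm
  refine ⟨m, hm.1, hm.2, ?_, fun j hj hj0 => hmin j (mem_filter.2 ⟨hj, hj0⟩)⟩
  rw [← add_sum_erase s t hm.1]
  refine (v.z_add_eq hm.2 ?_).2
  apply Ge.sum
  intro j hj
  rw [mem_erase] at hj
  rw [ge_iff]
  by_cases hj0 : t j = 0
  · exact Or.inl hj0
  · right
    have h1 := hmin j (mem_filter.2 ⟨hj.2, hj0⟩)
    have h2 : v.z (t m) ≠ v.z (t j) := fun h => hj.1 (hinj m hm.1 j hj.2 hm.2 hj0 h).symm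
    omega

variable {K N : Type} [Field K] [Field N] [Algebra K N]

/-- twist of a place by an automorphism -/
def cm (W : FFPrime N) (τ : N ≃ₐ[K] N) : FFPrime N := W.comap τ.toRingEquiv

@[simp] lemma cm_z (W : FFPrime N) (τ : N ≃ₐ[K] N) (x : N) : (W.cm τ).z x = W.z (τ x) := by
  simp [cm]

@[simp] lemma cm_ge (W : FFPrime N) (τ : N ≃ₐ[K] N) (n : ℤ) (x : N) :
    (W.cm τ).Ge n x ↔ W.Ge n (τ x) := by
  simp [cm]

lemma cm_mul (W : FFPrime N) (τ σ : N ≃ₐ[K] N) : W.cm (τ * σ) = (W.cm τ).cm σ := by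
  apply ext_z; intro x _; simp

lemma cm_one (W : FFPrime N) : W.cm (1 : N ≃ₐ[K] N) = W := by
  apply ext_z; intro x _; simp

lemma cm_pow_of_eq {W : FFPrime N} {τ : N ≃ₐ[K] N} (h : W.cm τ = W) (i : ℕ) : W.cm (τ ^ i) = W := by
  induction i with
  | zero => rw [pow_zero, cm_one]
  | succ i ih => rw [pow_succ, cm_mul, ih, h]

lemma Ov.cm {W : FFPrime N} {v : FFPrime K} {e : ℤ} (h : Ov W v e) (τ : N ≃ₐ[K] N) :
    Ov (W.cm τ) v e := by
  refine ⟨h.1, fun x => ?_⟩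
  rw [cm_z, AlgEquiv.commutes, h.z]

lemma z_nm (W : FFPrime N) (q : ℕ) (τ : N ≃ₐ[K] N) {x : N} (hx : x ≠ 0) :
    W.z (nm q τ x) = ∑ i ∈ range q, W.z ((τ ^ i) x) := by
  rw [nm, z_prod]
  intro i _
  exact (map_ne_zero_iff _ (τ ^ i).injective).2 hx

lemma z_nm_of_eq {W : FFPrime N} (q : ℕ) {τ : N ≃ₐ[K] N} (h : W.cm τ = W) {x : N} (hx : x ≠ 0) :
    W.z (nm q τ x) = q * W.z x := by
  rw [z_nm W q τ hx]
  have : ∀ i ∈ range q, W.z ((τ ^ i) x) = W.z x := by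
    intro i _
    rw [← cm_z, cm_pow_of_eq h]
  rw [sum_congr rfl this]; simp

end FFPrime

namespace Cyc
open FFPrime
variable {q : ℕ} {K N : Type} [Field K] [Field N] [Algebra K N] {ζ : K} {τ : N ≃ₐ[K] N} {α : N}

open Classical in
/-- orbit of a place -/
def orb (h : Cyc q K N ζ τ α) (W : FFPrime N) : Finset (FFPrime N) :=
  (range q).image (fun i => W.cm (τ ^ i))

lemma mem_orb (h : Cyc q K N ζ τ α) {W U : FFPrime N} : U ∈ h.orb W ↔ ∃ i, U = W.cm (τ ^ i) := by
  classical
  rw [orb, mem_image]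
  constructor
  · rintro ⟨i, _, rfl⟩; exact ⟨i, rfl⟩
  · rintro ⟨i, rfl⟩
    exact ⟨i % q, mem_range.2 (Nat.mod_lt _ h.hq.pos), by rw [h.pow_mod]⟩

lemma self_mem_orb (h : Cyc q K N ζ τ α) (W : FFPrime N) : W ∈ h.orb W :=
  h.mem_orb.2 ⟨0, by rw [pow_zero, cm_one]⟩

lemma orb_cm (h : Cyc q K N ζ τ α) {W U : FFPrime N} (hU : U ∈ h.orb W) (i : ℕ) :
    U.cm (τ ^ i) ∈ h.orb W := by
  obtain ⟨j, rfl⟩ := h.mem_orb.1 hU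
  rw [← cm_mul, ← pow_add]
  exact h.mem_orb.2 ⟨_, rfl⟩

lemma orb_symm (h : Cyc q K N ζ τ α) {W U : FFPrime N} (hU : U ∈ h.orb W) : W ∈ h.orb U := by
  obtain ⟨j, rfl⟩ := h.mem_orb.1 hU
  refine h.mem_orb.2 ⟨j * (q - 1), ?_⟩
  rw [← cm_mul, ← pow_add]
  have : j + j * (q - 1) = q * j := by
    obtain ⟨m, hm⟩ : ∃ m, q = m + 1 := ⟨q - 1, by have := h.hq.pos; omega⟩
    rw [hm]; simp; ring
  rw [this, pow_mul, h.pow, one_pow, cm_one]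

theorem conj (h : Cyc q K N ζ τ α) {W W' : FFPrime N} {v : FFPrime K} {e e' : ℤ}
    (hW : Ov W v e) (hW' : Ov W' v e') : ∃ s < q, W' = W.cm (τ ^ s) := by
  classical
  by_contra hcon
  push Not at hcon
  have hn : W' ∉ h.orb W := by
    intro hm
    rw [orb, mem_image] at hm
    obtain ⟨s, hs, hs'⟩ := hm
    exact hcon s (mem_range.1 hs) hs'.symm
  have hdisj : ∀ U ∈ h.orb W', U ∉ h.orb W := by
    intro U hU hU'
    apply hn
    obtain ⟨i, hi⟩ := h.mem_orb.1 (h.orb_symm hU)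
    rw [hi]
    exact h.orb_cm hU' i
  obtain ⟨x, hx⟩ := approx (h.orb W ∪ h.orb W') (fun U => if U ∈ h.orb W then 1 else 0) 1
  have hx1 : ∀ i, W.Ge 1 ((τ ^ i) x - 1) := by
    intro i
    have hm : W.cm (τ ^ i) ∈ h.orb W := h.mem_orb.2 ⟨i, rfl⟩
    have := hx _ (mem_union_left _ hm)
    rw [if_pos hm, cm_ge, map_sub, map_one] at this
    exact this
  have hx2 : ∀ i, W'.Ge 1 ((τ ^ i) x) := by
    intro i
    have hm : W'.cm (τ ^ i) ∈ h.orb W' := h.mem_orb.2 ⟨i, rfl⟩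
    have := hx _ (mem_union_right _ hm)
    rw [if_neg (hdisj _ hm), cm_ge, sub_zero] at this
    exact this
  have hx0 : x ≠ 0 := by
    have := (W.z_unit_of_sub_one (hx1 0)).1
    simpa using this
  obtain ⟨y, hy⟩ := h.exists_nm x
  have hz1 : W.z (nm q τ x) = 0 := by
    rw [z_nm W q τ hx0]
    apply sum_eq_zero
    intro i _
    exact (W.z_unit_of_sub_one (hx1 i)).2
  have hz2 : 0 < W'.z (nm q τ x) := by
    rw [z_nm W' q τ hx0]
    apply sum_pos
    · intro i _
      have := hx2 i
      rw [W'.ge_iff' ((map_ne_zero_iff _ (τ ^ i).injective).2 hx0)] at this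
      omega
    · exact ⟨0, mem_range.2 h.hq.pos⟩
  rw [← hy, hW.z] at hz1
  rw [← hy, hW'.z] at hz2
  have : v.z y = 0 := (mul_eq_zero.1 hz1).resolve_left hW.1.ne'
  rw [this] at hz2
  simp at hz2

lemma cm_pow_ne (h : Cyc q K N ζ τ α) {W : FFPrime N} (hW : W.cm τ ≠ W) {i : ℕ}
    (hi : 0 < i) (hiq : i < q) : W.cm (τ ^ i) ≠ W := by
  intro he
  apply hW
  have hcop : Nat.Coprime i q :=
    ((Nat.Prime.coprime_iff_not_dvd h.hq).2 (Nat.not_dvd_of_pos_of_lt hi hiq)).symm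
  obtain ⟨m, -, hm⟩ := Nat.exists_mul_mod_eq_one_of_coprime hcop h.hq.one_lt
  have := cm_pow_of_eq he m
  rw [← pow_mul, ← h.pow_mod, hm, pow_one] at this
  exact this

lemma coef_ge (p : ℕ) [Fact p.Prime] [CharP N p] (h : Cyc q K N ζ τ α) {W : FFPrime N} {n m : ℤ} (hα : W.z α = m)
    {x : N} (hx : ∀ i < q, W.Ge n ((τ ^ i) x)) (j : ℕ) :
    W.Ge (n - j * m) (algebraMap K N (h.coef x j)) := by
  rw [h.coef_spec]
  have hq0 : W.Ge 0 ((q : N)⁻¹) := by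
    rw [W.ge_iff' (inv_ne_zero h.qneN), z_inv, z_natCast p]; simp
  have := Ge.mul hq0 (n := n - j * m) (y := ∑ i ∈ range q, (τ ^ i) (x * (α ^ j)⁻¹)) (by
    apply Ge.sum
    intro i hi
    rw [map_mul, sub_eq_add_neg]
    apply Ge.mul (hx i (mem_range.1 hi))
    have h0 : (τ ^ i) (α ^ j)⁻¹ ≠ 0 :=
      (map_ne_zero_iff _ (τ ^ i).injective).2 (inv_ne_zero (pow_ne_zero _ h.ne))
    rw [W.ge_iff' h0, map_inv₀, map_pow, h.act_pow, z_inv, z_pow,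
      z_mul _ (pow_ne_zero _ h.zne) h.ne, z_pow, W.z_of_pow_eq_one h.hq.ne_zero h.primN.pow_eq_one, hα]
    simp)
  simpa using this

/-- Lemma U: adjoining the root of a unit is unramified. -/
theorem unram (p : ℕ) [Fact p.Prime] [CharP N p] (h : Cyc q K N ζ τ α) {W : FFPrime N} {v : FFPrime K} {e : ℤ}
    (hW : Ov W v e) (hα : W.z α = 0) : e = 1 := by
  by_contra hne
  have he2 : 2 ≤ e := by have := hW.1; omega
  obtain ⟨x, hx0, hx⟩ := exists_z_finset (h.orb W) (fun _ => 1)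
  have hxi : ∀ i < q, W.Ge 1 ((τ ^ i) x) := by
    intro i _
    have := hx _ (h.mem_orb.2 ⟨i, rfl⟩)
    rw [cm_z] at this
    rw [W.ge_iff' ((map_ne_zero_iff _ (τ ^ i).injective).2 hx0), this]
  have hc : ∀ j, W.Ge 2 (algebraMap K N (h.coef x j)) := by
    intro j
    have := h.coef_ge p hα hxi j
    rw [mul_zero, sub_zero, hW.ge_one_iff, ← hW.ge_mul_iff, mul_one] at this
    exact this.mono he2
  have : W.Ge 2 x := by
    rw [h.expand x]
    apply Ge.sum
    intro j _
    have h2 : W.Ge 0 (α ^ j) := by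
      rw [W.ge_iff' (pow_ne_zero _ h.ne), z_pow, hα]; simp
    simpa using (hc j).mul h2
  rw [W.ge_iff' hx0, hx W (h.self_mem_orb W)] at this
  omega

/-- Residues are generated by `α`. -/
theorem residue (p : ℕ) [Fact p.Prime] [CharP N p] (h : Cyc q K N ζ τ α) {W : FFPrime N} {v : FFPrime K} {e : ℤ}
    (hW : Ov W v e) (hα : W.z α = 0) {x : N} (hx : W.Ge 0 x) :
    ∃ c : ℕ → K, (∀ j, v.Ge 0 (c j)) ∧ W.Ge 1 (x - ∑ j ∈ range q, algebraMap K N (c j) * α ^ j) := by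
  classical
  obtain ⟨y, hy⟩ := approx (h.orb W) (fun U => if U = W then x else 0) 1
  have hyW : W.Ge 1 (y - x) := by simpa using hy W (h.self_mem_orb W)
  have hyi : ∀ i < q, W.Ge 0 ((τ ^ i) y) := by
    intro i _
    rw [← cm_ge]
    by_cases he : W.cm (τ ^ i) = W
    · rw [he]
      have := (hyW.mono (by norm_num : (0 : ℤ) ≤ 1)).add hx
      simpa using this
    · have := hy _ (h.mem_orb.2 ⟨i, rfl⟩)
      rw [if_neg he, sub_zero] at this
      exact this.mono (by norm_num)
  refine ⟨h.coef y, fun j => ?_, ?_⟩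
  · have := h.coef_ge p hα hyi j
    rwa [mul_zero, sub_zero, hW.ge_zero_iff] at this
  · rw [← h.expand y]
    have := hyW.neg
    simpa using this

/-- Lemma R -/
theorem residue_pow (h : Cyc q K N ζ τ α) {W : FFPrime N} {v : FFPrime K} {e : ℤ}
    (hW : Ov W v e) (hα : W.z α = 0) (hne : W.cm τ ≠ W) {a : K} (ha : algebraMap K N a = α ^ q) :
    ∃ r : K, v.Ge 1 (r ^ q - a) := by
  classical
  obtain ⟨y, hy⟩ := approx (h.orb W) (fun U => if U = W then 1 else 0) 1
  have hyW : W.Ge 1 (y - 1) := by simpa using hy W (h.self_mem_orb W)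
  have hyi : ∀ i, 0 < i → i < q → W.Ge 1 ((τ ^ i) y) := by
    intro i hi hiq
    have := hy _ (h.mem_orb.2 ⟨i, rfl⟩)
    rw [if_neg (h.cm_pow_ne hne hi hiq), sub_zero, cm_ge] at this
    exact this
  obtain ⟨r, hr⟩ := h.exists_tr (y * α)
  refine ⟨r, ?_⟩
  have hα0 : W.Ge 0 α := by rw [W.ge_iff' h.ne, hα]
  have hrα : W.Ge 1 (algebraMap K N r - α) := by
    obtain ⟨m, hm⟩ : ∃ m, q = m + 1 := ⟨q - 1, by have := h.hq.pos; omega⟩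
    rw [hr, hm, sum_range_succ']
    have h1 : W.Ge 1 (∑ i ∈ range m, (τ ^ (i + 1)) (y * α)) := by
      apply Ge.sum
      intro i hi
      rw [mem_range] at hi
      rw [map_mul]
      have h2 : W.Ge 0 ((τ ^ (i + 1)) α) := by
        rw [h.act_pow, W.ge_iff' (mul_ne_zero (pow_ne_zero _ h.zne) h.ne),
          z_mul _ (pow_ne_zero _ h.zne) h.ne, z_pow,
          W.z_of_pow_eq_one h.hq.ne_zero h.primN.pow_eq_one, hα]
        simp
      simpa using (hyi (i + 1) (by omega) (by omega)).mul h2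
    have h3 : W.Ge 1 ((y - 1) * α) := by simpa using hyW.mul hα0
    have := h1.add h3
    convert this using 1
    simp; ring
  rw [← hW.ge_one_iff, map_sub, map_pow, ha]
  have hr0 : W.Ge 0 (algebraMap K N r) := by
    have := (hrα.mono (by norm_num : (0 : ℤ) ≤ 1)).add hα0
    simpa using this
  exact hrα.pow_sub hr0 hα0 q


end Cyc

namespace FFPrime
variable {K : Type} [Field K]

lemma eq_one_of_ge (p : ℕ) [Fact p.Prime] [CharP K p] {q : ℕ} (hq : q.Prime) (hq0 : (q : K) ≠ 0)
    {W : FFPrime K} {η : K} (hη : η ^ q = 1) (h : W.Ge 1 (η - 1)) : η = 1 := by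
  by_contra hne
  have hs : ∑ i ∈ range q, η ^ i = 0 := by
    have := mul_neg_geom_sum η q
    rw [hη, sub_self] at this
    exact (mul_eq_zero.1 this).resolve_left (sub_ne_zero.2 (Ne.symm hne))
  have h0 : W.Ge 0 η := by
    rw [W.ge_iff' (by rintro rfl; simp [hq.ne_zero] at hη), W.z_of_pow_eq_one hq.ne_zero hη]
  have h1 : W.Ge 1 (∑ i ∈ range q, (η ^ i - 1 ^ i)) :=
    Ge.sum (fun i _ => h.pow_sub h0 (by simpa using W.ge_one') i)
  simp only [one_pow, sum_sub_distrib, hs] at h1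
  simp only [sum_const, card_range, nsmul_eq_mul, mul_one, zero_sub] at h1
  have h2 := h1.neg
  rw [neg_neg, W.ge_iff' hq0, z_natCast p] at h2
  omega

lemma exists_root_ge {q : ℕ} (hq : q.Prime) {ζ : K} (hζ : IsPrimitiveRoot ζ q) {W : FFPrime K} {x y : K}
    (hx : W.Ge 0 x) (hy : W.Ge 0 y) (h : W.Ge 1 (x ^ q - y ^ q)) : ∃ i : ℕ, W.Ge 1 (x - ζ ^ i * y) := by
  by_contra hcon
  push Not at hcon
  haveI : NeZero q := ⟨hq.ne_zero⟩
  rw [hζ.pow_sub_pow_eq_prod_sub_mul _ _ hq.pos] at h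
  have key : ∀ η ∈ Polynomial.nthRootsFinset q (1 : K), x - η * y ≠ 0 ∧ W.z (x - η * y) = 0 := by
    intro η hη
    rw [Polynomial.mem_nthRootsFinset hq.pos] at hη
    obtain ⟨i, _, rfl⟩ := hζ.eq_pow_of_pow_eq_one hη
    have h1 := hcon i
    have h0 : W.Ge 0 (ζ ^ i) := by
      rw [W.ge_iff' (by rintro h0; rw [h0] at hη; simp [hq.ne_zero] at hη), W.z_of_pow_eq_one hq.ne_zero hη]
    have h2 : W.Ge 0 (x - ζ ^ i * y) := hx.sub (by simpa using h0.mul hy)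
    rw [ge_iff] at h1 h2
    push Not at h1
    refine ⟨h1.1, ?_⟩
    have := h2.resolve_left h1.1
    omega
  rw [W.ge_iff' (prod_ne_zero_iff.2 (fun η hη => (key η hη).1)), z_prod _ _ _ (fun η hη => (key η hη).1),
    sum_eq_zero (fun η hη => (key η hη).2)] at h
  omega

end FFPrime

namespace Cyc
open FFPrime
variable {q : ℕ} {K N : Type} [Field K] [Field N] [Algebra K N] {ζ : K} {τ : N ≃ₐ[K] N} {α : N}

/-- converse of Lemma R -/
theorem cm_ne_of_residue (p : ℕ) [Fact p.Prime] [CharP N p] (h : Cyc q K N ζ τ α) {W : FFPrime N} {v : FFPrime K} {e : ℤ}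
    (hW : Ov W v e) (hα : W.z α = 0) {a r : K} (ha : algebraMap K N a = α ^ q)
    (hr : v.Ge 1 (r ^ q - a)) : W.cm τ ≠ W := by
  intro heq
  have hα0 : W.Ge 0 α := by rw [W.ge_iff' h.ne, hα]
  have h1 : W.Ge 1 (algebraMap K N r ^ q - α ^ q) := by
    rw [← ha, ← map_pow, ← map_sub, hW.ge_one_iff]; exact hr
  have ha0 : W.Ge 0 (α ^ q) := by simpa using hα0.pow q
  have hr0 : W.Ge 0 (algebraMap K N r) := by
    have h2 := (h1.mono (by norm_num : (0:ℤ) ≤ 1)).add ha0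
    rw [sub_add_cancel] at h2
    rw [ge_iff] at h2 ⊢
    rcases h2 with h2 | h2
    · left; exact pow_eq_zero_iff h.hq.ne_zero |>.1 h2
    · right; rw [z_pow] at h2
      have : (0 : ℤ) < q := by exact_mod_cast h.hq.pos
      nlinarith
  have h1' : W.Ge 1 (α ^ q - algebraMap K N r ^ q) := by
    have := h1.neg; rwa [neg_sub] at this
  obtain ⟨i, hi⟩ := exists_root_ge h.hq h.primN hα0 hr0 h1'
  have h3 := hi
  rw [← heq, cm_ge, map_sub, map_mul, map_pow, h.act, AlgEquiv.commutes, AlgEquiv.commutes] at h3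
  have h4 := h3.sub hi
  rw [sub_sub_sub_cancel_right, ← sub_one_mul] at h4
  have h5 : W.Ge 1 (algebraMap K N ζ - 1) := by
    have h6 : W.Ge 0 α⁻¹ := by rw [W.ge_iff' (inv_ne_zero h.ne), z_inv, hα]; simp
    have := h4.mul h6
    rwa [mul_assoc, mul_inv_cancel₀ h.ne, mul_one, add_zero] at this
  exact h.primN.ne_one h.hq.one_lt (eq_one_of_ge p h.hq h.qneN h.primN.pow_eq_one h5)

theorem twist (h : Cyc q K N ζ τ α) {i : ℕ} (hi : Nat.Coprime i q) {c : K} (hc : c ≠ 0) :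
    Cyc q K N (ζ ^ i) τ (α ^ i * algebraMap K N c) where
  hq := h.hq
  prim := h.prim.pow_of_coprime i hi
  pow := h.pow
  fix := h.fix
  ne := mul_ne_zero (pow_ne_zero _ h.ne) ((map_ne_zero _).2 hc)
  act := by rw [map_mul, map_pow, h.act, AlgEquiv.commutes, mul_pow, map_pow, mul_assoc]

section ram

lemma ram_aux (h : Cyc q K N ζ τ α) {W : FFPrime N} {v : FFPrime K} {e : ℤ}
    (hW : Ov W v e) {a : K} (ha : algebraMap K N a = α ^ q) (hva : v.z a = 1) : e = q * W.z α ∧ 0 < W.z α := by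
  have h1 := congrArg W.z ha
  rw [hW.z, hva, mul_one, z_pow] at h1
  refine ⟨h1, ?_⟩
  have := hW.1
  have hq : (0 : ℤ) < q := by exact_mod_cast h.hq.pos
  nlinarith

lemma ram_term (h : Cyc q K N ζ τ α) {W : FFPrime N} {v : FFPrime K} {e : ℤ}
    (hW : Ov W v e) {a : K} (ha : algebraMap K N a = α ^ q) (hva : v.z a = 1) (c : K) (hc : c ≠ 0) (j : ℕ) : W.z (algebraMap K N c * α ^ j) = W.z α * (q * v.z c + j) := by
  rw [z_mul _ ((map_ne_zero _).2 hc) (pow_ne_zero _ h.ne), hW.z, z_pow, (h.ram_aux hW ha hva).1]; ring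

lemma ram_inj (h : Cyc q K N ζ τ α) {W : FFPrime N} {v : FFPrime K} {e : ℤ}
    (hW : Ov W v e) {a : K} (ha : algebraMap K N a = α ^ q) (hva : v.z a = 1) (c : ℕ → K) {i j : ℕ} (hi : i < q) (hj : j < q) (hci : c i ≠ 0) (hcj : c j ≠ 0)
    (he : W.z (algebraMap K N (c i) * α ^ i) = W.z (algebraMap K N (c j) * α ^ j)) : i = j := by
  rw [h.ram_term hW ha hva _ hci, h.ram_term hW ha hva _ hcj] at he
  have h1 := mul_left_cancel₀ (h.ram_aux hW ha hva).2.ne' he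
  have h2 : (i : ℤ) % q = (j : ℤ) % q := by
    have := congrArg (· % (q : ℤ)) h1
    simpa [add_comm] using this
  rw [Int.emod_eq_of_lt (by positivity) (by exact_mod_cast hi), Int.emod_eq_of_lt (by positivity) (by exact_mod_cast hj)] at h2
  exact_mod_cast h2

lemma ram_z (h : Cyc q K N ζ τ α) {W : FFPrime N} {v : FFPrime K} {e : ℤ}
    (hW : Ov W v e) {a : K} (ha : algebraMap K N a = α ^ q) (hva : v.z a = 1) (c : ℕ → K) (x : N) (hx : x = ∑ j ∈ range q, algebraMap K N (c j) * α ^ j) (hx0 : x ≠ 0) :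
    ∃ i < q, c i ≠ 0 ∧ W.z x = W.z α * (q * v.z (c i) + i) ∧
      ∀ j < q, c j ≠ 0 → W.z α * (q * v.z (c i) + i) ≤ W.z α * (q * v.z (c j) + j) := by
  have hc : ∀ j, algebraMap K N (c j) * α ^ j ≠ 0 ↔ c j ≠ 0 := by
    intro j; simp [h.ne]
  obtain ⟨i, hi, hi0, hz, hmin⟩ := W.z_sum_distinct (range q) (fun j => algebraMap K N (c j) * α ^ j)
    (fun i hi j hj hi0 hj0 he => h.ram_inj hW ha hva c (mem_range.1 hi) (mem_range.1 hj)
      ((hc i).1 hi0) ((hc j).1 hj0) he) (by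
      by_contra hcon
      push Not at hcon
      exact hx0 (by rw [hx]; exact sum_eq_zero hcon))
  refine ⟨i, mem_range.1 hi, (hc i).1 hi0, ?_, ?_⟩
  · rw [hx, hz, h.ram_term hW ha hva _ ((hc i).1 hi0)]
  · intro j hj hj0
    rw [← h.ram_term hW ha hva _ ((hc i).1 hi0), ← h.ram_term hW ha hva _ hj0]
    exact hmin j (mem_range.2 hj) ((hc j).2 hj0)

theorem ram_e (h : Cyc q K N ζ τ α) {W : FFPrime N} {v : FFPrime K} {e : ℤ}
    (hW : Ov W v e) {a : K} (ha : algebraMap K N a = α ^ q) (hva : v.z a = 1) : e = q ∧ W.z α = 1 := by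
  have h2 : W.z α = 1 := by
    obtain ⟨x, hx0, hx⟩ := W.exists_z 1
    obtain ⟨i, _, _, hz, _⟩ := h.ram_z hW ha hva (h.coef x) x (h.expand x) hx0
    rw [hx] at hz
    have := Int.eq_one_or_neg_one_of_mul_eq_one hz.symm
    have h3 := (h.ram_aux hW ha hva).2
    omega
  refine ⟨?_, h2⟩
  rw [(h.ram_aux hW ha hva).1, h2, mul_one]

lemma act_expand (h : Cyc q K N ζ τ α) {W : FFPrime N} {v : FFPrime K} {e : ℤ}
    (hW : Ov W v e) {a : K} (ha : algebraMap K N a = α ^ q) (hva : v.z a = 1) (x : N) : τ x = ∑ j ∈ range q, algebraMap K N (h.coef x j * ζ ^ j) * α ^ j := by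
  conv_lhs => rw [h.expand x]
  rw [map_sum]
  apply sum_congr rfl
  intro j _
  rw [map_mul, AlgEquiv.commutes, map_pow, h.act, mul_pow, map_mul, map_pow, mul_assoc]

theorem ram_cm (h : Cyc q K N ζ τ α) {W : FFPrime N} {v : FFPrime K} {e : ℤ}
    (hW : Ov W v e) {a : K} (ha : algebraMap K N a = α ^ q) (hva : v.z a = 1) : W.cm τ = W := by
  apply ext_z
  intro x hx0
  rw [cm_z]
  have hx1 : τ x ≠ 0 := (map_ne_zero_iff _ τ.injective).2 hx0
  have hζ0 : ζ ≠ 0 := h.prim.ne_zero h.hq.ne_zero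
  obtain ⟨i, hi, hi0, hz, hmin⟩ := h.ram_z hW ha hva (h.coef x) x (h.expand x) hx0
  obtain ⟨j, hj, hj0, hz', hmin'⟩ := h.ram_z hW ha hva _ (τ x) (h.act_expand hW ha hva x) hx1
  have hc : ∀ c : K, c ≠ 0 → ∀ k : ℕ, v.z (c * ζ ^ k) = v.z c := by
    intro c hc k
    rw [z_mul _ hc (pow_ne_zero _ hζ0), z_pow, v.z_of_pow_eq_one h.hq.ne_zero h.prim.pow_eq_one]
    simp
  have hj1 : h.coef x j ≠ 0 := left_ne_zero_of_mul hj0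
  have h1 := hmin j hj hj1
  have h2 := hmin' i hi (mul_ne_zero hi0 (pow_ne_zero _ hζ0))
  rw [hc _ hj1, hc _ hi0] at h2
  rw [hc _ hj1] at hz'
  rw [hz, hz']
  exact le_antisymm h2 h1

theorem ram_ge (h : Cyc q K N ζ τ α) {W : FFPrime N} {v : FFPrime K} {e : ℤ}
    (hW : Ov W v e) {a : K} (ha : algebraMap K N a = α ^ q) (hva : v.z a = 1) (x : N) (hx : W.Ge 0 x) : W.Ge 1 (τ x - x) := by
  have hz : W.z α = 1 := (h.ram_e hW ha hva).2
  by_cases hx0 : x = 0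
  · rw [hx0, map_zero, sub_zero]; exact W.ge_zero' 1
  obtain ⟨i, hi, hi0, hz', hmin⟩ := h.ram_z hW ha hva (h.coef x) x (h.expand x) hx0
  rw [W.ge_iff' hx0, hz', hz, one_mul] at hx
  have heq : τ x - x = ∑ j ∈ range q, algebraMap K N (h.coef x j * (ζ ^ j - 1)) * α ^ j := by
    conv_lhs => rw [h.act_expand hW ha hva x]; arg 2; rw [h.expand x]
    rw [← sum_sub_distrib]
    apply sum_congr rfl
    intro j _
    rw [← sub_mul, ← map_sub, mul_sub, mul_one]
  rw [heq]
  apply Ge.sum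
  intro j hj
  by_cases hj0 : j = 0
  · subst hj0; simpa using W.ge_zero' 1
  by_cases hc : h.coef x j = 0
  · rw [hc]; simpa using W.ge_zero' 1
  have h1 := hmin j (mem_range.1 hj) hc
  rw [hz, one_mul, one_mul] at h1
  have h2 : W.Ge 1 (algebraMap K N (h.coef x j) * α ^ j) := by
    rw [W.ge_iff' (mul_ne_zero ((map_ne_zero _).2 hc) (pow_ne_zero _ h.ne)),
      h.ram_term hW ha hva _ hc, hz, one_mul]
    by_contra hlt
    have h3 : (q : ℤ) * v.z (h.coef x j) + j = 0 := by omega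
    have h4 : (q : ℤ) ∣ (j : ℤ) := ⟨- v.z (h.coef x j), by linarith⟩
    have h5 : q ∣ j := by exact_mod_cast h4
    exact absurd (Nat.le_of_dvd (Nat.pos_of_ne_zero hj0) h5) (not_le.2 (mem_range.1 hj))
  have h6 : W.Ge 0 (algebraMap K N (ζ ^ j - 1)) := by
    rw [hW.ge_zero_iff]
    apply Ge.sub _ v.ge_one'
    rw [v.ge_iff' (pow_ne_zero _ (h.prim.ne_zero h.hq.ne_zero)), z_pow,
      v.z_of_pow_eq_one h.hq.ne_zero h.prim.pow_eq_one]
    simp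
  have := h2.mul h6
  rw [add_zero] at this
  convert this using 1
  rw [map_mul]; ring

end ram
end Cyc

end

noncomputable section
set_option linter.all false
open Finset Polynomial IntermediateField

/-- function field over `k` -/
def FFd (k K : Type) [Field k] [Field K] [Algebra k K] : Prop :=
  ∃ t : K, Transcendental k t ∧ FiniteDimensional k⟮t⟯ K

section basic
variable {k K : Type} [Field k] [Field K] [Algebra k K]

lemma FFd.ess (h : FFd k K) : Algebra.EssFiniteType k K := by
  obtain ⟨t, ht, hf⟩ := h
  haveI : Algebra.EssFiniteType k k⟮t⟯ := by
    rw [IntermediateField.essFiniteType_iff]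
    exact IntermediateField.fg_adjoin_of_finite (Set.finite_singleton t)
  exact Algebra.EssFiniteType.comp k k⟮t⟯ K

open scoped IntermediateField.algebraAdjoinAdjoin in
theorem FFd.fin (h : FFd k K) {f : K} (hf : Transcendental k f) : FiniteDimensional k⟮f⟯ K := by
  haveI := h.ess
  obtain ⟨t, ht, hfin⟩ := h
  have htr : Algebra.trdeg k K ≤ 1 := by
    haveI : Algebra.IsAlgebraic (Algebra.adjoin k ({t} : Set K)) K :=
      (IsFractionRing.comap_isAlgebraic_iff (A := Algebra.adjoin k ({t} : Set K)) (K := k⟮t⟯) (C := K)).2 inferInstance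
    have := Algebra.IsAlgebraic.trdeg_le_cardinalMk (R := k) (A := K) (s := {t})
    simpa using this
  have hai : AlgebraicIndependent k (fun _ : Unit => f) := by
    rw [algebraicIndependent_unique_type_iff]; exact hf
  have hb : IsTranscendenceBasis k (fun _ : Unit => f) :=
    hai.isTranscendenceBasis_of_trdeg_le_of_finite (by simpa using htr)
  have halg := hb.isAlgebraic_field
  rw [Set.range_const] at halg
  haveI : Algebra.EssFiniteType k⟮f⟯ K := Algebra.EssFiniteType.of_comp k k⟮f⟯ K
  haveI := halg
  exact Algebra.finite_of_essFiniteType_of_isAlgebraic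

open scoped IntermediateField.algebraAdjoinAdjoin in
/-- Lemma A -/
theorem lemA {g : K} (hg : Transcendental k g) (V : Submodule k K) (hgV : ∀ x ∈ V, g * x ∈ V)
    {ι : Type} [Fintype ι] (x : ι → K) (hx : ∀ i, x i ∈ V)
    (hind : ∀ c : ι → k, (∃ y ∈ V, ∑ i, c i • x i = g * y) → ∀ i, c i = 0) :
    LinearIndependent k⟮g⟯ x := by
  have hg0 : g ≠ 0 := by rintro rfl; exact hg (isAlgebraic_zero)
  have key : ∀ n : ℕ, ∀ P : ι → k[X], (∀ i, (P i).natDegree < n) →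
      ∑ i, aeval g (P i) * x i = 0 → ∀ i, P i = 0 := by
    intro n
    induction n with
    | zero => intro P hP; exact fun _ i => absurd (hP i) (by omega)
    | succ n ih =>
      intro P hP hs
      have hPx : ∀ i, P i = X * (P i).divX + C ((P i).coeff 0) := fun i => (X_mul_divX_add (P i)).symm
      have hmemV : ∀ (Q : k[X]) (y : K), y ∈ V → aeval g Q * y ∈ V := by
        intro Q y hy
        induction Q using Polynomial.induction_on' with
        | add a b ha hb => rw [map_add, add_mul]; exact V.add_mem ha hb
        | monomial m a =>
          rw [aeval_monomial, mul_assoc, ← Algebra.smul_def]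
          apply V.smul_mem
          induction m with
          | zero => simpa using hy
          | succ m ih => rw [pow_succ', mul_assoc]; exact hgV _ ih
      have hs' : g * ∑ i, aeval g (P i).divX * x i + ∑ i, (P i).coeff 0 • x i = 0 := by
        rw [mul_sum, ← sum_add_distrib, ← hs]
        apply sum_congr rfl
        intro i _
        conv_rhs => rw [hPx i]
        rw [map_add, map_mul, aeval_X, aeval_C, Algebra.smul_def]; ring
      have hc := hind (fun i => (P i).coeff 0) ⟨-∑ i, aeval g (P i).divX * x i,
        V.neg_mem (V.sum_mem (fun i _ => hmemV _ _ (hx i))), by linear_combination hs'⟩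
      have hz : ∑ i, aeval g (P i).divX * x i = 0 := by
        simp only [hc, zero_smul, sum_const_zero, add_zero] at hs'
        exact (mul_eq_zero.1 hs').resolve_left hg0
      by_cases hn : n = 0
      · intro i
        have h1 := hP i
        have h2 : (P i).natDegree = 0 := by omega
        rw [eq_C_of_natDegree_eq_zero h2, hc i, C_0]
      · have := ih (fun i => (P i).divX) (fun i => by
          rw [natDegree_divX_eq_natDegree_tsub_one]; have := hP i; omega) hz
        intro i
        rw [hPx i, this i, hc i]; simp
  rw [← LinearIndependent.iff_fractionRing (R := Algebra.adjoin k ({g} : Set K)) (K := k⟮g⟯),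
    Fintype.linearIndependent_iff]
  intro r hr
  have hr' : ∀ i, ∃ P : k[X], aeval g P = (r i : K) := by
    intro i
    have h1 : ∀ y ∈ Algebra.adjoin k ({g} : Set K), ∃ P : k[X], aeval g P = y := by
      intro y hy
      rw [Algebra.adjoin_singleton_eq_range_aeval] at hy
      obtain ⟨P, hP⟩ := hy
      exact ⟨P, hP⟩
    exact h1 _ (r i).2
  choose P hP using hr'
  have h0 := key (univ.sup (fun i => (P i).natDegree) + 1) P
    (fun i => Nat.lt_succ_of_le (le_sup (f := fun i => (P i).natDegree) (mem_univ i))) (by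
      rw [← hr]; apply sum_congr rfl; intro i _; rw [hP i]; rfl)
  intro i
  apply Subtype.ext
  rw [← hP i, h0 i]; simp

theorem lemA_finrank (h : FFd k K) {g : K} (hg : Transcendental k g) (V : Submodule k K) (hgV : ∀ x ∈ V, g * x ∈ V)
    (U : Submodule k K) [FiniteDimensional k U] (hU : U ≤ V) (hd : ∀ y ∈ V, g * y ∈ U → g * y = 0) :
    Module.finrank k U ≤ Module.finrank k⟮g⟯ K := by
  haveI := h.fin hg
  let b := Module.finBasis k U
  have := lemA hg V hgV (fun i => (b i : K)) (fun i => hU (b i).2) (by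
    rintro c ⟨y, hy, he⟩
    have h1 : g * y ∈ U := by
      rw [← he]; exact U.sum_mem (fun i _ => U.smul_mem _ (b i).2)
    rw [hd y hy h1] at he
    have h2 : ∑ i, c i • b i = 0 := by
      apply Subtype.ext; simpa using he
    exact Fintype.linearIndependent_iff.1 b.linearIndependent c h2)
  simpa using this.fintype_card_le_finrank
end basic

end

noncomputable section
set_option linter.all false
open Finset Polynomial IntermediateField

namespace FFPrime
variable (k : Type) {K : Type} [Field k] [Finite k] [Field K] [Algebra k K]

lemma z_const (v : FFPrime K) (c : k) : v.z (algebraMap k K c) = 0 := by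
  haveI := Fintype.ofFinite k
  by_cases hc : c = 0
  · rw [hc, map_zero]; simp [z, v.ord_zero]
  · apply v.z_of_pow_eq_one (n := Fintype.card k - 1)
    · have := Fintype.one_lt_card (α := k); omega
    · rw [← map_pow, FiniteField.pow_card_sub_one_eq_one c hc, map_one]

lemma ge_const (v : FFPrime K) (c : k) : v.Ge 0 (algebraMap k K c) := by
  rw [ge_iff]; right; rw [z_const]

/-- balls as submodules -/
def ball (v : FFPrime K) (n : ℤ) : Submodule k K where
  carrier := {x | v.Ge n x}
  zero_mem' := v.ge_zero' n
  add_mem' := fun h h' => h.add h'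
  smul_mem' := fun c x h => by
    change v.Ge n (c • x)
    rw [Algebra.smul_def]; simpa using (v.ge_const k c).mul h

lemma mem_ball {v : FFPrime K} {n : ℤ} {x : K} : x ∈ ball k v n ↔ v.Ge n x := Iff.rfl

/-- valuation ring as algebra -/
def OA (v : FFPrime K) : Subalgebra k K where
  carrier := {x | v.Ge 0 x}
  mul_mem' := fun {a b} ha hb => by simpa using Ge.mul ha hb
  add_mem' := fun h h' => Ge.add h h'
  algebraMap_mem' := fun c => v.ge_const k c

lemma mem_OA {v : FFPrime K} {x : K} : x ∈ OA k v ↔ v.Ge 0 x := Iff.rfl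

/-- maximal ideal -/
def mI (v : FFPrime K) : Ideal (OA k v) where
  carrier := {x | v.Ge 1 (x : K)}
  zero_mem' := v.ge_zero' 1
  add_mem' := fun h h' => Ge.add h h'
  smul_mem' := fun c x h => by
    have := ((mem_OA k).1 c.2).mul h
    simpa using this

lemma mem_mI {v : FFPrime K} {x : OA k v} : x ∈ mI k v ↔ v.Ge 1 (x : K) := Iff.rfl

instance (v : FFPrime K) : (mI k v).IsMaximal := by
  rw [Ideal.isMaximal_iff]
  constructor
  · intro h
    have : v.Ge 1 (1 : K) := h
    rw [v.ge_iff' one_ne_zero, z_one] at this; omega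
  · intro J x hJ hx hxJ
    have hx' : ¬ v.Ge 1 (x : K) := hx
    have h0 := (mem_OA k).1 x.2
    rw [ge_iff] at hx' h0
    push Not at hx'
    have hz : v.z (x : K) = 0 := by
      have := h0.resolve_left hx'.1; omega
    have hi : (x : K)⁻¹ ∈ OA k v := by
      rw [mem_OA, v.ge_iff' (inv_ne_zero hx'.1), z_inv, hz]; simp
    have := J.mul_mem_left ⟨_, hi⟩ hxJ
    convert this using 1
    apply Subtype.ext
    simp [hx'.1]

/-- residue field -/
def kap (v : FFPrime K) : Type := OA k v ⧸ mI k v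

instance (v : FFPrime K) : CommRing (kap k v) := inferInstanceAs (CommRing (OA k v ⧸ mI k v))
instance (v : FFPrime K) : Algebra k (kap k v) := inferInstanceAs (Algebra k (OA k v ⧸ mI k v))
instance (v : FFPrime K) : IsDomain (kap k v) := inferInstanceAs (IsDomain (OA k v ⧸ mI k v))


/-- residue map -/
def rmk (v : FFPrime K) : OA k v →ₐ[k] kap k v := Ideal.Quotient.mkₐ k (mI k v)

lemma rmk_surj (v : FFPrime K) : Function.Surjective (rmk k v) := Ideal.Quotient.mk_surjective

lemma rmk_zero {v : FFPrime K} (x : OA k v) : rmk k v x = 0 ↔ v.Ge 1 (x : K) :=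
  Ideal.Quotient.eq_zero_iff_mem

/-- degree -/
def deg (v : FFPrime K) : ℕ := Module.finrank k (kap k v)

lemma rmk_eq {v : FFPrime K} (x y : OA k v) : rmk k v x = rmk k v y ↔ v.Ge 1 ((x : K) - y) := by
  rw [← sub_eq_zero, ← map_sub, rmk_zero]; rfl

/-- uniformizer -/
def unif (v : FFPrime K) : K := (v.exists_z 1).choose
lemma unif_ne (v : FFPrime K) : v.unif ≠ 0 := (v.exists_z 1).choose_spec.1
lemma unif_z (v : FFPrime K) : v.z v.unif = 1 := (v.exists_z 1).choose_spec.2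

lemma ge_unif {v : FFPrime K} {n m : ℤ} {x : K} : v.Ge n (x * v.unif ^ m) ↔ v.Ge (n - m) x := by
  have h0 := zpow_ne_zero m v.unif_ne
  by_cases hx : x = 0
  · subst hx; simp [v.ge_zero']
  · rw [v.ge_iff' (mul_ne_zero hx h0), v.ge_iff' hx, z_mul _ hx h0, z_zpow, unif_z]; constructor <;> intro h <;> linarith

/-- leading coefficient map -/
def res (v : FFPrime K) (n : ℤ) : ball k v n →ₗ[k] kap k v where
  toFun x := rmk k v ⟨(x : K) * v.unif ^ (-n), by rw [mem_OA, ge_unif, sub_neg_eq_add, zero_add]; exact x.2⟩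
  map_add' x y := by
    rw [← map_add]; congr 1; apply Subtype.ext; simp [add_mul]
  map_smul' c x := by
    rw [RingHom.id_apply, ← map_smul]; congr 1; apply Subtype.ext; simp

lemma res_eq_zero {v : FFPrime K} {n : ℤ} (x : ball k v n) : res k v n x = 0 ↔ v.Ge (n + 1) (x : K) := by
  change rmk k v _ = 0 ↔ _
  rw [rmk_zero]
  change v.Ge 1 (_ * _) ↔ _
  rw [ge_unif]; simp [add_comm]

lemma res_eq {v : FFPrime K} {n : ℤ} (x y : ball k v n) : res k v n x = res k v n y ↔ v.Ge (n + 1) ((x : K) - y) := by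
  rw [← sub_eq_zero, ← map_sub, res_eq_zero]; rfl

lemma res_surj (v : FFPrime K) (n : ℤ) : Function.Surjective (res k v n) := by
  intro c
  obtain ⟨y, rfl⟩ := rmk_surj k v c
  refine ⟨⟨(y : K) * v.unif ^ n, ?_⟩, ?_⟩
  · rw [mem_ball, ge_unif, sub_self]; exact y.2
  · change rmk k v _ = _
    congr 1
    apply Subtype.ext
    change (y : K) * v.unif ^ n * v.unif ^ (-n) = y
    rw [mul_assoc, ← zpow_add₀ v.unif_ne]; simp

variable {k}
lemma ge_of_algebraic (v : FFPrime K) {x : K} (hx : IsAlgebraic k x) : v.Ge 0 x := by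
  have hi : IsIntegral k x := hx.isIntegral
  refine v.ge_zero_of_monic (minpoly k x) (minpoly.monic hi) (fun i => v.ge_const k _) (minpoly.aeval k x)

lemma z_of_algebraic (v : FFPrime K) {x : K} (hx : IsAlgebraic k x) : v.z x = 0 := by
  by_cases h0 : x = 0
  · rw [h0]; simp [z, v.ord_zero]
  have h1 := v.ge_of_algebraic hx
  have h2 := v.ge_of_algebraic hx.inv
  rw [v.ge_iff' h0] at h1
  rw [v.ge_iff' (inv_ne_zero h0), z_inv] at h2
  omega

lemma transc_of_z {v : FFPrime K} {x : K} (hx : v.z x ≠ 0) : Transcendental k x :=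
  fun h => hx (v.z_of_algebraic h)

lemma kap_rank (h : FFd k K) (v : FFPrime K) : FiniteDimensional k (kap k v) := by
  have hg : Transcendental k v.unif := transc_of_z (v := v) (by rw [unif_z]; norm_num)
  haveI := h.fin hg
  obtain ⟨s, hs⟩ := (res k v 0).exists_rightInverse_of_surjective (LinearMap.range_eq_top.2 (res_surj k v 0))
  have : Module.rank k (kap k v) ≤ (Module.finrank k⟮v.unif⟯ K : ℕ) := by
    apply rank_le
    intro t ht
    have := lemA hg (ball k v 0) (fun x hx => by
      rw [mem_ball] at *
      have h1 : v.Ge 1 v.unif := by rw [v.ge_iff' v.unif_ne, unif_z]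
      simpa using (h1.mono (by norm_num : (0:ℤ) ≤ 1)).mul hx) (fun i : t => (s i : K)) (fun i => (s i).2) (by
      rintro c ⟨y, hy, he⟩
      have h2 : res k v 0 (∑ i, c i • s i) = 0 := by
        rw [res_eq_zero]
        have h3 : ((∑ i, c i • s i : ball k v 0) : K) = v.unif * y := by
          rw [← he]; simp
        rw [h3]
        have h1 : v.Ge 1 v.unif := by rw [v.ge_iff' v.unif_ne, unif_z]
        simpa using h1.mul hy
      rw [map_sum] at h2
      have h3 : ∀ i : t, res k v 0 (c i • s i) = c i • (i : kap k v) := by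
        intro i
        rw [map_smul]; congr 1
        exact LinearMap.congr_fun hs (i : kap k v)
      simp only [h3] at h2
      exact Fintype.linearIndependent_iff.1 ht c h2)
    have h9 := this.fintype_card_le_finrank
    rw [Fintype.card_coe] at h9; exact h9
  exact Module.rank_lt_aleph0_iff.1 (this.trans_lt (Cardinal.natCast_lt_aleph0))

lemma deg_pos (h : FFd k K) (v : FFPrime K) : 0 < deg k v := by
  haveI := kap_rank h v
  exact Module.finrank_pos

theorem exists_pole (h : FFd k K) {x : K} (hx : Transcendental k x) : ∃ v : FFPrime K, v.z x < 0 := by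
  haveI := h.fin hx
  let φ := RatFunc.algEquivOfTranscendental x hx
  obtain ⟨v, e, he, hv⟩ := ofFun (K := k⟮x⟯) (fun y => - (φ.symm y).intDegree)
    (fun a b ha hb => by
      simp only [map_mul]
      rw [RatFunc.intDegree_mul (by simpa using ha) (by simpa using hb)]; ring)
    (fun a b n ha hb hab h1 h2 => by
      simp only [map_add] at *
      have := RatFunc.intDegree_add_le (x := φ.symm a) (y := φ.symm b) (by simpa using hb)
        (by rw [← map_add]; exact fun h0 => hab ((map_eq_zero_iff _ φ.symm.injective).1 h0))
      rcases le_total (φ.symm a).intDegree (φ.symm b).intDegree with h3 | h3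
      · rw [max_eq_right h3] at this; linarith
      · rw [max_eq_left h3] at this; linarith)
    ⟨AdjoinSimple.gen k x, by
      intro h0
      have := congrArg (algebraMap k⟮x⟯ K) h0
      simp at this
      exact hx (by rw [this]; exact isAlgebraic_zero), by
      simp only [φ, RatFunc.algEquivOfTranscendental_symm_gen, RatFunc.intDegree_X]; norm_num⟩
  have hgen : (AdjoinSimple.gen k x : k⟮x⟯) ≠ 0 := by
      intro h0
      have := congrArg (algebraMap k⟮x⟯ K) h0
      simp at this
      exact hx (by rw [this]; exact isAlgebraic_zero)
  have h1 := hv _ hgen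
  simp only [φ, RatFunc.algEquivOfTranscendental_symm_gen, RatFunc.intDegree_X] at h1
  obtain ⟨w, e', hw⟩ := exists_extend (L := K) v
  refine ⟨w, ?_⟩
  have h2 := hw.z (AdjoinSimple.gen k x)
  rw [AdjoinSimple.algebraMap_gen] at h2
  rw [h2]
  have h3 : v.z (AdjoinSimple.gen k x) < 0 := by nlinarith
  have := hw.1
  nlinarith

end FFPrime

end

noncomputable section
set_option linter.all false
open Finset Polynomial IntermediateField

theorem eff_ind {α : Type} {p : (α →₀ ℤ) → Prop} (h0 : p 0)
    (hs : ∀ E v, 0 ≤ E → p E → p (E + Finsupp.single v 1)) : ∀ E, 0 ≤ E → p E := by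
  classical
  have key : ∀ n : ℕ, ∀ E : α →₀ ℤ, 0 ≤ E → (E.sum fun _ m => m) ≤ n → p E := by
    intro n
    induction n with
    | zero =>
      intro E hE hn
      have : E = 0 := by
        ext v
        have h1 : E v ≤ E.sum fun _ m => m := by
          by_cases hv : v ∈ E.support
          · exact Finset.single_le_sum (f := fun v => E v) (fun i _ => hE i) hv
          · rw [Finsupp.notMem_support_iff.1 hv]; exact Finset.sum_nonneg (fun i _ => hE i)
        have h2 := hE v
        simp at h2 hn ⊢; omega
      rw [this]; exact h0
    | succ n ih =>
      intro E hE hn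
      by_cases hE0 : E = 0
      · rw [hE0]; exact h0
      obtain ⟨v, hv⟩ : ∃ v, E v ≠ 0 := by
        by_contra h; push Not at h; exact hE0 (Finsupp.ext h)
      have hv' : 0 < E v := lt_of_le_of_ne (hE v) (Ne.symm hv)
      have h1 : 0 ≤ E - Finsupp.single v 1 := by
        intro w
        by_cases hw : w = v
        · subst hw; simp; omega
        · have := hE w
          simpa [Finsupp.single_apply, Ne.symm hw] using this
      have h2 : (E - Finsupp.single v 1) + Finsupp.single v 1 = E := by abel
      rw [← h2]
      apply hs _ _ h1
      apply ih _ h1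
      have : (E.sum fun _ m => m) = ((E - Finsupp.single v 1).sum fun _ m => m) + 1 := by
        conv_lhs => rw [← h2]
        rw [Finsupp.sum_add_index' (by simp) (by simp)]
        simp
      push_cast at hn; omega
  intro E hE
  exact key (E.sum fun _ m => m).toNat E hE (by omega)

namespace FFPrime
variable (k : Type) {K : Type} [Field k] [Finite k] [Field K] [Algebra k K]

/-- Riemann–Roch spaces -/
def LP (P : Set (FFPrime K)) (D : FFPrime K →₀ ℤ) : Submodule k K where
  carrier := {x | ∀ v ∈ P, v.Ge (- D v) x}
  zero_mem' := fun v _ => v.ge_zero' _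
  add_mem' := fun h h' v hv => (h v hv).add (h' v hv)
  smul_mem' := fun c x h v hv => (ball k v _).smul_mem c (h v hv)

variable {k}
lemma mem_LP {P : Set (FFPrime K)} {D : FFPrime K →₀ ℤ} {x : K} :
    x ∈ LP k P D ↔ ∀ v ∈ P, v.Ge (- D v) x := Iff.rfl

lemma LP_mono {P : Set (FFPrime K)} {D D' : FFPrime K →₀ ℤ} (h : D ≤ D') : LP k P D ≤ LP k P D' :=
  fun x hx v hv => (hx v hv).mono (by have := h v; omega)

/-- leading coefficient at v -/
def lc {P : Set (FFPrime K)} {v : FFPrime K} (hv : v ∈ P) (D : FFPrime K →₀ ℤ) :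
    LP k P (D + Finsupp.single v 1) →ₗ[k] kap k v :=
  (res k v (- D v - 1)).comp (Submodule.inclusion (fun x hx => by
    have := hx v hv
    rw [mem_ball]
    convert this using 1
    simp; ring))

lemma lc_zero {P : Set (FFPrime K)} {v : FFPrime K} (hv : v ∈ P) (D : FFPrime K →₀ ℤ)
    (x : LP k P (D + Finsupp.single v 1)) : lc hv D x = 0 ↔ (x : K) ∈ LP k P D := by
  classical
  change res k v _ _ = 0 ↔ _
  rw [res_eq_zero]
  simp only [sub_add_cancel, Submodule.coe_inclusion]
  constructor
  · intro h w hw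
    by_cases hwv : w = v
    · subst hwv; exact h
    · have := x.2 w hw
      simpa [Finsupp.single_apply, Ne.symm hwv] using this
  · intro h; exact h v hv

lemma lc_surj {P : Set (FFPrime K)} (hP : P.Finite) {v : FFPrime K} (hv : v ∈ P) (D : FFPrime K →₀ ℤ) :
    Function.Surjective (lc (k := k) hv D) := by
  classical
  intro c
  obtain ⟨y, hy⟩ := res_surj k v (- D v - 1) c
  obtain ⟨n, hn⟩ : ∃ n : ℤ, ∀ w ∈ hP.toFinset, - D w ≤ n := by
    refine ⟨∑ w ∈ hP.toFinset, |D w|, fun w hw => ?_⟩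
    have := Finset.single_le_sum (f := fun w => |D w|) (fun i _ => abs_nonneg _) hw
    have := neg_abs_le (D w)
    simp at *; linarith
  obtain ⟨x, hx⟩ := approx hP.toFinset (fun w => if w = v then (y : K) else 0) n
  have hxv : v.Ge n (x - y) := by simpa using hx v (by simpa using hv)
  have hnv : - D v ≤ n := hn v (by simpa using hv)
  have hxm : x ∈ LP k P (D + Finsupp.single v 1) := by
    intro w hw
    by_cases hwv : w = v
    · subst hwv
      have h1 : w.Ge (- D w - 1) (x - y) := hxv.mono (by linarith)
      have h2 := h1.add y.2
      simp at h2 ⊢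
      convert h2 using 1; ring
    · have h1 := hx w (by simpa using hw)
      have h2 := hn w (by simpa using hw)
      simp [hwv] at h1
      simpa [Finsupp.single_apply, Ne.symm hwv] using h1.mono h2
  refine ⟨⟨x, hxm⟩, ?_⟩
  rw [← hy]
  change res k v _ _ = _
  rw [res_eq]
  exact hxv.mono (by linarith)

variable (k) in
/-- degree of divisors -/
def degD : (FFPrime K →₀ ℤ) →+ ℤ :=
  Finsupp.liftAddHom (fun v => (AddMonoidHom.mulRight (deg k v : ℤ)))

@[simp] lemma degD_single (v : FFPrime K) (n : ℤ) : degD k (Finsupp.single v n) = n * deg k v := by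
  simp [degD]

lemma degD_eq (D : FFPrime K →₀ ℤ) : degD k D = D.sum (fun v n => n * deg k v) := by
  simp [degD]

lemma degD_nonneg {D : FFPrime K →₀ ℤ} (h : 0 ≤ D) : 0 ≤ degD k D := by
  rw [degD_eq]; exact Finset.sum_nonneg (fun i _ => mul_nonneg (h i) (by positivity))

lemma degD_mono {D D' : FFPrime K →₀ ℤ} (h : D ≤ D') : degD k D ≤ degD k D' := by
  have := degD_nonneg (k := k) (sub_nonneg.2 h)
  rw [map_sub] at this; linarith


lemma exists_U (h : FFd k K) {P : Set (FFPrime K)} (hP : P.Finite) (D E : FFPrime K →₀ ℤ) (hE : 0 ≤ E)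
    (hEP : ∀ v, E v ≠ 0 → v ∈ P) :
    ∃ U : Submodule k K, FiniteDimensional k U ∧ (Module.finrank k U : ℤ) = degD k E ∧
      U ≤ LP k P (D + E) ∧ U ⊓ LP k P D = ⊥ := by
  revert hEP
  refine eff_ind (p := fun E => (∀ v, E v ≠ 0 → v ∈ P) → ∃ U : Submodule k K, FiniteDimensional k U ∧ (Module.finrank k U : ℤ) = degD k E ∧
      U ≤ LP k P (D + E) ∧ U ⊓ LP k P D = ⊥) ?_ ?_ E hE
  · intro _
    exact ⟨⊥, inferInstance, by simp, bot_le, by simp⟩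
  · intro E v hE ih hEP
    classical
    have hv : v ∈ P := hEP v (by have := hE v; simp at this ⊢; omega)
    obtain ⟨U, hU1, hU2, hU3, hU4⟩ := ih (fun w hw => by
      apply hEP w
      have := hE w
      by_cases hwv : w = v
      · subst hwv; simp at this ⊢; omega
      · simpa [Finsupp.single_apply, Ne.symm hwv] using hw)
    haveI := kap_rank h v
    obtain ⟨s, hs⟩ := (lc (k := k) hv (D + E)).exists_rightInverse_of_surjective (LinearMap.range_eq_top.2 (lc_surj hP hv _))
    have hs' : ∀ c, lc (k := k) hv (D + E) (s c) = c := fun c => LinearMap.congr_fun hs c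
    have key : ∀ c, (s c : K) ∈ LP k P (D + E) → c = 0 := by
      intro c hc
      rw [← hs' c]; exact (lc_zero hv _ _).2 hc
    let φ : kap k v →ₗ[k] K := (Submodule.subtype _).comp s
    have hφ : Function.Injective φ := by
      rw [injective_iff_map_eq_zero]
      intro c hc
      apply key
      have : (s c : K) = 0 := hc
      rw [this]; exact Submodule.zero_mem _
    have hinf : U ⊓ LinearMap.range φ = ⊥ := by
      rw [eq_bot_iff]
      rintro x ⟨hx, ⟨c, rfl⟩⟩
      have := key c (hU3 hx)
      rw [this]; simp
    have hfr : Module.finrank k (LinearMap.range φ) = deg k v := LinearMap.finrank_range_of_inj hφ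
    refine ⟨U ⊔ LinearMap.range φ, inferInstance, ?_, ?_, ?_⟩
    · have := Submodule.finrank_sup_add_finrank_inf_eq U (LinearMap.range φ)
      rw [hinf, finrank_bot, hfr] at this
      rw [map_add, ← hU2, degD_single]; push_cast [← this]; omega
    · rw [← add_assoc]
      apply sup_le (hU3.trans (LP_mono (by simp)))
      rintro _ ⟨c, rfl⟩
      exact (s c).2
    · rw [eq_bot_iff]
      rintro x ⟨hx, hx'⟩
      obtain ⟨u, hu, _, ⟨c, rfl⟩, rfl⟩ := Submodule.mem_sup.1 hx
      have h1 : φ c ∈ LP k P (D + E) := by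
        have := Submodule.sub_mem _ (LP_mono (P := P) (by simpa using hE : D ≤ D + E) hx') (hU3 hu)
        simpa using this
      have hc := key c h1
      rw [hc] at hx' ⊢
      simp only [map_zero, add_zero] at *
      rw [← hU4]; exact ⟨hu, hx'⟩

lemma sum_zero_le (h : FFd k K) {g : K} (hg : Transcendental k g) (P : Finset (FFPrime K)) (hP : ∀ v ∈ P, 0 ≤ v.z g) :
    ∑ v ∈ P, v.z g * deg k v ≤ Module.finrank k⟮g⟯ K := by
  classical
  have hg0 : g ≠ 0 := by rintro rfl; exact hg isAlgebraic_zero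
  let E : FFPrime K →₀ ℤ := ∑ v ∈ P, Finsupp.single v (v.z g)
  have hEv : ∀ w, E w = if w ∈ P then w.z g else 0 := by
    intro w
    simp only [E, Finsupp.finset_sum_apply, Finsupp.single_apply]
    simp
  have hE : 0 ≤ E := by
    intro w; rw [hEv]; split_ifs with hw
    · exact hP w hw
    · exact le_refl _
  obtain ⟨U, hU1, hU2, hU3, hU4⟩ := exists_U h (P.finite_toSet) (-E) E hE (fun v hv => by
    rw [hEv] at hv; by_contra h'; simp at h'; simp [h'] at hv)
  have := lemA_finrank h hg (LP k (P : Set (FFPrime K)) 0) (fun x hx v hv => by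
    have h1 : v.Ge 0 g := by rw [v.ge_iff' hg0]; exact hP v hv
    simpa using h1.mul (hx v hv)) U (by simpa using hU3) (fun y hy hgy => by
      have : g * y ∈ U ⊓ LP k (P : Set (FFPrime K)) (-E) := by
        refine ⟨hgy, fun v hv => ?_⟩
        have h1 : v.Ge (v.z g) g := by rw [v.ge_iff' hg0]
        have hv' : v ∈ P := hv
        simpa [hEv, hv'] using h1.mul (hy v hv)
      rw [hU4] at this; exact this)
  have h2 : degD k E = ∑ v ∈ P, v.z g * deg k v := by simp [E]
  rw [← h2, ← hU2]; exact_mod_cast this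

lemma finite_zeros (h : FFd k K) {g : K} (hg : Transcendental k g) : {v : FFPrime K | 0 < v.z g}.Finite := by
  by_contra hinf
  obtain ⟨P, hP, hc⟩ := Set.Infinite.exists_subset_card_eq hinf (Module.finrank k⟮g⟯ K + 1)
  have h1 := sum_zero_le h hg P (fun v hv => le_of_lt (hP hv))
  have h2 : (∑ v ∈ P, (1 : ℤ)) ≤ ∑ v ∈ P, v.z g * deg k v := by
    apply Finset.sum_le_sum
    intro v hv
    have h3 : 0 < v.z g := hP hv
    have h4 : (0 : ℤ) < deg k v := by exact_mod_cast deg_pos h v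
    nlinarith
  simp [hc] at h2
  omega

lemma finite_z (h : FFd k K) (g : K) : {v : FFPrime K | v.z g ≠ 0}.Finite := by
  by_cases hg : Transcendental k g
  · have hg' : Transcendental k g⁻¹ := fun h' => hg (by simpa using h'.inv)
    refine ((finite_zeros h hg).union (finite_zeros h hg')).subset ?_
    intro v hv
    simp only [Set.mem_setOf_eq, Set.mem_union, z_inv] at *
    omega
  · convert Set.finite_empty
    ext v
    simp only [Set.mem_setOf_eq, Set.mem_empty_iff_false, iff_false, not_not]
    exact v.z_of_algebraic (by simpa [Transcendental] using hg)

end FFPrime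

end

noncomputable section
set_option linter.all false
open Finset Polynomial IntermediateField

namespace FFPrime
variable {k : Type} {K : Type} [Field k] [Finite k] [Field K] [Algebra k K]

open Classical in
/-- principal divisor -/
def dv (x : K) : FFPrime K →₀ ℤ :=
  if hf : (Function.support fun v : FFPrime K => v.z x).Finite then Finsupp.ofSupportFinite (fun v => v.z x) hf else 0

lemma dv_apply (h : FFd k K) (x : K) (v : FFPrime K) : dv x v = v.z x := by
  have : (Function.support fun v : FFPrime K => v.z x).Finite := finite_z h x
  rw [dv, dif_pos this]; rfl

lemma dv_mul (h : FFd k K) {x y : K} (hx : x ≠ 0) (hy : y ≠ 0) : dv (x * y) = dv x + dv y := by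
  ext v; simp only [dv_apply h, Finsupp.add_apply]; exact v.z_mul hx hy

lemma dv_inv (h : FFd k K) (x : K) : dv x⁻¹ = - dv x := by
  ext v; simp only [dv_apply h, Finsupp.neg_apply]; exact v.z_inv x

lemma dv_one (h : FFd k K) : dv (1 : K) = 0 := by
  ext v; simp only [dv_apply h, z_one, Finsupp.zero_apply]

variable (k) in
/-- RR space -/
def LL (D : FFPrime K →₀ ℤ) : Submodule k K := LP k Set.univ D

lemma mem_LL (h : FFd k K) {D : FFPrime K →₀ ℤ} {x : K} (hx : x ≠ 0) : x ∈ LL k D ↔ 0 ≤ dv x + D := by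
  rw [LL, mem_LP]
  constructor
  · intro h1 v
    have := h1 v (Set.mem_univ _)
    rw [v.ge_iff' hx] at this
    simp [dv_apply h]; linarith
  · intro h1 v _
    have := h1 v
    simp [dv_apply h] at this
    rw [v.ge_iff' hx]; linarith

lemma exists_place (h : FFd k K) : ∃ v : FFPrime K, True := by
  obtain ⟨t, ht, _⟩ := id h
  obtain ⟨v, _⟩ := exists_pole h ht
  exact ⟨v, trivial⟩

lemma fin_LL_zero (h : FFd k K) : FiniteDimensional k (LL k (0 : FFPrime K →₀ ℤ)) := by
  obtain ⟨v, -⟩ := exists_place h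
  haveI := kap_rank h v
  have hle : LL k (0 : FFPrime K →₀ ℤ) ≤ ball k v 0 := fun x hx => by
    have := hx v (Set.mem_univ _); rw [mem_ball]; simpa using this
  let φ : LL k (0 : FFPrime K →₀ ℤ) →ₗ[k] kap k v := (res k v 0).comp (Submodule.inclusion hle)
  have hφ : Function.Injective φ := by
    rw [injective_iff_map_eq_zero]
    intro x hx
    have h1 : v.Ge 1 (x : K) := by
      have := (res_eq_zero k _).1 hx; simpa using this
    by_contra hx0
    have hx1 : (x : K) ≠ 0 := fun h' => hx0 (Subtype.ext h')
    rw [v.ge_iff' hx1] at h1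
    obtain ⟨w, hw⟩ := exists_pole h (transc_of_z (k := k) (v := v) (x := (x:K)) (by omega))
    have := x.2 w (Set.mem_univ _)
    rw [w.ge_iff' hx1] at this
    simp at this; omega
  exact FiniteDimensional.of_injective φ hφ

lemma step_LL (h : FFd k K) (D : FFPrime K →₀ ℤ) (v : FFPrime K) (hD : FiniteDimensional k (LL k D)) :
    FiniteDimensional k (LL k (D + Finsupp.single v 1)) ∧
      Module.finrank k (LL k (D + Finsupp.single v 1)) ≤ Module.finrank k (LL k D) + deg k v := by
  haveI := kap_rank h v
  let φ : LL k (D + Finsupp.single v 1) →ₗ[k] kap k v := lc (Set.mem_univ v) D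
  have hle : LL k D ≤ LL k (D + Finsupp.single v 1) := LP_mono (by simp)
  have hker : LinearMap.ker φ = (LL k D).comap (Submodule.subtype _) := by
    ext x
    rw [LinearMap.mem_ker]; exact lc_zero (Set.mem_univ v) D x
  let e : LinearMap.ker φ ≃ₗ[k] LL k D :=
    (LinearEquiv.ofEq _ _ hker).trans (Submodule.comapSubtypeEquivOfLe hle)
  haveI : FiniteDimensional k (LinearMap.ker φ) := Module.Finite.equiv e.symm
  haveI : FiniteDimensional k (LL k (D + Finsupp.single v 1)) := by
    haveI : Module.Finite k (LL k (D + Finsupp.single v 1) ⧸ LinearMap.ker φ) := Module.Finite.equiv φ.quotKerEquivRange.symm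
    exact Module.Finite.of_submodule_quotient (LinearMap.ker φ)
  refine ⟨this, ?_⟩
  have h1 := LinearMap.finrank_range_add_finrank_ker φ
  rw [e.finrank_eq] at h1
  have h2 : Module.finrank k (LinearMap.range φ) ≤ deg k v := Submodule.finrank_le _
  omega

lemma fin_LL_eff (h : FFd k K) (E : FFPrime K →₀ ℤ) (hE : 0 ≤ E) : FiniteDimensional k (LL k E) :=
  eff_ind (p := fun E => FiniteDimensional k (LL k E)) (fin_LL_zero h) (fun E v _ hE => (step_LL h E v hE).1) E hE

lemma fin_LL (h : FFd k K) (D : FFPrime K →₀ ℤ) : FiniteDimensional k (LL k D) := by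
  haveI : FiniteDimensional k (LP k Set.univ (D ⊔ 0)) := fin_LL_eff h (D ⊔ 0) le_sup_right
  exact Submodule.finiteDimensional_of_le (LP_mono (P := Set.univ) (le_sup_left : D ≤ D ⊔ 0))

variable (k) in
/-- dimension -/
def ell (D : FFPrime K →₀ ℤ) : ℤ := Module.finrank k (LL k D)

lemma ell_add (h : FFd k K) (D E : FFPrime K →₀ ℤ) (hE : 0 ≤ E) : ell k (D + E) ≤ ell k D + degD k E := by
  refine eff_ind (p := fun E => ell k (D + E) ≤ ell k D + degD k E) (by simp) ?_ E hE
  intro E v _ ih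
  have := (step_LL h (D + E) v (fin_LL h _)).2
  rw [← add_assoc, map_add, degD_single]
  unfold ell at *
  zify at this; linarith

variable (k) in
/-- defect -/
def dfc (D : FFPrime K →₀ ℤ) : ℤ := degD k D - ell k D

lemma dfc_mono (h : FFd k K) {D D' : FFPrime K →₀ ℤ} (hD : D ≤ D') : dfc k D ≤ dfc k D' := by
  have := ell_add h D (D' - D) (sub_nonneg.2 hD)
  rw [map_sub, add_sub_cancel] at this
  unfold dfc; linarith

lemma ell_pos_iff (h : FFd k K) (D : FFPrime K →₀ ℤ) (hp : 0 < ell k D) : ∃ x : K, x ≠ 0 ∧ 0 ≤ dv x + D := by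
  unfold ell at hp
  have : Nontrivial (LL k D) := Module.nontrivial_of_finrank_pos (R := k) (by exact_mod_cast hp)
  obtain ⟨x, hx⟩ := exists_ne (0 : LL k D)
  have hx' : (x : K) ≠ 0 := fun h' => hx (Subtype.ext h')
  exact ⟨x, hx', (mem_LL h hx').1 x.2⟩

lemma ell_dv (h : FFd k K) (D : FFPrime K →₀ ℤ) {x : K} (hx : x ≠ 0) : ell k (D + dv x) = ell k D := by
  let e : K ≃ₗ[k] K := LinearEquiv.ofBijective (LinearMap.mulLeft k x⁻¹)
    ⟨mul_right_injective₀ (inv_ne_zero hx), fun y => ⟨x * y, by simp [hx]⟩⟩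
  have : (LL k D).map (e : K →ₗ[k] K) = LL k (D + dv x) := by
    ext y
    rw [Submodule.mem_map]
    constructor
    · rintro ⟨z, hz, rfl⟩
      change x⁻¹ * z ∈ _
      by_cases hz0 : z = 0
      · rw [hz0, mul_zero]; exact Submodule.zero_mem _
      · rw [mem_LL h (mul_ne_zero (inv_ne_zero hx) hz0), dv_mul h (inv_ne_zero hx) hz0, dv_inv h]
        rw [mem_LL h hz0] at hz
        convert hz using 1; abel
    · intro hy
      refine ⟨x * y, ?_, by change x⁻¹ * (x * y) = y; simp [hx]⟩
      by_cases hy0 : y = 0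
      · rw [hy0, mul_zero]; exact Submodule.zero_mem _
      · rw [mem_LL h hy0] at hy
        rw [mem_LL h (mul_ne_zero hx hy0), dv_mul h hx hy0]
        convert hy using 1; abel
  unfold ell
  rw [← this]
  exact congrArg _ (LinearEquiv.finrank_map_eq e (LL k D))

/-- zeros -/
lemma degD_zeros (h : FFd k K) {g : K} (hg : Transcendental k g) : degD k (dv g ⊔ 0) ≤ Module.finrank k⟮g⟯ K := by
  rw [degD_eq, Finsupp.sum]
  have h1 : ∀ v ∈ (dv g ⊔ 0).support, 0 < v.z g := by
    intro v hv
    rw [Finsupp.mem_support_iff, Finsupp.sup_apply, dv_apply h] at hv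
    by_contra h'
    exact hv (by simpa using h')
  refine le_trans (le_of_eq ?_) (sum_zero_le h hg (dv g ⊔ 0).support (fun v hv => (h1 v hv).le))
  apply Finset.sum_congr rfl
  intro v hv
  rw [Finsupp.sup_apply, dv_apply h, Finsupp.zero_apply, sup_of_le_left (h1 v hv).le]


lemma ge_of_integral {f : K} {v : FFPrime K} (hv : v.Ge 0 f) {x : K} (hx : IsIntegral (Algebra.adjoin k ({f} : Set K)) x) :
    v.Ge 0 x := by
  obtain ⟨P, hP, hx⟩ := hx
  refine v.ge_zero_of_monic (P.map (algebraMap _ K)) (hP.map _) ?_ (y := x) ?_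
  · intro i
    rw [coeff_map]
    have hle : Algebra.adjoin k ({f} : Set K) ≤ OA k v := Algebra.adjoin_le (by rw [Set.singleton_subset_iff]; exact hv)
    exact hle (P.coeff i).2
  · rw [aeval_map_algebraMap]; exact hx

open scoped IntermediateField.algebraAdjoinAdjoin in
/-- lower bound -/
lemma ell_poles (h : FFd k K) {f : K} (hf : Transcendental k f) : ∃ C : ℤ, ∀ m : ℕ,
    m * (Module.finrank k⟮f⟯ K : ℤ) - C ≤ ell k ((m : ℤ) • (dv f⁻¹ ⊔ 0)) := by
  classical
  haveI := h.fin hf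
  have hf0 : f ≠ 0 := by rintro rfl; exact hf isAlgebraic_zero
  set n := Module.finrank k⟮f⟯ K with hn
  let b := Module.finBasis k⟮f⟯ K
  haveI : Algebra.IsAlgebraic (Algebra.adjoin k ({f} : Set K)) K :=
      (IsFractionRing.comap_isAlgebraic_iff (A := Algebra.adjoin k ({f} : Set K)) (K := k⟮f⟯) (C := K)).2 inferInstance
  obtain ⟨y, hy0, hy⟩ := Algebra.IsAlgebraic.exists_integral_multiples (Algebra.adjoin k ({f} : Set K)) (Finset.univ.image b)
  have hyK : (y : K) ≠ 0 := fun h' => hy0 (Subtype.ext h')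
  let e : Fin n → K := fun i => (y : K) * b i
  have he0 : ∀ i, e i ≠ 0 := fun i => mul_ne_zero hyK (b.ne_zero i)
  have hei : ∀ i, IsIntegral (Algebra.adjoin k ({f} : Set K)) (e i) := fun i => by
    have := hy (b i) (by simp)
    rwa [Algebra.smul_def] at this
  have heind : LinearIndependent k⟮f⟯ e := by
    have := b.linearIndependent.map' (LinearMap.mulLeft k⟮f⟯ (y : K)) (LinearMap.ker_eq_bot.2 (mul_right_injective₀ hyK))
    exact this
  have hpole : ∀ i, ∀ v : FFPrime K, 0 ≤ v.z f → 0 ≤ v.z (e i) := by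
    intro i v hv
    rw [← v.ge_iff' (he0 i)]
    exact ge_of_integral (by rw [v.ge_iff' hf0]; exact hv) (hei i)
  obtain ⟨m0, hm0⟩ : ∃ m0 : ℕ, ∀ i, ∀ v : FFPrime K, v.z f < 0 → - v.z (e i) ≤ m0 := by
    have hfin : {v : FFPrime K | v.z f ≠ 0}.Finite := finite_z h f
    refine ⟨∑ i, ∑ v ∈ hfin.toFinset, (v.z (e i)).natAbs, fun i v hv => ?_⟩
    have h1 : (v.z (e i)).natAbs ≤ ∑ v ∈ hfin.toFinset, (v.z (e i)).natAbs :=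
      Finset.single_le_sum (f := fun v : FFPrime K => (v.z (e i)).natAbs) (fun _ _ => Nat.zero_le _) (by simp; omega)
    have h2 : ∑ v ∈ hfin.toFinset, (v.z (e i)).natAbs ≤ ∑ i, ∑ v ∈ hfin.toFinset, (v.z (e i)).natAbs :=
      Finset.single_le_sum (f := fun i => ∑ v ∈ hfin.toFinset, (v.z (e i)).natAbs) (fun _ _ => Nat.zero_le _) (Finset.mem_univ i)
    omega
  have hpow : LinearIndependent k (fun j : ℕ => (AdjoinSimple.gen k f) ^ j) := by
    have hg : Transcendental k (AdjoinSimple.gen k f) := by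
      rw [← transcendental_algebraMap_iff (algebraMap k⟮f⟯ K).injective, AdjoinSimple.algebraMap_gen]
      exact hf
    have := (Polynomial.basisMonomials k).linearIndependent.map' (aeval (AdjoinSimple.gen k f)).toLinearMap
      (LinearMap.ker_eq_bot.2 (transcendental_iff_injective.1 hg))
    have h5 : (fun j : ℕ => (AdjoinSimple.gen k f) ^ j) = (aeval (AdjoinSimple.gen k f)).toLinearMap ∘ (basisMonomials k) := by
      ext j; simp [aeval_monomial]
    rw [h5]; exact this
  refine ⟨m0 * n, fun m => ?_⟩
  by_cases hm : m < m0
  · have : (0 : ℤ) ≤ ell k ((m : ℤ) • (dv f⁻¹ ⊔ 0) : FFPrime K →₀ ℤ) := by unfold ell; positivity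
    have h1 : (m : ℤ) * n ≤ m0 * n := by gcongr
    linarith
  push Not at hm
  have hind := _root_.linearIndependent_smul (hpow.comp (fun j : Fin (m - m0) => (j : ℕ)) Fin.val_injective) heind
  have hmem : ∀ i : Fin (m - m0) × Fin n, (AdjoinSimple.gen k f) ^ (i.1 : ℕ) • e i.2 ∈ LL k ((m : ℤ) • (dv f⁻¹ ⊔ 0) : FFPrime K →₀ ℤ) := by
    rintro ⟨j, i⟩ v _
    have hj := j.2
    rw [Algebra.smul_def, map_pow, AdjoinSimple.algebraMap_gen]
    rw [v.ge_iff' (mul_ne_zero (pow_ne_zero _ hf0) (he0 i)), v.z_mul (pow_ne_zero _ hf0) (he0 i), z_pow]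
    simp only [Finsupp.smul_apply, Finsupp.sup_apply, dv_apply h, z_inv, Finsupp.zero_apply, smul_eq_mul]
    by_cases hv : 0 ≤ v.z f
    · have := hpole i v hv
      have h3 : max (- v.z f) 0 = 0 := by simpa using hv
      rw [h3]; simp; positivity
    · push Not at hv
      have := hm0 i v hv
      have h3 : max (- v.z f) 0 = - v.z f := by simpa using hv.le
      rw [h3]
      have h4 : (j : ℤ) + m0 ≤ m := by have := j.2; simp; omega
      nlinarith
  haveI := fin_LL h ((m : ℤ) • (dv f⁻¹ ⊔ 0))
  have hind2 : LinearIndependent k (fun i => (⟨_, hmem i⟩ : LL k ((m : ℤ) • (dv f⁻¹ ⊔ 0) : FFPrime K →₀ ℤ))) :=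
    LinearIndependent.of_comp (Submodule.subtype _) hind
  have := hind2.fintype_card_le_finrank
  simp at this
  unfold ell
  zify [hm] at this
  linarith


lemma adjoin_inv (f : K) : k⟮f⁻¹⟯ = k⟮f⟯ := by
  apply le_antisymm
  · rw [adjoin_simple_le_iff]; exact inv_mem (mem_adjoin_simple_self k f)
  · rw [adjoin_simple_le_iff]
    have := inv_mem (mem_adjoin_simple_self k f⁻¹)
    simpa using this

lemma degD_poles_eq (h : FFd k K) {f : K} (hf : Transcendental k f) :
    degD k (dv f⁻¹ ⊔ 0) = Module.finrank k⟮f⟯ K := by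
  have hf' : Transcendental k f⁻¹ := fun h' => hf (by simpa using h'.inv)
  apply le_antisymm
  · have := degD_zeros h hf'
    rwa [adjoin_inv] at this
  · obtain ⟨C, hC⟩ := ell_poles h hf
    by_contra hcon
    push Not at hcon
    set n : ℤ := ((Module.finrank k⟮f⟯ K : ℕ) : ℤ)
    set d := degD k (dv f⁻¹ ⊔ 0)
    have hbd : ∀ m : ℕ, (m : ℤ) * n - C ≤ ell k (0 : FFPrime K →₀ ℤ) + m * d := by
      intro m
      have h1 := ell_add h 0 ((m : ℤ) • (dv f⁻¹ ⊔ 0)) (smul_nonneg (by positivity) le_sup_right)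
      rw [zero_add, map_zsmul, smul_eq_mul] at h1
      exact (hC m).trans h1
    have := hbd (C + ell k (0 : FFPrime K →₀ ℤ) + 1).toNat
    have h3 := Int.self_le_toNat (C + ell k (0 : FFPrime K →₀ ℤ) + 1)
    nlinarith

theorem degD_dv (h : FFd k K) (f : K) : degD k (dv f) = 0 := by
  by_cases hf : Transcendental k f
  · have hf' : Transcendental k f⁻¹ := fun h' => hf (by simpa using h'.inv)
    have h1 := degD_poles_eq h hf
    have h2 := degD_poles_eq h hf'
    rw [adjoin_inv, inv_inv] at h2
    have h3 : dv f = (dv f ⊔ 0) - (dv f⁻¹ ⊔ 0) := by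
      ext v
      simp only [Finsupp.sub_apply, Finsupp.sup_apply, dv_inv h, Finsupp.neg_apply, Finsupp.zero_apply]
      omega
    rw [h3, map_sub, h1, h2, sub_self]
  · have : dv f = 0 := by
      ext v
      rw [dv_apply h]
      exact v.z_of_algebraic (by simpa [Transcendental] using hf)
    rw [this, map_zero]

lemma dfc_dv (h : FFd k K) (D : FFPrime K →₀ ℤ) {x : K} (hx : x ≠ 0) : dfc k (D + dv x) = dfc k D := by
  unfold dfc; rw [ell_dv h D hx, map_add, degD_dv h, add_zero]

lemma riemann (h : FFd k K) : ∃ C : ℤ, ∀ D : FFPrime K →₀ ℤ, dfc k D ≤ C := by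
  obtain ⟨f, hf, _⟩ := id h
  obtain ⟨C, hC⟩ := ell_poles h hf
  have hB := degD_poles_eq h hf
  haveI := h.fin hf
  have hn : 0 < Module.finrank k⟮f⟯ K := Module.finrank_pos
  set n : ℤ := ((Module.finrank k⟮f⟯ K : ℕ) : ℤ) with hndef
  have hn' : 0 < n := by rw [hndef]; exact_mod_cast hn
  set B := dv f⁻¹ ⊔ 0 with hBdef
  have hmB : ∀ m : ℕ, dfc k ((m : ℤ) • B) ≤ C := by
    intro m
    unfold dfc; rw [map_zsmul, hB, smul_eq_mul]; linarith [hC m]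
  refine ⟨C, fun D => ?_⟩
  refine (dfc_mono h (le_sup_left : D ≤ D ⊔ 0)).trans ?_
  generalize hE : D ⊔ 0 = E
  have hE0 : 0 ≤ E := hE ▸ le_sup_right
  set m := (C + degD k E + 1).toNat with hm
  have hm' : C + degD k E + 1 ≤ m := Int.self_le_toNat _
  have h1 := ell_add h ((m : ℤ) • B - E) E hE0
  rw [sub_add_cancel] at h1
  have h2 := hC m
  obtain ⟨x, hx0, hx⟩ := ell_pos_iff h ((m : ℤ) • B - E) (by nlinarith)
  have h3 : E ≤ (m : ℤ) • B + dv x := by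
    rw [← sub_nonneg]; convert hx using 1; abel
  exact (dfc_mono h h3).trans ((dfc_dv h _ hx0).trans_le (hmB m))

theorem RR (h : FFd k K) : ∃ c R : ℤ, ∀ D : FFPrime K →₀ ℤ, c ≤ degD k D → ell k D = degD k D - R := by
  obtain ⟨C, hC⟩ := riemann h
  obtain ⟨R, ⟨D0, hD0⟩, hR⟩ := Int.exists_greatest_of_bdd (P := fun R => ∃ D : FFPrime K →₀ ℤ, dfc k D = R)
    ⟨C, by rintro _ ⟨D, rfl⟩; exact hC D⟩ ⟨_, 0, rfl⟩
  refine ⟨degD k D0 + R + 1, R, fun D hD => ?_⟩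
  have h1 := hR _ ⟨D - D0, rfl⟩
  obtain ⟨x, hx0, hx⟩ := ell_pos_iff h (D - D0) (by unfold dfc at h1; rw [map_sub] at h1; linarith)
  have h3 : D0 ≤ D + dv x := by
    rw [← sub_nonneg]; convert hx using 1; abel
  have h4 := dfc_mono h h3
  rw [dfc_dv h _ hx0] at h4
  have h5 := hR _ ⟨D, rfl⟩
  unfold dfc at *; linarith

end FFPrime

end

noncomputable section
set_option linter.all false
open Finset Polynomial IntermediateField

namespace FFPrime
variable {k : Type} {K : Type} [Field k] [Finite k] [Field K] [Algebra k K]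

lemma kap_finite (h : FFd k K) (v : FFPrime K) : Finite (kap k v) := by
  haveI := kap_rank h v
  exact Module.finite_of_finite k

lemma kap_card (h : FFd k K) (v : FFPrime K) : Nat.card (kap k v) = Nat.card k ^ deg k v := by
  haveI := kap_rank h v
  exact Module.natCard_eq_pow_finrank

lemma pow_kap (h : FFd k K) (v : FFPrime K) {x : K} (hx : v.Ge 0 x) :
    v.Ge 1 (x ^ (Nat.card k ^ deg k v) - x) := by
  haveI := kap_finite h v
  letI := Fintype.ofFinite (kap k v)
  classical
  letI : Field (kap k v) := (Finite.isField_of_domain (kap k v)).toField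
  have h1 : (rmk k v ⟨x, hx⟩) ^ (Fintype.card (kap k v)) = rmk k v ⟨x, hx⟩ := FiniteField.pow_card _
  rw [← Nat.card_eq_fintype_card, kap_card h v, ← map_pow, rmk_eq] at h1
  simpa using h1

theorem finite_places (h : FFd k K) (B : ℕ) : {v : FFPrime K | deg k v ≤ B}.Finite := by
  obtain ⟨t, ht, _⟩ := id h
  have hQ : 1 < Nat.card k := Finite.one_lt_card
  have hfin : ({v : FFPrime K | v.z t ≠ 0} ∪ ⋃ d ∈ Finset.range (B + 1), {v : FFPrime K | v.z (t ^ (Nat.card k ^ d) - t) ≠ 0}).Finite :=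
    (finite_z h t).union (Set.Finite.biUnion (Finset.finite_toSet _) (fun d _ => finite_z h _))
  refine hfin.subset ?_
  intro v hv
  have hv' : deg k v ≤ B := hv
  by_cases h1 : v.z t = 0
  · right
    simp only [Set.mem_iUnion]
    refine ⟨deg k v, by simp; omega, ?_⟩
    have h0 : v.Ge 0 t := by rw [ge_iff]; right; omega
    have h2 := pow_kap h v h0
    have hne : t ^ (Nat.card k ^ deg k v) - t ≠ 0 := by
      intro h3
      apply ht
      refine ⟨X ^ (Nat.card k ^ deg k v) - X, ?_, by simpa using h3⟩
      have hd := deg_pos h v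
      exact FiniteField.X_pow_card_pow_sub_X_ne_zero k hd.ne' hQ
    rw [v.ge_iff' hne] at h2
    simp only [Set.mem_setOf_eq]; omega
  · left; exact h1

/-- effective divisors of degree d -/
def Eff (k : Type) {K : Type} [Field k] [Finite k] [Field K] [Algebra k K] (d : ℤ) : Set (FFPrime K →₀ ℤ) :=
  {D | 0 ≤ D ∧ degD k D = d}

lemma le_degD (h : FFd k K) {D : FFPrime K →₀ ℤ} (hD : 0 ≤ D) (v : FFPrime K) : D v * deg k v ≤ degD k D := by
  have h1 : Finsupp.single v (D v) ≤ D := by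
    classical
    intro w
    rw [Finsupp.single_apply]; split_ifs with hw
    · rw [hw]
    · exact hD w
  have := degD_mono (k := k) h1
  simpa using this

lemma Eff_deg_le (h : FFd k K) {d : ℤ} {D : FFPrime K →₀ ℤ} (hD : D ∈ Eff k d) (v : FFPrime K) (hv : D v ≠ 0) :
    (deg k v : ℤ) ≤ d := by
  have h1 := le_degD h hD.1 v
  have h2 := hD.1 v
  rw [hD.2] at h1
  simp at h2
  have : 1 ≤ D v := by omega
  have h3 : (0 : ℤ) ≤ deg k v := by positivity
  nlinarith

lemma finite_Eff (h : FFd k K) (d : ℤ) : (Eff (K := K) k d).Finite := by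
  classical
  let Dm : FFPrime K →₀ ℤ := ∑ v ∈ (finite_places h d.toNat).toFinset, Finsupp.single v d
  refine (Set.finite_Icc (0 : FFPrime K →₀ ℤ) Dm).subset ?_
  intro D hD
  refine ⟨hD.1, fun v => ?_⟩
  simp only [Dm, Finsupp.finset_sum_apply, Finsupp.single_apply]
  simp only [Finset.sum_ite_eq', Set.Finite.mem_toFinset, Set.mem_setOf_eq]
  have h0 := hD.1 v
  simp at h0
  by_cases hv : D v = 0
  · rw [hv]; split_ifs with h1
    · rw [← hD.2]; exact degD_nonneg hD.1
    · exact le_refl _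
  · have h1 := Eff_deg_le h hD v hv
    rw [if_pos (by omega)]
    have h2 := le_degD h hD.1 v
    have h3 : (1 : ℤ) ≤ deg k v := by exact_mod_cast deg_pos h v
    rw [hD.2] at h2
    nlinarith

lemma card_LL (h : FFd k K) (D : FFPrime K →₀ ℤ) : Finite (LL k D) ∧ Nat.card (LL k D) = Nat.card k ^ (ell k D).toNat := by
  haveI := fin_LL h D
  refine ⟨Module.finite_of_finite k, ?_⟩
  rw [Module.natCard_eq_pow_finrank (K := k)]; rfl

/-- nonzero elements -/
lemma fin_LLs (h : FFd k K) (D : FFPrime K →₀ ℤ) : {x : K | x ≠ 0 ∧ 0 ≤ dv x + D}.Finite ∧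
    {x : K | x ≠ 0 ∧ 0 ≤ dv x + D}.ncard = Nat.card k ^ (ell k D).toNat - 1 := by
  obtain ⟨h1, h2⟩ := card_LL h D
  have h3 : {x : K | x ≠ 0 ∧ 0 ≤ dv x + D} = (LL k D : Set K) \ {0} := by
    ext x
    simp only [Set.mem_setOf_eq, Set.mem_diff, SetLike.mem_coe, Set.mem_singleton_iff]
    constructor
    · rintro ⟨h4, h5⟩; exact ⟨(mem_LL h h4).2 h5, h4⟩
    · rintro ⟨h4, h5⟩; exact ⟨h5, (mem_LL h h5).1 h4⟩
  have hf : (LL k D : Set K).Finite := h1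
  rw [h3]
  refine ⟨hf.diff, ?_⟩
  rw [Set.ncard_diff_singleton_of_mem (Submodule.zero_mem _), ← h2]; rfl

theorem sum_char_zero (h : FFd k K) : ∃ c : ℕ, ∀ (ψ : Multiplicative (FFPrime K →₀ ℤ) →* ℂ)
    (hp : ∀ x : K, x ≠ 0 → ψ (.ofAdd (dv x)) = 1) (D0 : FFPrime K →₀ ℤ) (hD0 : degD k D0 = 0) (hψ : ψ (.ofAdd D0) ≠ 1),
    ∀ d : ℕ, c ≤ d → ∑ D ∈ (finite_Eff (K := K) h d).toFinset, ψ (.ofAdd D) = 0 := by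
  classical
  obtain ⟨c, R, hR⟩ := RR h
  have hQ : 1 < Nat.card k := Finite.one_lt_card
  refine ⟨(max c (R + 1)).toNat, fun ψ hp D0 hD0 hψ d hd => ?_⟩
  set E := (finite_Eff (K := K) h d).toFinset
  set N : ℕ := Nat.card k ^ (d - R : ℤ).toNat - 1
  have hNpos : 0 < N := by
    have h1 : (d - R : ℤ).toNat ≠ 0 := by omega
    have := Nat.one_lt_pow h1 hQ
    omega
  have hcard : ∀ D, degD k D = d → (fin_LLs h D).1.toFinset.card = N := by
    intro D hD
    rw [← Set.ncard_eq_toFinset_card _ (fin_LLs h D).1, (fin_LLs h D).2, hR D (by omega), hD]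
  have hmemE : ∀ D, D ∈ E ↔ 0 ≤ D ∧ degD k D = d := fun D => by simp [E, Eff]
  have key : ∑ s ∈ E.sigma (fun D => (fin_LLs h (D + D0)).1.toFinset), ψ (.ofAdd (s.1 + D0 + dv s.2))
      = ∑ s ∈ E.sigma (fun D => (fin_LLs h (D - D0)).1.toFinset), ψ (.ofAdd s.1) := by
    refine Finset.sum_bij' (fun s _ => (⟨s.1 + D0 + dv s.2, s.2⁻¹⟩ : Σ _ : FFPrime K →₀ ℤ, K))
      (fun s _ => (⟨s.1 - D0 + dv s.2, s.2⁻¹⟩ : Σ _ : FFPrime K →₀ ℤ, K)) ?_ ?_ ?_ ?_ ?_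
    · rintro ⟨D, f⟩ hs
      simp only [Finset.mem_sigma, Set.Finite.mem_toFinset, Set.mem_setOf_eq, hmemE] at hs ⊢
      obtain ⟨⟨h1, h2⟩, h3, h4⟩ := hs
      refine ⟨⟨?_, ?_⟩, inv_ne_zero h3, ?_⟩
      · convert h4 using 1; abel
      · rw [map_add, map_add, degD_dv h, hD0, h2]; ring
      · rw [dv_inv h]; convert h1 using 1; abel
    · rintro ⟨D, f⟩ hs
      simp only [Finset.mem_sigma, Set.Finite.mem_toFinset, Set.mem_setOf_eq, hmemE] at hs ⊢
      obtain ⟨⟨h1, h2⟩, h3, h4⟩ := hs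
      refine ⟨⟨?_, ?_⟩, inv_ne_zero h3, ?_⟩
      · convert h4 using 1; abel
      · rw [map_add, map_sub, degD_dv h, hD0, h2]; ring
      · rw [dv_inv h]; convert h1 using 1; abel
    · rintro ⟨D, f⟩ hs
      simp [dv_inv h]; abel
    · rintro ⟨D, f⟩ hs
      simp [dv_inv h]; abel
    · rintro ⟨D, f⟩ hs; rfl
  rw [Finset.sum_sigma, Finset.sum_sigma] at key
  have hl : ∀ D ∈ E, ∑ f ∈ (fin_LLs h (D + D0)).1.toFinset, ψ (.ofAdd (D + D0 + dv f)) = N * (ψ (.ofAdd D) * ψ (.ofAdd D0)) := by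
    intro D hD
    rw [Finset.sum_congr rfl (g := fun _ => ψ (.ofAdd D) * ψ (.ofAdd D0)), Finset.sum_const, hcard, nsmul_eq_mul]
    · rw [map_add, hD0, ((hmemE D).1 hD).2, add_zero]
    · intro f hf
      simp only [Set.Finite.mem_toFinset, Set.mem_setOf_eq] at hf
      rw [ofAdd_add, ofAdd_add, map_mul, map_mul, hp f hf.1, mul_one]
  have hr : ∀ D ∈ E, ∑ f ∈ (fin_LLs h (D - D0)).1.toFinset, ψ (.ofAdd D) = N * ψ (.ofAdd D) := by
    intro D hD
    rw [Finset.sum_const, hcard, nsmul_eq_mul]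
    rw [map_sub, hD0, ((hmemE D).1 hD).2, sub_zero]
  rw [Finset.sum_congr rfl hl, Finset.sum_congr rfl hr, ← Finset.mul_sum, ← Finset.mul_sum, ← Finset.sum_mul] at key
  have hN : (N : ℂ) ≠ 0 := by exact_mod_cast hNpos.ne'
  have key2 := mul_left_cancel₀ hN key
  by_contra hA
  apply hψ
  field_simp at key2
  exact key2

end FFPrime

end

noncomputable section
set_option linter.all false
open Finset PowerSeries

/-- geometric series -/
def geo {R : Type} [CommRing R] (a : R) (e : ℕ) : PowerSeries R :=
  PowerSeries.mk fun m => if e ∣ m then a ^ (m / e) else 0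

lemma geo_mul {R : Type} [CommRing R] (a : R) {e : ℕ} (he : 0 < e) : geo a e * (1 - PowerSeries.C a * PowerSeries.X ^ e) = 1 := by
  ext m
  rw [mul_sub, mul_one, map_sub, ← mul_assoc, PowerSeries.coeff_mul_X_pow', PowerSeries.coeff_mul_C, geo, PowerSeries.coeff_mk,
    PowerSeries.coeff_one]
  by_cases hm : m = 0
  · subst hm; simp [he.ne']
  · rw [if_neg hm]
    by_cases h1 : e ≤ m
    · rw [if_pos h1, PowerSeries.coeff_mk]
      by_cases h2 : e ∣ m
      · obtain ⟨n, rfl⟩ := h2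
        have hn : n ≠ 0 := by rintro rfl; simp at hm
        obtain ⟨n, rfl⟩ := Nat.exists_eq_succ_of_ne_zero hn
        have h3 : e * n.succ - e = e * n := by rw [Nat.mul_succ]; omega
        rw [h3, Nat.mul_div_cancel_left _ he, Nat.mul_div_cancel_left _ he]
        simp [pow_succ]
      · have h3 : ¬ e ∣ m - e := fun h => h2 (by have := Nat.dvd_add h (dvd_refl e); rwa [Nat.sub_add_cancel h1] at this)
        simp [h2, h3]
    · rw [if_neg h1]
      have h2 : ¬ e ∣ m := fun h => h1 (Nat.le_of_dvd (by omega) h)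
      simp [h2]

/-- natural number geometric series -/
def geoN (e : ℕ) : PowerSeries ℕ := PowerSeries.mk fun m => if e ∣ m then 1 else 0

lemma geoN_map (e : ℕ) : PowerSeries.map (Nat.castRingHom ℂ) (geoN e) = geo (1 : ℂ) e := by
  ext m
  simp [geoN, geo]

lemma prod_geo_inert {q e : ℕ} (hq : q.Prime) (he : 0 < e) {ω : ℂ} (hω : IsPrimitiveRoot ω q) {a : ℂ} (ha : a ^ q = 1) :
    ∏ j ∈ range q, geo (a * ω ^ j) e = geo 1 (q * e) := by
  haveI : NeZero q := ⟨hq.ne_zero⟩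
  have h1 : (∏ j ∈ range q, geo (a * ω ^ j) e) * ∏ j ∈ range q, (1 - PowerSeries.C (a * ω ^ j) * PowerSeries.X ^ e) = 1 := by
    rw [← Finset.prod_mul_distrib]
    exact Finset.prod_eq_one (fun j _ => geo_mul _ he)
  have h2 := geo_mul (1 : ℂ) (Nat.mul_pos hq.pos he)
  have hω' : IsPrimitiveRoot (PowerSeries.C ω) q := hω.map_of_injective PowerSeries.C_injective
  have h3 : ∏ j ∈ range q, (1 - PowerSeries.C (a * ω ^ j) * PowerSeries.X ^ e) = 1 - PowerSeries.C (1 : ℂ) * PowerSeries.X ^ (q * e) := by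
    have h4 := hω'.pow_sub_pow_eq_prod_sub_mul 1 (PowerSeries.C a * PowerSeries.X ^ e) hq.pos
    rw [one_pow, mul_pow, ← map_pow, ha, ← pow_mul, mul_comm e q] at h4
    rw [h4]
    symm
    refine Finset.prod_bij' (s := Polynomial.nthRootsFinset q 1) (t := range q) (f := fun x => 1 - x * (PowerSeries.C a * PowerSeries.X ^ e)) 
      (fun x hx => (hω'.eq_pow_of_pow_eq_one ((Polynomial.mem_nthRootsFinset hq.pos _).1 hx)).choose) (fun j _ => PowerSeries.C ω ^ j) ?_ ?_ ?_ ?_ ?_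
    · intro x hx
      have := (hω'.eq_pow_of_pow_eq_one ((Polynomial.mem_nthRootsFinset hq.pos _).1 hx)).choose_spec
      simpa using this.1
    · intro j hj
      rw [Polynomial.mem_nthRootsFinset hq.pos, ← pow_mul, mul_comm, pow_mul, hω'.pow_eq_one, one_pow]
    · intro x hx
      exact (hω'.eq_pow_of_pow_eq_one ((Polynomial.mem_nthRootsFinset hq.pos _).1 hx)).choose_spec.2
    · intro j hj
      have hx : PowerSeries.C ω ^ j ∈ Polynomial.nthRootsFinset q (1 : PowerSeries ℂ) := by
        rw [Polynomial.mem_nthRootsFinset hq.pos, ← pow_mul, mul_comm, pow_mul, hω'.pow_eq_one, one_pow]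
      have := (hω'.eq_pow_of_pow_eq_one ((Polynomial.mem_nthRootsFinset hq.pos _).1 hx)).choose_spec
      exact hω'.pow_inj this.1 (by simpa using hj) this.2
    · intro x hx
      have := (hω'.eq_pow_of_pow_eq_one ((Polynomial.mem_nthRootsFinset hq.pos _).1 hx)).choose_spec.2
      conv_lhs => rw [← this]
      rw [map_mul, map_pow]; ring
  rw [h3] at h1
  calc _ = (∏ j ∈ range q, geo (a * ω ^ j) e) * ((1 - PowerSeries.C (1 : ℂ) * PowerSeries.X ^ (q * e)) * geo 1 (q * e)) := by
        rw [mul_comm _ (geo (1 : ℂ) _), h2, mul_one]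
    _ = _ := by rw [← mul_assoc, h1, one_mul]

namespace FFPrime
variable {k : Type} {K : Type} [Field k] [Finite k] [Field K] [Algebra k K]

/-- Euler product -/
lemma coeff_euler (h : FFd k K) (ψ : Multiplicative (FFPrime K →₀ ℤ) →* ℂ) (B d : ℕ) (hd : d ≤ B) :
    PowerSeries.coeff d (∏ v ∈ (finite_places (K := K) h B).toFinset, geo (ψ (.ofAdd (Finsupp.single v 1))) (deg k v))
      = ∑ D ∈ (finite_Eff (K := K) h d).toFinset, ψ (.ofAdd D) := by
  classical
  set P := (finite_places (K := K) h B).toFinset with hP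
  have hPm : ∀ v, v ∈ P ↔ deg k v ≤ B := fun v => by simp [hP]
  rw [PowerSeries.coeff_prod]
  symm
  have hmem : ∀ D, D ∈ (finite_Eff (K := K) h d).toFinset ↔ 0 ≤ D ∧ degD k D = d := fun D => by simp [Eff]
  have hsup : ∀ D, D ∈ (finite_Eff (K := K) h d).toFinset → D.support ⊆ P := by
    intro D hD v hv
    have := Eff_deg_le h (by simpa using hD : D ∈ Eff k (d : ℤ)) v (by simpa using hv)
    rw [hPm]; omega
  refine Finset.sum_of_injOn (fun D => ∑ v ∈ P, Finsupp.single v ((D v).toNat * deg k v)) ?_ ?_ ?_ ?_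
  · intro D hD D' hD' he
    ext v
    have h1 := DFunLike.congr_fun he v
    simp only [Finsupp.finset_sum_apply, Finsupp.single_apply, Finset.sum_ite_eq'] at h1
    have e1 := ((hmem D).1 hD).1 v
    have e2 := ((hmem D').1 hD').1 v
    simp at e1 e2
    by_cases hv : v ∈ P
    · rw [if_pos hv, if_pos hv] at h1
      have := Nat.eq_of_mul_eq_mul_right (deg_pos h v) h1
      omega
    · have a1 : D v = 0 := by by_contra h'; exact hv (hsup D hD (by simpa using h'))
      have a2 : D' v = 0 := by by_contra h'; exact hv (hsup D' hD' (by simpa using h'))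
      rw [a1, a2]
  · intro D hD
    have hD1 := (hmem D).1 hD
    rw [Finset.mem_coe, Finset.mem_finsuppAntidiag]
    constructor
    · have e : ∀ v ∈ P, (∑ w ∈ P, Finsupp.single w ((D w).toNat * deg k w)) v = (D v).toNat * deg k v := by
        intro v hv
        simp [Finsupp.finset_sum_apply, Finsupp.single_apply, hv]
      have e2 : ∑ v ∈ P, (∑ w ∈ P, Finsupp.single w ((D w).toNat * deg k w)) v = d := by
        rw [Finset.sum_congr rfl e]
        have h2 := hD1.2
        rw [degD_eq, Finsupp.sum_of_support_subset D (hsup D hD) _ (by simp)] at h2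
        zify
        rw [← h2]
        apply Finset.sum_congr rfl
        intro v hv
        have := hD1.1 v
        simp at this
        rw [Int.toNat_of_nonneg this]
      exact e2
    · intro v hv
      by_contra hv'
      simp [Finsupp.finset_sum_apply, Finsupp.single_apply, hv'] at hv
  · intro l hl hl'
    rw [Finset.mem_finsuppAntidiag] at hl
    by_contra hne
    replace hne := Finset.prod_ne_zero_iff.1 hne
    have hdvd : ∀ v ∈ P, deg k v ∣ l v := by
      intro v hv
      have := hne v hv
      simp only [geo, PowerSeries.coeff_mk] at this
      by_contra h'; simp [h'] at this
    apply hl'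
    refine ⟨∑ v ∈ P, Finsupp.single v ((l v / deg k v : ℕ) : ℤ), ?_, ?_⟩
    · rw [Finset.mem_coe, hmem]
      constructor
      · apply Finset.sum_nonneg
        intro v _
        rw [Finsupp.single_nonneg]; positivity
      · rw [map_sum]
        simp only [degD_single]
        rw [← hl.1]; push_cast
        apply Finset.sum_congr rfl
        intro v hv
        exact_mod_cast Nat.div_mul_cancel (hdvd v hv)
    · ext v
      simp only [Finsupp.finset_sum_apply, Finsupp.single_apply, Finset.sum_ite_eq']
      by_cases hv : v ∈ P
      · rw [if_pos hv, if_pos hv, Int.toNat_natCast, Nat.div_mul_cancel (hdvd v hv)]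
      · rw [if_neg hv]
        by_contra h'
        exact hv (hl.2 (by simpa using Ne.symm h'))
  · intro D hD
    have hD1 := (hmem D).1 hD
    have e3 : D = ∑ v ∈ P, Finsupp.single v (D v) := by
      ext v
      simp only [Finsupp.finset_sum_apply, Finsupp.single_apply, Finset.sum_ite_eq']
      split_ifs with hv
      · rfl
      · by_contra h'; exact hv (hsup D hD (by simpa using h'))
    conv_lhs => rw [e3, ofAdd_sum, map_prod]
    apply Finset.prod_congr rfl
    intro v hv
    simp only [Finsupp.finset_sum_apply, Finsupp.single_apply, Finset.sum_ite_eq', if_pos hv]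
    simp only [geo, PowerSeries.coeff_mk, dvd_mul_left, if_true]
    rw [Nat.mul_div_cancel _ (deg_pos h v), ← map_pow, ← ofAdd_nsmul]
    congr 2
    rw [Finsupp.smul_single]
    congr 1
    have := hD1.1 v
    simp at this ⊢
    omega

end FFPrime

end

noncomputable section
set_option linter.all false
open Finset PowerSeries

lemma ps_zero {q c B m : ℕ} (hq : 0 < q) (F : ℕ → PowerSeries ℂ)
    (hF : ∀ j ∈ range q, ∀ d, c ≤ d → d ≤ B → PowerSeries.coeff d (F j) = 0) (hm : q * c ≤ m) (hB : m ≤ B) :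
    PowerSeries.coeff m (∏ j ∈ range q, F j) = 0 := by
  classical
  rw [PowerSeries.coeff_prod]
  apply Finset.sum_eq_zero
  intro l hl
  rw [Finset.mem_finsuppAntidiag] at hl
  have h1 : ∑ i ∈ range q, l i = m := hl.1
  have : ∃ j ∈ range q, c ≤ l j := by
    by_contra hcon
    push Not at hcon
    have := Finset.sum_lt_sum_of_nonempty (s := range q) ⟨0, by simpa using hq⟩ hcon
    simp at this
    omega
  obtain ⟨j, hj, hc⟩ := this
  apply Finset.prod_eq_zero hj
  apply hF j hj _ hc
  have := Finset.single_le_sum (f := l) (s := range q) (fun _ _ => Nat.zero_le _) hj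
  omega

lemma ps_pos {ι : Type} (P : Finset ι) (G : ι → PowerSeries ℕ) (h0 : ∀ i ∈ P, PowerSeries.coeff 0 (G i) ≠ 0)
    {i0 : ι} (hi : i0 ∈ P) {m : ℕ} (hm : PowerSeries.coeff m (G i0) ≠ 0) : PowerSeries.coeff m (∏ i ∈ P, G i) ≠ 0 := by
  classical
  rw [PowerSeries.coeff_prod]
  intro h
  rw [Finset.sum_eq_zero_iff] at h
  have := h (Finsupp.single i0 m) (by
    rw [Finset.mem_finsuppAntidiag]
    constructor
    · show P.sum (fun i => (Finsupp.single i0 m : ι →₀ ℕ) i) = m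
      simp [Finsupp.single_apply, hi]
    · exact Finsupp.support_single_subset.trans (by simpa using hi))
  rw [Finset.prod_eq_zero_iff] at this
  obtain ⟨i, hi', h'⟩ := this
  rw [Finsupp.single_apply] at h'
  split_ifs at h' with hh
  · subst hh; exact hm h'
  · exact h0 i hi' h'

lemma exists_dual_ne (F V : Type) [Field F] [AddCommGroup V] [Module F V] {x : V} (hx : x ≠ 0) : ∃ f : V →ₗ[F] F, f x ≠ 0 := by
  by_contra hcon
  push Not at hcon
  exact hx ((Module.forall_dual_apply_eq_zero_iff F x).1 hcon)

lemma exists_char_mod {q : ℕ} [Fact q.Prime] {Q : Type} [AddCommGroup Q] (hk : ∀ x : Q, q • x = 0) {x : Q} (hx : x ≠ 0) :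
    ∃ F : Q →+ ZMod q, F x ≠ 0 := by
  letI : Module (ZMod q) Q := AddCommGroup.zmodModule hk
  obtain ⟨f, hf⟩ := exists_dual_ne (ZMod q) Q hx
  exact ⟨f.toAddMonoidHom, hf⟩

lemma exists_char_sub {q : ℕ} (hq : q.Prime) {A : Type} [AddCommGroup A] (H : AddSubgroup A) (hk : ∀ x : A, q • x ∈ H) {x : A} (hx : x ∉ H) :
    ∃ F : A →+ ZMod q, (∀ y ∈ H, F y = 0) ∧ F x ≠ 0 := by
  haveI : Fact q.Prime := ⟨hq⟩
  obtain ⟨F, hF⟩ := exists_char_mod (q := q) (Q := A ⧸ H) (fun y => by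
    obtain ⟨D, rfl⟩ := QuotientAddGroup.mk_surjective y
    rw [← QuotientAddGroup.mk_nsmul, QuotientAddGroup.eq_zero_iff]
    exact hk D) (x := QuotientAddGroup.mk x) (by rw [Ne, QuotientAddGroup.eq_zero_iff]; exact hx)
  refine ⟨F.comp (QuotientAddGroup.mk' H), ?_, hF⟩
  intro y hy
  have : (QuotientAddGroup.mk y : A ⧸ H) = 0 := (QuotientAddGroup.eq_zero_iff y).2 hy
  show F (QuotientAddGroup.mk y) = 0
  rw [this, map_zero]

namespace FFPrime
variable {k : Type} {K : Type} [Field k] [Finite k] [Field K] [Algebra k K]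

theorem G1 (h : FFd k K) {q : ℕ} (hq : q.Prime) (H : AddSubgroup (FFPrime K →₀ ℤ)) (hp : ∀ x : K, x ≠ 0 → dv x ∈ H)
    (hs : ∀ v : FFPrime K, q ∣ deg k v → Finsupp.single v 1 ∈ H) (hqv : ∀ v : FFPrime K, Finsupp.single v (q : ℤ) ∈ H) :
    ∀ D, degD k D = 0 → D ∈ H := by
  classical
  intro D1 hD1
  by_contra hDH
  haveI : Fact q.Prime := ⟨hq⟩
  have hkill : ∀ D : FFPrime K →₀ ℤ, q • D ∈ H := by
    intro D
    induction D using Finsupp.induction_linear with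
    | zero => simp
    | add f g hf hg => rw [smul_add]; exact H.add_mem hf hg
    | single v n =>
      have := H.zsmul_mem (hqv v) n
      rw [Finsupp.smul_single] at this ⊢
      simpa [mul_comm] using this
  obtain ⟨F, hF, hFD1⟩ := exists_char_sub hq H hkill hDH
  let g : ℕ → (FFPrime K →₀ ℤ) →+ ZMod q := fun j => F + (AddMonoidHom.mulLeft (j : ZMod q)).comp ((Int.castAddHom (ZMod q)).comp (degD k))
  have hg : ∀ j D, g j D = F D + j * (degD k D : ℤ) := fun j D => rfl
  let χ : AddChar (ZMod q) ℂ := ZMod.stdAddChar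
  have hχ : Function.Injective χ := ZMod.injective_stdAddChar
  have hχ1 : ∀ x, χ x = 1 ↔ x = 0 := fun x => by rw [← AddChar.map_zero_eq_one χ]; exact hχ.eq_iff
  let ψ : ℕ → Multiplicative (FFPrime K →₀ ℤ) →* ℂ := fun j => (AddChar.toMonoidHom χ).comp (AddMonoidHom.toMultiplicative (g j))
  have hψ : ∀ j D, ψ j (.ofAdd D) = χ (g j D) := fun j D => rfl
  obtain ⟨c, hc⟩ := sum_char_zero (K := K) h
  obtain ⟨v0, -⟩ := exists_place h
  have hd0 := deg_pos h v0
  set m := q * (deg k v0 * c) with hm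
  have hzero : ∀ j, ∀ d, c ≤ d → d ≤ max m (deg k v0) → PowerSeries.coeff d (∏ v ∈ (finite_places (K := K) h (max m (deg k v0))).toFinset, geo (ψ j (.ofAdd (Finsupp.single v 1))) (deg k v)) = 0 := by
    intro j d hcd hdB
    rw [coeff_euler h (ψ j) _ d hdB]
    refine hc (ψ j) ?_ D1 hD1 ?_ d hcd
    · intro x hx
      rw [hψ, hg, hF _ (hp x hx), degD_dv h x]; simp
    · rw [hψ, hg, hD1, Ne, hχ1]; simpa using hFD1
  have hz := ps_zero hq.pos _ (fun j _ => hzero j) (m := m) (by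
    rw [hm]; exact Nat.mul_le_mul_left _ (Nat.le_mul_of_pos_left _ hd0)) (le_max_left _ _)
  rw [Finset.prod_comm] at hz
  set P := (finite_places (K := K) h (max m (deg k v0))).toFinset with hP
  let G : FFPrime K → PowerSeries ℕ := fun v => if q ∣ deg k v then ∏ j ∈ range q, geoN (deg k v) else geoN (q * deg k v)
  have hE : ∀ v ∈ P, ∏ j ∈ range q, geo (ψ j (.ofAdd (Finsupp.single v 1))) (deg k v) = PowerSeries.map (Nat.castRingHom ℂ) (G v) := by
    intro v hv
    by_cases hqd : q ∣ deg k v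
    · simp only [G, if_pos hqd, map_prod]
      apply Finset.prod_congr rfl
      intro j _
      rw [geoN_map, hψ, hg, hF _ (hs v hqd), degD_single]
      have : ((deg k v : ℕ) : ZMod q) = 0 := (ZMod.natCast_eq_zero_iff _ _).2 hqd
      simp [this]
    · simp only [G, if_neg hqd]
      rw [geoN_map]
      have hdne : ((deg k v : ℕ) : ZMod q) ≠ 0 := fun h' => hqd ((ZMod.natCast_eq_zero_iff _ _).1 h')
      have hω : IsPrimitiveRoot (χ (deg k v : ZMod q)) q := by
        have h1 : (χ (deg k v : ZMod q)) ^ q = 1 := by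
          rw [← AddChar.map_nsmul_eq_pow]; simp
        have h2 : orderOf (χ (deg k v : ZMod q)) = q := orderOf_eq_prime h1 (by rw [Ne, hχ1]; exact hdne)
        have := IsPrimitiveRoot.orderOf (χ (deg k v : ZMod q))
        rwa [h2] at this
      rw [← prod_geo_inert hq (deg_pos h v) hω (a := χ (F (Finsupp.single v 1))) (by rw [← AddChar.map_nsmul_eq_pow]; simp)]
      apply Finset.prod_congr rfl
      intro j _
      congr 1
      rw [hψ, hg, AddChar.map_add_eq_mul, ← AddChar.map_nsmul_eq_pow]
      simp
  rw [Finset.prod_congr rfl hE, ← map_prod, PowerSeries.coeff_map] at hz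
  have hz' : PowerSeries.coeff m (∏ v ∈ P, G v) = 0 := by simpa using hz
  have hgeo0 : ∀ e n, PowerSeries.coeff (e * n) (geoN e) ≠ 0 := by intro e n; simp [geoN]
  refine ps_pos P G ?_ (i0 := v0) (by rw [hP]; simp) ?_ hz'
  · intro v _
    simp only [G]
    split_ifs
    · simp [geoN]
    · simp [geoN]
  · simp only [G]
    split_ifs
    · refine ps_pos _ _ ?_ (i0 := 0) (by simpa using hq.pos) ?_
      · intro _ _; simp [geoN]
      · rw [hm, mul_left_comm]; exact hgeo0 _ _
    · rw [hm, ← mul_assoc]; exact hgeo0 _ _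
end FFPrime

end

noncomputable section
set_option linter.all false
open Finset

lemma fin_group_lemma {A B : Type} [AddCommGroup A] [AddCommGroup B] [Finite A] [Finite B] (s : A →+ A) (N : A →+ B)
    (hN : Function.Surjective N) (hs : ∀ a, N (s a) = N a) (J : B → A) (hJ : ∀ a, s a = a → ∃ b, J b = a) {a : A} (ha : N a = 0) :
    ∃ f, a = s f - f := by
  let δ : A →+ A := s - AddMonoidHom.id A
  have hδ : ∀ x, δ x = s x - x := fun x => rfl
  have c1 : Nat.card δ.range * Nat.card δ.ker = Nat.card A := by
    have := AddSubgroup.card_eq_card_quotient_mul_card_addSubgroup δ.ker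
    rw [this, Nat.card_congr (QuotientAddGroup.quotientKerEquivRange δ).toEquiv]
  have c2 : Nat.card B * Nat.card N.ker = Nat.card A := by
    have := AddSubgroup.card_eq_card_quotient_mul_card_addSubgroup N.ker
    rw [this, Nat.card_congr (QuotientAddGroup.quotientKerEquivOfSurjective N hN).toEquiv]
  have c3 : Nat.card δ.ker ≤ Nat.card B := by
    choose g hg using hJ
    apply Nat.card_le_card_of_injective (fun x : δ.ker => g x.1 (by
      have := x.2; rw [AddMonoidHom.mem_ker, hδ, sub_eq_zero] at this; exact this))
    intro x y hxy
    have h1 := hg x.1 (by have := x.2; rw [AddMonoidHom.mem_ker, hδ, sub_eq_zero] at this; exact this)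
    have h2 := hg y.1 (by have := y.2; rw [AddMonoidHom.mem_ker, hδ, sub_eq_zero] at this; exact this)
    apply Subtype.ext
    rw [← h1, ← h2]
    simp only at hxy
    rw [hxy]
  have hle : δ.range ≤ N.ker := by
    rintro _ ⟨x, rfl⟩
    rw [AddMonoidHom.mem_ker, hδ, map_sub, hs, sub_self]
  have hB : 0 < Nat.card B := Nat.card_pos
  have c4 : Nat.card N.ker ≤ Nat.card δ.range := by
    have h1 : Nat.card B * Nat.card N.ker ≤ Nat.card B * Nat.card δ.range := by
      rw [c2, ← c1, mul_comm]; exact Nat.mul_le_mul_right _ c3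
    exact Nat.le_of_mul_le_mul_left h1 hB
  have : δ.range = N.ker := AddSubgroup.eq_of_le_of_card_ge hle c4
  have ha' : a ∈ δ.range := by rw [this]; exact ha
  obtain ⟨f, hf⟩ := ha'
  exact ⟨f, by rw [← hf, hδ]⟩

lemma fin_quot {X : Type} [AddCommGroup X] (D P : AddSubgroup X) (F : Set X) (hF : F.Finite)
    (h : ∀ x ∈ D, ∃ f ∈ F, x - f ∈ P) : Finite (D ⧸ P.addSubgroupOf D) := by
  haveI := hF.to_subtype
  choose! g hgF hgP using h
  apply Finite.of_injective (fun x : D ⧸ P.addSubgroupOf D => (⟨g x.out, hgF _ x.out.2⟩ : F))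
  intro x y hxy
  simp only [Subtype.mk.injEq] at hxy
  rw [← QuotientAddGroup.out_eq' x, ← QuotientAddGroup.out_eq' y, QuotientAddGroup.eq, AddSubgroup.mem_addSubgroupOf]
  have h1 := hgP _ x.out.2
  have h2 := hgP _ y.out.2
  rw [hxy] at h1
  have := P.sub_mem h2 h1
  simp at this
  rw [AddSubgroup.coe_add, AddSubgroup.coe_neg, neg_add_eq_sub]
  exact this

lemma abs_group {X : Type} [AddCommGroup X] (s T : X →+ X) (D P I R : AddSubgroup X)
    (hI : I ≤ D) (hsD : ∀ x ∈ D, s x ∈ D) (hsP : ∀ x ∈ P, s x ∈ P) (hTD : ∀ x ∈ D, T x ∈ I) (hTP : ∀ x ∈ P, T x ∈ R)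
    (hTs : ∀ x, T (s x) = T x) (F1 F2 : Set X) (hF1 : F1.Finite) (hF2 : F2.Finite)
    (h1 : ∀ x ∈ D, ∃ f ∈ F1, x - f ∈ P) (h2 : ∀ x ∈ I, ∃ f ∈ F2, x - f ∈ R) (hRP : R ≤ P)
    (hsurj : ∀ y ∈ I, ∃ x ∈ D, y - T x ∈ R) (hinv : ∀ x ∈ D, s x - x ∈ P → ∃ y ∈ I, x - y ∈ P)
    {x : X} (hx : x ∈ D) (hTx : T x ∈ R) : ∃ y ∈ D, x - (s y - y) ∈ P := by
  haveI := fin_quot D P F1 hF1 h1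
  haveI := fin_quot I R F2 hF2 h2
  let s' : D →+ D := (s.comp D.subtype).codRestrict D (fun x => hsD _ x.2)
  let T' : D →+ I := (T.comp D.subtype).codRestrict I (fun x => hTD _ x.2)
  let sq : D ⧸ P.addSubgroupOf D →+ D ⧸ P.addSubgroupOf D := QuotientAddGroup.map _ _ s' (fun x hx => by
    rw [AddSubgroup.mem_comap, AddSubgroup.mem_addSubgroupOf]; exact hsP _ hx)
  let Tq : D ⧸ P.addSubgroupOf D →+ I ⧸ R.addSubgroupOf I := QuotientAddGroup.map _ _ T' (fun x hx => by
    rw [AddSubgroup.mem_comap, AddSubgroup.mem_addSubgroupOf]; exact hTP _ hx)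
  let j' : I →+ D := AddSubgroup.inclusion hI
  let jq : I ⧸ R.addSubgroupOf I →+ D ⧸ P.addSubgroupOf D := QuotientAddGroup.map _ _ j' (fun x hx => by
    rw [AddSubgroup.mem_comap, AddSubgroup.mem_addSubgroupOf]; exact hRP hx)
  have key := fin_group_lemma sq Tq (by
      intro b
      obtain ⟨y, rfl⟩ := QuotientAddGroup.mk_surjective b
      obtain ⟨x, hx, hxy⟩ := hsurj y.1 y.2
      refine ⟨QuotientAddGroup.mk ⟨x, hx⟩, ?_⟩
      show (QuotientAddGroup.mk (T' ⟨x, hx⟩) : I ⧸ R.addSubgroupOf I) = _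
      rw [QuotientAddGroup.eq, AddSubgroup.mem_addSubgroupOf, AddSubgroup.coe_add, AddSubgroup.coe_neg, neg_add_eq_sub]
      exact hxy) (by
      intro b
      obtain ⟨y, rfl⟩ := QuotientAddGroup.mk_surjective b
      show (QuotientAddGroup.mk (T' (s' y)) : I ⧸ R.addSubgroupOf I) = QuotientAddGroup.mk (T' y)
      congr 1
      exact Subtype.ext (hTs y.1)) jq (by
      intro b hb
      obtain ⟨y, rfl⟩ := QuotientAddGroup.mk_surjective b
      have hb' : (QuotientAddGroup.mk (s' y) : D ⧸ P.addSubgroupOf D) = QuotientAddGroup.mk y := hb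
      rw [eq_comm, QuotientAddGroup.eq, AddSubgroup.mem_addSubgroupOf, AddSubgroup.coe_add, AddSubgroup.coe_neg, neg_add_eq_sub] at hb'
      obtain ⟨z, hz, hzy⟩ := hinv y.1 y.2 hb'
      refine ⟨QuotientAddGroup.mk ⟨z, hz⟩, ?_⟩
      show (QuotientAddGroup.mk (j' ⟨z, hz⟩) : D ⧸ P.addSubgroupOf D) = _
      rw [QuotientAddGroup.eq, AddSubgroup.mem_addSubgroupOf, AddSubgroup.coe_add, AddSubgroup.coe_neg, neg_add_eq_sub]
      exact hzy) (a := QuotientAddGroup.mk ⟨x, hx⟩) (by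
      show (QuotientAddGroup.mk (T' ⟨x, hx⟩) : I ⧸ R.addSubgroupOf I) = 0
      rw [QuotientAddGroup.eq_zero_iff, AddSubgroup.mem_addSubgroupOf]
      exact hTx)
  obtain ⟨f, hf⟩ := key
  obtain ⟨y, rfl⟩ := QuotientAddGroup.mk_surjective f
  refine ⟨y.1, y.2, ?_⟩
  have hf' : (QuotientAddGroup.mk ⟨x, hx⟩ : D ⧸ P.addSubgroupOf D) = QuotientAddGroup.mk (s' y - y) := hf
  rw [eq_comm, QuotientAddGroup.eq, AddSubgroup.mem_addSubgroupOf, AddSubgroup.coe_add, AddSubgroup.coe_neg, neg_add_eq_sub] at hf'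
  exact hf'

namespace FFPrime
variable {k : Type} {K : Type} [Field k] [Finite k] [Field K] [Algebra k K]

lemma alg_of_dv (h : FFd k K) {x : K} (hx : ∀ v : FFPrime K, v.z x = 0) : IsAlgebraic k x := by
  by_contra ht
  obtain ⟨v, hv⟩ := exists_pole h ht
  rw [hx v] at hv
  exact lt_irrefl _ hv

lemma pic_fin (h : FFd k K) : ∃ F : Set (FFPrime K →₀ ℤ), F.Finite ∧ ∀ D, degD k D = 0 → ∃ f ∈ F, ∃ x : K, x ≠ 0 ∧ D - f = dv x := by
  obtain ⟨c, R, hRR⟩ := RR (K := K) h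
  obtain ⟨v0, -⟩ := exists_place h
  have hd0 : (1 : ℤ) ≤ deg k v0 := by exact_mod_cast deg_pos h v0
  set n : ℤ := max (max c (R + 1)) 0 with hn
  have hn1 : c ≤ n * deg k v0 := by
    have : c ≤ n := le_trans (le_max_left _ _) (le_max_left _ _)
    have : 0 ≤ n := le_max_right _ _
    nlinarith
  have hn2 : R + 1 ≤ n * deg k v0 := by
    have : R + 1 ≤ n := le_trans (le_max_right _ _) (le_max_left _ _)
    have : 0 ≤ n := le_max_right _ _
    nlinarith
  refine ⟨Set.image (fun E => E - Finsupp.single v0 n) (Eff k (n * deg k v0)), (finite_Eff h _).image _, ?_⟩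
  intro D hD
  have hdeg : degD k (D + Finsupp.single v0 n) = n * deg k v0 := by rw [map_add, hD, degD_single, zero_add]
  obtain ⟨x, hx, hx2⟩ := ell_pos_iff h (D + Finsupp.single v0 n) (by rw [hRR _ (by rw [hdeg]; exact hn1), hdeg]; omega)
  refine ⟨_, ⟨dv x + (D + Finsupp.single v0 n), ⟨hx2, by rw [map_add, degD_dv h, hdeg, zero_add]⟩, rfl⟩, x⁻¹, inv_ne_zero hx, ?_⟩
  rw [dv_inv h]; ext w; simp; ring

lemma pic_tors (h : FFd k K) {D : FFPrime K →₀ ℤ} (hD : degD k D = 0) : ∃ n : ℕ, 0 < n ∧ ∃ x : K, x ≠ 0 ∧ n • D = dv x := by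
  obtain ⟨F, hF, hF2⟩ := pic_fin (K := K) h
  have : ∀ n : ℕ, ∃ f ∈ F, ∃ x : K, x ≠ 0 ∧ n • D - f = dv x := fun n => hF2 _ (by rw [map_nsmul, hD, smul_zero])
  choose f hfF x hx hxe using this
  obtain ⟨m, n, hmn, hfe⟩ := Set.Finite.exists_lt_map_eq_of_forall_mem hfF hF
  refine ⟨n - m, by omega, x n * (x m)⁻¹, mul_ne_zero (hx n) (inv_ne_zero (hx m)), ?_⟩
  rw [dv_mul h (hx n) (inv_ne_zero (hx m)), dv_inv h, ← hxe, ← hxe, hfe, sub_nsmul _ (le_of_lt hmn)]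
  abel

lemma phi_zero (h : FFd k K) (φ : (FFPrime K →₀ ℤ) →+ ℤ) (h0 : ∀ x : K, x ≠ 0 → φ (dv x) = 0) {D} (hD : degD k D = 0) : φ D = 0 := by
  obtain ⟨n, hn, x, hx, he⟩ := pic_tors h hD
  have := h0 x hx
  rw [← he, map_nsmul] at this
  simpa [hn.ne'] using this

lemma phi_zero' (h : FFd k K) (φ : (FFPrime K →₀ ℤ) →+ ℤ) (h0 : ∀ x : K, x ≠ 0 → φ (dv x) = 0) (hpos : ∀ v, φ (Finsupp.single v 1) ≠ 0)
    {D} (hD : φ D = 0) : degD k D = 0 := by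
  obtain ⟨v, -⟩ := exists_place h
  have h1 := phi_zero h φ h0 (D := degD k D • Finsupp.single v 1 - (deg k v : ℤ) • D) (by
    rw [map_sub, map_zsmul, map_zsmul, degD_single]; simp; ring)
  rw [map_sub, map_zsmul, map_zsmul, hD] at h1
  simpa [hpos v] using h1
end FFPrime

end

noncomputable section
set_option linter.all false
open Finset IntermediateField

lemma adjoin_gen_top {k M : Type} [Field k] [Field M] [Algebra k M] (β : M) :
    IntermediateField.adjoin k ({AdjoinSimple.gen k β} : Set k⟮β⟯) = ⊤ := by
  apply IntermediateField.lift_injective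
  rw [IntermediateField.lift_adjoin_simple, IntermediateField.lift_top, AdjoinSimple.coe_gen]

lemma FFd.ext {k K M : Type} [Field k] [Field K] [Field M] [Algebra k K] [Algebra k M] [Algebra K M] [IsScalarTower k K M]
    [FiniteDimensional K M] (h : FFd k K) : FFd k M := by
  obtain ⟨t, ht, hf⟩ := h
  refine ⟨algebraMap K M t, (transcendental_algebraMap_iff (algebraMap K M).injective).2 ht, ?_⟩
  have hmem : ∀ x : k⟮t⟯, algebraMap K M x ∈ k⟮algebraMap K M t⟯ := by
    intro x
    have h1 : k⟮algebraMap K M t⟯ = (k⟮t⟯).map (IsScalarTower.toAlgHom k K M) := by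
      rw [IntermediateField.adjoin_map, Set.image_singleton]; rfl
    rw [h1]
    exact ⟨x, x.2, rfl⟩
  let f : k⟮t⟯ →+* k⟮algebraMap K M t⟯ := ((algebraMap K M).comp (algebraMap k⟮t⟯ K)).codRestrict (k⟮algebraMap K M t⟯).toSubfield.toSubring hmem
  letI : Algebra k⟮t⟯ k⟮algebraMap K M t⟯ := f.toAlgebra
  haveI : IsScalarTower k⟮t⟯ k⟮algebraMap K M t⟯ M := IsScalarTower.of_algebraMap_eq' (by
    ext x
    rfl)
  haveI : FiniteDimensional k⟮t⟯ M := FiniteDimensional.trans k⟮t⟯ K M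
  exact Module.Finite.of_restrictScalars_finite k⟮t⟯ k⟮algebraMap K M t⟯ M

/-- q-th power criterion in a finite domain -/
lemma pow_crit {R : Type} [CommRing R] [IsDomain R] [Finite R] {q t : ℕ} (ht : Nat.card Rˣ = q * t) (u : Rˣ) (hu : u ^ t = 1) :
    ∃ r : Rˣ, r ^ q = u := by
  obtain ⟨g, hg⟩ := IsCyclic.exists_generator (α := Rˣ)
  have hog := orderOf_eq_card_of_forall_mem_zpowers hg
  have hpos : 0 < Nat.card Rˣ := Nat.card_pos
  obtain ⟨m, hm⟩ := (mem_powers_iff_mem_zpowers.2 (hg u) : u ∈ Submonoid.powers g)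
  simp only at hm
  have ht0 : 0 < t := Nat.pos_of_ne_zero (by rintro rfl; omega)
  rw [← hm, ← pow_mul] at hu
  have := orderOf_dvd_of_pow_eq_one hu
  rw [hog, ht] at this
  obtain ⟨r, rfl⟩ := Nat.dvd_of_mul_dvd_mul_right ht0 this
  exact ⟨g ^ r, by rw [← hm, ← pow_mul, mul_comm]⟩

lemma card_units_div {q Q d : ℕ} (hQ : 0 < Q) (h1 : q ∣ Q - 1) (h2 : q ∣ d) : ∃ t, Q ^ d - 1 = q * ((Q - 1) * t) := by
  have hS : q ∣ ∑ i ∈ range d, Q ^ i := by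
    have hc : Q ≡ 1 [MOD q] := ((Nat.modEq_iff_dvd' hQ).2 h1).symm
    have : ∑ i ∈ range d, Q ^ i ≡ ∑ i ∈ range d, 1 [MOD q] := by
      apply Nat.ModEq.sum
      intro i _
      simpa using hc.pow i
    simp at this
    exact (Nat.modEq_zero_iff_dvd.1 (this.trans (Nat.modEq_zero_iff_dvd.2 h2)))
  obtain ⟨t, ht⟩ := hS
  refine ⟨t, ?_⟩
  obtain ⟨Q, rfl⟩ := Nat.exists_eq_add_of_lt hQ
  have h3 := geom_sum_mul_add Q d
  simp only [zero_add, Nat.add_sub_cancel] at *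
  rw [← h3, ht, Nat.add_sub_cancel]
  ring

/-- constant cyclic extension -/
structure GS (p q : ℕ) (k K M : Type) [Field k] [Field K] [Field M] [Algebra k K] [Algebra k M] [Algebra K M]
    (ζ : K) (σ : M ≃ₐ[K] M) (β : M) (u : k) : Prop where
  ff : FFd k K
  ex : ∀ x : K, IsAlgebraic k x → ∃ c : k, algebraMap k K c = x
  cyc : Cyc q K M ζ σ β
  hu : β ^ q = algebraMap k M u

namespace GS
variable {p q : ℕ} {k K M : Type} [Field k] [Finite k] [Field K] [Field M] [Algebra k K] [Algebra k M] [Algebra K M] [IsScalarTower k K M]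
  {ζ : K} {σ : M ≃ₐ[K] M} {β : M} {u : k} [Fact p.Prime] [CharP M p]

lemma ffM (G : GS p q k K M ζ σ β u) : FFd k M := by
  haveI := G.cyc.finiteDim
  exact G.ff.ext

lemma u_ne (G : GS p q k K M ζ σ β u) : u ≠ 0 := by
  intro h
  have := G.hu
  rw [h, map_zero] at this
  exact G.cyc.ne (pow_eq_zero_iff G.cyc.hq.ne_zero |>.1 this)

lemma beta_alg (G : GS p q k K M ζ σ β u) : IsAlgebraic k β := by
  have h1 : IsAlgebraic k (β ^ q) := by rw [G.hu]; exact isAlgebraic_algebraMap u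
  exact h1.of_pow G.cyc.hq.pos

lemma exists_zeta (G : GS p q k K M ζ σ β u) : ∃ z : k, algebraMap k K z = ζ ∧ IsPrimitiveRoot z q := by
  obtain ⟨z, hz⟩ := G.ex ζ (by
    have : IsAlgebraic k (ζ ^ q) := by rw [G.cyc.prim.pow_eq_one]; exact isAlgebraic_one
    exact this.of_pow G.cyc.hq.pos)
  refine ⟨z, hz, ?_⟩
  have := G.cyc.prim
  rw [← hz] at this
  exact IsPrimitiveRoot.of_map_of_injective this (algebraMap k K).injective

lemma nonres (G : GS p q k K M ζ σ β u) (r : k) : r ^ q ≠ u := by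
  intro h
  haveI : NeZero q := ⟨G.cyc.hq.ne_zero⟩
  have h1 : β ^ q = (algebraMap k M r) ^ q := by rw [G.hu, ← h, map_pow]
  have hr : algebraMap k M r ≠ 0 := by
    intro h0; rw [h0, zero_pow G.cyc.hq.ne_zero] at h1; exact G.cyc.ne (pow_eq_zero_iff G.cyc.hq.ne_zero |>.1 h1)
  have h2 : (β / algebraMap k M r) ^ q = 1 := by rw [div_pow, h1, div_self (pow_ne_zero _ hr)]
  obtain ⟨i, -, hi⟩ := G.cyc.primN.eq_pow_of_pow_eq_one h2
  have h3 : β = algebraMap K M (ζ ^ i * algebraMap k K r) := by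
    rw [map_mul, map_pow, hi, ← IsScalarTower.algebraMap_apply, div_mul_cancel₀ _ hr]
  have h4 := G.cyc.act
  have h5 : σ β = β := by rw [h3, AlgEquiv.commutes]
  rw [h5] at h4
  have h6 : algebraMap K M ζ = 1 := by
    have := mul_right_cancel₀ G.cyc.ne ((one_mul β).trans h4); exact this.symm
  exact G.cyc.primN.ne_one G.cyc.hq.one_lt h6

lemma norm_const (G : GS p q k K M ζ σ β u) (c : k) : ∃ y : M, IsAlgebraic k y ∧ nm q σ y = algebraMap k M c := by
  obtain ⟨z, hz, hzp⟩ := G.exists_zeta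
  have hθ : (AdjoinSimple.gen k β) ^ q = algebraMap k k⟮β⟯ u := by
    apply (algebraMap k⟮β⟯ M).injective
    rw [map_pow, AdjoinSimple.algebraMap_gen, G.hu]; rfl
  obtain ⟨τ, hτ⟩ := Cyc.of_root G.cyc.hq hzp hθ (adjoin_gen_top β) G.u_ne G.nonres
  haveI := hτ.finiteDim
  haveI : Finite k⟮β⟯ := Module.finite_of_finite k
  obtain ⟨y, hy⟩ := FiniteField.norm_surjective k k⟮β⟯ c
  refine ⟨algebraMap k⟮β⟯ M y, (Algebra.IsAlgebraic.isAlgebraic y).algebraMap, ?_⟩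
  have h1 : ∀ x, algebraMap k⟮β⟯ M (τ x) = σ (algebraMap k⟮β⟯ M x) := by
    intro x
    rw [hτ.expand x]
    simp only [map_sum, map_mul, map_pow, hτ.act, AlgEquiv.commutes, AdjoinSimple.algebraMap_gen, G.cyc.act]
    apply Finset.sum_congr rfl
    intro j _
    have e1 : ∀ c : k, algebraMap k⟮β⟯ M (algebraMap k k⟮β⟯ c) = algebraMap K M (algebraMap k K c) := by
      intro c; rw [← IsScalarTower.algebraMap_apply, ← IsScalarTower.algebraMap_apply]
    rw [e1, e1, AlgEquiv.commutes, hz]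
  have h2 : ∀ i : ℕ, ∀ x, algebraMap k⟮β⟯ M ((τ ^ i) x) = (σ ^ i) (algebraMap k⟮β⟯ M x) := by
    intro i
    induction i with
    | zero => intro x; simp
    | succ i ih => intro x; rw [pow_succ, pow_succ, AlgEquiv.mul_apply, AlgEquiv.mul_apply, ih, h1]
  have h3 := hτ.norm_eq y
  rw [hy] at h3
  have h4 := congrArg (algebraMap k⟮β⟯ M) h3
  rw [nm, map_prod] at h4
  rw [nm, IsScalarTower.algebraMap_apply k k⟮β⟯ M, h4]
  exact Finset.prod_congr rfl (fun i _ => (h2 i y).symm)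

open FFPrime in
lemma exists_res (G : GS p q k K M ζ σ β u) (v : FFPrime K) (hv : q ∣ deg k v) : ∃ r : K, v.Ge 1 (r ^ q - algebraMap k K u) := by
  obtain ⟨z, hz, hzp⟩ := G.exists_zeta
  haveI := kap_finite G.ff v
  have hQ : 0 < Nat.card k := Nat.card_pos
  have hd : q ∣ Nat.card k - 1 := by
    have h1 : IsPrimitiveRoot (hzp.isUnit G.cyc.hq.ne_zero).unit q := by
      rw [← IsPrimitiveRoot.coe_units_iff]; exact hzp
    have := orderOf_dvd_natCard (hzp.isUnit G.cyc.hq.ne_zero).unit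
    rwa [← h1.eq_orderOf, Nat.card_units] at this
  obtain ⟨t, ht⟩ := card_units_div hQ hd hv
  have hcard : Nat.card (kap k v)ˣ = q * ((Nat.card k - 1) * t) := by
    letI : Field (kap k v) := (Finite.isDomain_to_isField (kap k v)).toField
    rw [← ht, ← kap_card G.ff v]
    exact Nat.card_units _
  obtain ⟨r, hr⟩ := pow_crit hcard (Units.map (algebraMap k (kap k v)).toMonoidHom (Units.mk0 u G.u_ne)) (by
    rw [← map_pow, pow_mul, ← Nat.card_units, pow_card_eq_one', one_pow, map_one])
  obtain ⟨x, hx⟩ := rmk_surj k v r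
  refine ⟨x, ?_⟩
  have h1 := congrArg Units.val hr
  rw [Units.val_pow_eq_pow_val, ← hx, ← map_pow] at h1
  have h2 : rmk k v (x ^ q) = rmk k v (algebraMap k _ u) := by rw [h1, AlgHom.commutes]; rfl
  rw [rmk_eq] at h2
  exact h2

end GS

end

noncomputable section
set_option linter.all false
open Finset IntermediateField FFPrime

section sg
variable {K M : Type} [Field K] [Field M] [Algebra K M]

/-- galois action on places -/
def cmE (τ : M ≃ₐ[K] M) : FFPrime M ≃ FFPrime M where
  toFun W := W.cm τ
  invFun W := W.cm τ⁻¹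
  left_inv W := by
    show (W.cm τ).cm τ⁻¹ = W
    rw [← cm_mul, mul_inv_cancel, cm_one]
  right_inv W := by
    show (W.cm τ⁻¹).cm τ = W
    rw [← cm_mul, inv_mul_cancel, cm_one]

/-- galois action on divisors -/
def sg (τ : M ≃ₐ[K] M) : (FFPrime M →₀ ℤ) →+ (FFPrime M →₀ ℤ) := (Finsupp.domCongr (cmE τ).symm).toAddMonoidHom

@[simp] lemma sg_apply (τ : M ≃ₐ[K] M) (E : FFPrime M →₀ ℤ) (W : FFPrime M) : sg τ E W = E (W.cm τ) := by
  simp [sg, cmE]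

/-- trace on divisors -/
def tD (q : ℕ) (τ : M ≃ₐ[K] M) : (FFPrime M →₀ ℤ) →+ (FFPrime M →₀ ℤ) := ∑ i ∈ range q, sg (τ ^ i)

lemma tD_apply (q : ℕ) (τ : M ≃ₐ[K] M) (E : FFPrime M →₀ ℤ) (W : FFPrime M) : tD q τ E W = ∑ i ∈ range q, E (W.cm (τ ^ i)) := by
  simp [tD, AddMonoidHom.finset_sum_apply, Finsupp.finset_sum_apply]

lemma tD_shift {q : ℕ} {τ : M ≃ₐ[K] M} (h : τ ^ q = 1) (E : FFPrime M →₀ ℤ) (W : FFPrime M) :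
    ∑ i ∈ range q, E (W.cm (τ ^ (i + 1))) = ∑ i ∈ range q, E (W.cm (τ ^ i)) := by
  have h1 := Finset.sum_range_succ (fun i => E (W.cm (τ ^ i))) q
  have h2 := Finset.sum_range_succ' (fun i => E (W.cm (τ ^ i))) q
  rw [h1] at h2
  simp only [h, pow_zero] at h2
  linarith

lemma tD_sg {q : ℕ} {τ : M ≃ₐ[K] M} (h : τ ^ q = 1) (E : FFPrime M →₀ ℤ) : tD q τ (sg τ E) = tD q τ E := by
  ext W
  rw [tD_apply, tD_apply]
  refine Eq.trans ?_ (tD_shift h E W)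
  apply Finset.sum_congr rfl
  intro i _
  rw [sg_apply, ← cm_mul, pow_succ]

lemma sg_tD {q : ℕ} {τ : M ≃ₐ[K] M} (h : τ ^ q = 1) (E : FFPrime M →₀ ℤ) : sg τ (tD q τ E) = tD q τ E := by
  ext W
  rw [sg_apply, tD_apply, tD_apply]
  refine Eq.trans ?_ (tD_shift h E W)
  apply Finset.sum_congr rfl
  intro i _
  rw [← cm_mul, pow_succ']

variable {k : Type} [Field k] [Finite k] [Algebra k M]
lemma sg_dv (hM : FFd k M) (τ : M ≃ₐ[K] M) (x : M) : sg τ (dv x) = dv (τ x) := by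
  ext W
  rw [sg_apply, dv_apply hM, dv_apply hM, cm_z]

lemma tD_dv (hM : FFd k M) (q : ℕ) (τ : M ≃ₐ[K] M) {x : M} (hx : x ≠ 0) : tD q τ (dv x) = dv (nm q τ x) := by
  ext W
  rw [tD_apply, dv_apply hM, z_nm _ _ _ hx]
  apply Finset.sum_congr rfl
  intro i _
  rw [dv_apply hM, cm_z]
end sg

namespace GS
variable {p q : ℕ} {k K M : Type} [Field k] [Finite k] [Field K] [Field M] [Algebra k K] [Algebra k M] [Algebra K M] [IsScalarTower k K M]
  {ζ : K} {σ : M ≃ₐ[K] M} {β : M} {u : k} [Fact p.Prime] [CharP M p]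

lemma zb (G : GS p q k K M ζ σ β u) (W : FFPrime M) : W.z β = 0 := z_of_algebraic W G.beta_alg

lemma ex_dn (G : GS p q k K M ζ σ β u) (W : FFPrime M) : ∃ v : FFPrime K, Ov W v 1 := by
  haveI := G.cyc.finiteDim
  obtain ⟨v, e, h⟩ := exists_restrict (K := K) W
  have := G.cyc.unram p h (G.zb W)
  subst this
  exact ⟨v, h⟩

lemma ex_up (G : GS p q k K M ζ σ β u) (v : FFPrime K) : ∃ W : FFPrime M, Ov W v 1 := by
  haveI := G.cyc.finiteDim
  obtain ⟨W, e, h⟩ := exists_extend (L := M) v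
  have := G.cyc.unram p h (G.zb W)
  subst this
  exact ⟨W, h⟩

/-- place below -/
def dn (G : GS p q k K M ζ σ β u) (W : FFPrime M) : FFPrime K := (G.ex_dn W).choose
lemma dn_ov (G : GS p q k K M ζ σ β u) (W : FFPrime M) : Ov W (G.dn W) 1 := (G.ex_dn W).choose_spec
/-- place above -/
def up (G : GS p q k K M ζ σ β u) (v : FFPrime K) : FFPrime M := (G.ex_up v).choose
lemma up_ov (G : GS p q k K M ζ σ β u) (v : FFPrime K) : Ov (G.up v) v 1 := (G.ex_up v).choose_spec

lemma dn_eq (G : GS p q k K M ζ σ β u) {W : FFPrime M} {v : FFPrime K} {e : ℤ} (h : Ov W v e) : G.dn W = v := (G.dn_ov W).v_eq h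
lemma dn_up (G : GS p q k K M ζ σ β u) (v : FFPrime K) : G.dn (G.up v) = v := G.dn_eq (G.up_ov v)
lemma dn_cm (G : GS p q k K M ζ σ β u) (W : FFPrime M) (τ : M ≃ₐ[K] M) : G.dn (W.cm τ) = G.dn W := G.dn_eq ((G.dn_ov W).cm τ)

lemma con_fin (G : GS p q k K M ζ σ β u) (D : FFPrime K →₀ ℤ) : (Function.support fun W => D (G.dn W)).Finite := by
  classical
  apply Set.Finite.subset (D.support.biUnion (fun v => (range q).image (fun i => (G.up v).cm (σ ^ i)))).finite_toSet
  intro W hW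
  simp only [Function.mem_support] at hW
  simp only [Finset.coe_biUnion, Set.mem_iUnion]
  refine ⟨G.dn W, by simpa using hW, ?_⟩
  obtain ⟨s, hs, he⟩ := G.cyc.conj (G.up_ov (G.dn W)) (G.dn_ov W)
  rw [Finset.mem_coe, Finset.mem_image]
  exact ⟨s, by simpa using hs, he.symm⟩

/-- conorm -/
def con (G : GS p q k K M ζ σ β u) : (FFPrime K →₀ ℤ) →+ (FFPrime M →₀ ℤ) where
  toFun D := Finsupp.ofSupportFinite (fun W => D (G.dn W)) (G.con_fin D)
  map_zero' := by ext W; rfl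
  map_add' D D' := by ext W; rfl

lemma con_apply (G : GS p q k K M ζ σ β u) (D : FFPrime K →₀ ℤ) (W : FFPrime M) : G.con D W = D (G.dn W) := rfl

lemma con_dv (G : GS p q k K M ζ σ β u) (x : K) : G.con (dv x) = dv (algebraMap K M x) := by
  ext W
  rw [con_apply, dv_apply G.ff, dv_apply G.ffM, (G.dn_ov W).z, one_mul]

lemma sg_con (G : GS p q k K M ζ σ β u) (D : FFPrime K →₀ ℤ) (τ : M ≃ₐ[K] M) : sg τ (G.con D) = G.con D := by
  ext W
  rw [sg_apply, con_apply, con_apply, dn_cm]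

lemma tD_con (G : GS p q k K M ζ σ β u) (D : FFPrime K →₀ ℤ) : tD q σ (G.con D) = (q : ℤ) • G.con D := by
  ext W
  rw [tD_apply]
  simp [con_apply, dn_cm]

lemma ex_con (G : GS p q k K M ζ σ β u) {E : FFPrime M →₀ ℤ} (hE : sg σ E = E) : ∃ D, G.con D = E := by
  have hinj : Function.Injective G.up := fun v v' h => by rw [← G.dn_up v, h, G.dn_up]
  refine ⟨E.comapDomain G.up hinj.injOn, ?_⟩
  ext W
  rw [con_apply, Finsupp.comapDomain_apply]
  obtain ⟨s, hs, he⟩ := G.cyc.conj (G.dn_ov W) (G.up_ov (G.dn W)) 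
  rw [he]
  clear he hs
  induction s with
  | zero => simp [cm_one]
  | succ s ih =>
    rw [← ih]
    conv_rhs => rw [← hE]
    rw [sg_apply, ← cm_mul, pow_succ]

lemma con_split (G : GS p q k K M ζ σ β u) {v : FFPrime K} {W : FFPrime M} (hW : Ov W v 1) (hs : W.cm σ ≠ W) :
    ∃ E, tD q σ E = G.con (Finsupp.single v 1) := by
  classical
  refine ⟨Finsupp.single W 1, ?_⟩
  ext U
  rw [tD_apply, con_apply]
  simp only [Finsupp.single_apply]
  by_cases hU : v = G.dn U
  · rw [if_pos hU]
    have hU' := G.dn_ov U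
    rw [← hU] at hU'
    obtain ⟨s, hs', he⟩ := G.cyc.conj hU' hW
    rw [Finset.sum_eq_single s]
    · rw [if_pos he]
    · intro i hi his
      rw [if_neg]
      intro hWi
      -- both powers give W
      have hne : ∀ a b : ℕ, a < b → b < q → U.cm (σ ^ a) = W → U.cm (σ ^ b) = W → False := by
        intro a b hab hb h1 h2
        apply G.cyc.cm_pow_ne hs (i := b - a) (by omega) (by omega)
        conv_lhs => rw [← h1]
        rw [← cm_mul, ← pow_add, Nat.add_sub_cancel' hab.le, h2]
      rcases lt_or_gt_of_ne his with h | h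
      · exact hne i s h hs' hWi.symm he.symm
      · exact hne s i h (by simpa using hi) he.symm hWi.symm
    · intro h; simp at h; omega
  · rw [if_neg hU]
    apply Finset.sum_eq_zero
    intro i _
    rw [if_neg]
    intro h
    apply hU
    rw [← G.dn_cm U (σ ^ i), ← h, G.dn_eq hW]

theorem main (G : GS p q k K M ζ σ β u) {d : K} (hd : d ≠ 0)
    (hv : ∀ v : FFPrime K, ∀ W : FFPrime M, Ov W v 1 → W.cm σ = W → (q : ℤ) ∣ v.z d) :
    ∃ m : M, m ≠ 0 ∧ nm q σ m = algebraMap K M d := by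
  classical
  have hM := G.ffM
  have hσ := G.cyc.pow
  -- constants
  have hconst : ∀ c : K, c ≠ 0 → (∀ v : FFPrime K, v.z c = 0) → ∃ y : M, y ≠ 0 ∧ (∀ W : FFPrime M, W.z y = 0) ∧ nm q σ y = algebraMap K M c := by
    intro c hc hz
    obtain ⟨c', rfl⟩ := G.ex c (alg_of_dv G.ff hz)
    obtain ⟨y, hy, hyn⟩ := G.norm_const c'
    refine ⟨y, ?_, fun W => z_of_algebraic W hy, by rw [hyn]; exact IsScalarTower.algebraMap_apply k K M c'⟩
    rintro rfl
    rw [nm, Finset.prod_eq_zero (i := 0) (by simpa using G.cyc.hq.pos) (by simp), eq_comm, IsScalarTower.algebraMap_apply k K M] at hyn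
    exact hc (by simpa using hyn)
  -- norm subgroup
  let H : AddSubgroup (FFPrime K →₀ ℤ) := (tD q σ).range.comap G.con
  have hHq : ∀ v, Finsupp.single v (q : ℤ) ∈ H := fun v => by
    refine ⟨G.con (Finsupp.single v 1), ?_⟩
    rw [tD_con, ← map_zsmul, Finsupp.smul_single]; simp
  have hHs : ∀ v W, Ov W v 1 → W.cm σ ≠ W → Finsupp.single v 1 ∈ H := fun v W hW hs => G.con_split hW hs
  -- degree facts
  have hdegpos : ∀ E : FFPrime M →₀ ℤ, degD k (tD q σ E) = 0 → degD k E = 0 := by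
    intro E hE
    refine phi_zero' hM ((degD k).comp (tD q σ)) ?_ ?_ hE
    · intro x hx
      show degD k (tD q σ (dv x)) = 0
      rw [tD_dv hM _ _ hx, degD_dv hM]
    · intro W
      show degD k (tD q σ (Finsupp.single W 1)) ≠ 0
      have h0 : (0 : FFPrime M →₀ ℤ) ≤ tD q σ (Finsupp.single W 1) := by
        intro U
        rw [tD_apply]
        apply Finset.sum_nonneg
        intro i _
        rw [Finsupp.single_apply]; split_ifs <;> simp
      have h1 : 1 ≤ tD q σ (Finsupp.single W 1) W := by
        rw [tD_apply]
        have := Finset.single_le_sum (f := fun i => (Finsupp.single W (1 : ℤ)) (W.cm (σ ^ i))) (s := range q) (fun i _ => by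
          simp only [Finsupp.single_apply]; split_ifs <;> simp) (Finset.mem_range.2 G.cyc.hq.pos)
        simpa [cm_one] using this
      have h2 := le_degD hM h0 W
      have h3 : (1 : ℤ) ≤ deg k W := by exact_mod_cast deg_pos hM W
      nlinarith
  have hdegT : ∀ E : FFPrime M →₀ ℤ, degD k E = 0 → degD k (tD q σ E) = 0 := fun E hE =>
    phi_zero hM ((degD k).comp (tD q σ)) (fun x hx => by
      show degD k (tD q σ (dv x)) = 0
      rw [tD_dv hM _ _ hx, degD_dv hM]) hE
  have hdegS : ∀ E : FFPrime M →₀ ℤ, degD k E = 0 → degD k (sg σ E) = 0 := fun E hE =>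
    phi_zero hM ((degD k).comp (sg σ)) (fun x hx => by
      show degD k (sg σ (dv x)) = 0
      rw [sg_dv hM, degD_dv hM]) hE
  have hdegC : ∀ D : FFPrime K →₀ ℤ, degD k (G.con D) = 0 → degD k D = 0 := by
    intro D hD
    refine phi_zero' G.ff ((degD k).comp G.con) ?_ ?_ hD
    · intro x hx
      show degD k (G.con (dv x)) = 0
      rw [con_dv, degD_dv hM]
    · intro v
      show degD k (G.con (Finsupp.single v 1)) ≠ 0
      have h0 : (0 : FFPrime M →₀ ℤ) ≤ G.con (Finsupp.single v 1) := by
        intro U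
        rw [con_apply, Finsupp.single_apply]; split_ifs <;> simp
      have h1 : G.con (Finsupp.single v 1) (G.up v) = 1 := by rw [con_apply, dn_up]; simp
      have h2 := le_degD hM h0 (G.up v)
      have h3 : (1 : ℤ) ≤ deg k (G.up v) := by exact_mod_cast deg_pos hM (G.up v)
      rw [h1] at h2
      linarith
  have hdegC' : ∀ D : FFPrime K →₀ ℤ, degD k D = 0 → degD k (G.con D) = 0 := fun D hD =>
    phi_zero G.ff ((degD k).comp G.con) (fun x hx => by
      show degD k (G.con (dv x)) = 0
      rw [con_dv, degD_dv hM]) hD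
  -- principal subgroups
  let P : AddSubgroup (FFPrime M →₀ ℤ) :=
    { carrier := {E | ∃ x : M, x ≠ 0 ∧ E = dv x}
      zero_mem' := ⟨1, one_ne_zero, (dv_one hM).symm⟩
      add_mem' := by rintro _ _ ⟨x, hx, rfl⟩ ⟨y, hy, rfl⟩; exact ⟨x * y, mul_ne_zero hx hy, (dv_mul hM hx hy).symm⟩
      neg_mem' := by rintro _ ⟨x, hx, rfl⟩; exact ⟨x⁻¹, inv_ne_zero hx, (dv_inv hM x).symm⟩ }
  let R : AddSubgroup (FFPrime M →₀ ℤ) :=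
    { carrier := {E | ∃ x : K, x ≠ 0 ∧ E = G.con (dv x)}
      zero_mem' := ⟨1, one_ne_zero, by rw [dv_one G.ff, map_zero]⟩
      add_mem' := by rintro _ _ ⟨x, hx, rfl⟩ ⟨y, hy, rfl⟩; exact ⟨x * y, mul_ne_zero hx hy, by rw [dv_mul G.ff hx hy, map_add]⟩
      neg_mem' := by rintro _ ⟨x, hx, rfl⟩; exact ⟨x⁻¹, inv_ne_zero hx, by rw [dv_inv G.ff x, map_neg]⟩ }
  let D0 : AddSubgroup (FFPrime M →₀ ℤ) := (degD k).ker
  let I : AddSubgroup (FFPrime M →₀ ℤ) := ((degD k).ker : AddSubgroup (FFPrime K →₀ ℤ)).map G.con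
  obtain ⟨F1, hF1, hF1'⟩ := pic_fin (K := M) hM
  obtain ⟨F2, hF2, hF2'⟩ := pic_fin (K := K) G.ff
  have hnmK : ∀ x : M, x ≠ 0 → ∃ y : K, y ≠ 0 ∧ algebraMap K M y = nm q σ x := by
    intro x hx
    obtain ⟨y, hy⟩ := G.cyc.exists_nm x
    refine ⟨y, ?_, hy⟩
    rintro rfl
    rw [map_zero] at hy
    exact Cyc.nm_ne q σ hx hy.symm
  -- d is a norm of a divisor
  have hdH : dv d ∈ H := by
    have : dv d = ∑ v ∈ (dv d).support, Finsupp.single v (dv d v) := (Finsupp.sum_single (dv d)).symm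
    rw [this]
    apply AddSubgroup.sum_mem
    intro v _
    by_cases hs : (G.up v).cm σ = G.up v
    · obtain ⟨n, hn⟩ := hv v _ (G.up_ov v) hs
      rw [dv_apply G.ff, hn]
      have := H.zsmul_mem (hHq v) n
      rw [Finsupp.smul_single] at this
      simpa [mul_comm] using this
    · have := H.zsmul_mem (hHs v _ (G.up_ov v) hs) (dv d v)
      rw [Finsupp.smul_single] at this
      simpa using this
  obtain ⟨E, hE⟩ := hdH
  have hE0 : degD k E = 0 := hdegpos E (by rw [hE, con_dv, degD_dv hM])
  obtain ⟨F, hF, hFP⟩ := abs_group (sg σ) (tD q σ) D0 P I R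
    (by rintro _ ⟨D, hD, rfl⟩; exact hdegC' D hD) (fun x hx => hdegS x hx)
    (by rintro _ ⟨x, hx, rfl⟩; exact ⟨σ x, (map_ne_zero_iff _ σ.injective).2 hx, sg_dv hM σ x⟩)
    (by
      intro x hx
      obtain ⟨D, hD⟩ := G.ex_con (sg_tD hσ x)
      exact ⟨D, hdegC D (by rw [hD]; exact hdegT x hx), hD⟩)
    (by
      rintro _ ⟨x, hx, rfl⟩
      obtain ⟨y, hy, hyx⟩ := hnmK x hx
      exact ⟨y, hy, by rw [tD_dv hM _ _ hx, con_dv, hyx]⟩)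
    (tD_sg hσ) F1 (Set.image G.con F2) hF1 (hF2.image _)
    (by
      intro x hx
      obtain ⟨f, hf, y, hy, he⟩ := hF1' x hx
      exact ⟨f, hf, y, hy, he⟩)
    (by
      rintro _ ⟨D, hD, rfl⟩
      obtain ⟨f, hf, y, hy, he⟩ := hF2' D hD
      exact ⟨G.con f, ⟨f, hf, rfl⟩, y, hy, by rw [← map_sub, he]⟩)
    (by
      rintro _ ⟨x, hx, rfl⟩
      exact ⟨algebraMap K M x, by simpa using hx, G.con_dv x⟩)
    (by
      rintro _ ⟨D, hD, rfl⟩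
      have hprin : ∀ x : K, x ≠ 0 → dv x ∈ H ⊔ AddSubgroup.comap G.con R := fun x hx =>
        AddSubgroup.mem_sup_right ⟨x, hx, rfl⟩
      have := G1 G.ff G.cyc.hq (H ⊔ AddSubgroup.comap G.con R) hprin
        (fun v hv => by
          apply AddSubgroup.mem_sup_left
          obtain ⟨r, hr⟩ := G.exists_res v hv
          refine hHs v _ (G.up_ov v) ?_
          exact G.cyc.cm_ne_of_residue p (G.up_ov v) (G.zb _) (by rw [G.hu]; exact (IsScalarTower.algebraMap_apply k K M u).symm) hr)
        (fun v => AddSubgroup.mem_sup_left (hHq v)) D hD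
      obtain ⟨D1, ⟨E1, hE1⟩, D2, ⟨x, hx, hxe⟩, rfl⟩ := AddSubgroup.mem_sup.1 this
      have he : G.con (D1 + D2) - tD q σ E1 = G.con (dv x) := by
        rw [map_add, hE1, hxe]; abel
      refine ⟨E1, hdegpos E1 ?_, x, hx, he⟩
      have h3 : tD q σ E1 = G.con (D1 + D2) - G.con (dv x) := by rw [← he]; abel
      rw [h3, map_sub, hdegC' _ hD, hdegC' _ (degD_dv G.ff x), sub_zero])
    (by
      rintro E1 hE1 ⟨f, hf, hfe⟩
      obtain ⟨y, hy, hyf⟩ := hnmK f hf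
      have hdvy : ∀ v : FFPrime K, v.z y = 0 := by
        intro v
        have h1 : dv (nm q σ f) = (0 : FFPrime M →₀ ℤ) := by
          rw [← tD_dv hM _ _ hf, ← hfe, map_sub, tD_sg hσ, sub_self]
        have h2 := DFunLike.congr_fun h1 (G.up v)
        rw [dv_apply hM, ← hyf, (G.up_ov v).z] at h2
        simpa using h2
      obtain ⟨κ, hκ, hκz, hκn⟩ := hconst y hy hdvy
      have hn1 : nm q σ (f / κ) = 1 := by
        rw [Cyc.nm_div, hκn, hyf, div_self (Cyc.nm_ne q σ hf)]
      have hσ1 : σ ≠ 1 := by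
        intro h1
        have := G.cyc.act
        rw [h1] at this
        have h6 : algebraMap K M ζ = 1 := by
          have := mul_right_cancel₀ G.cyc.ne ((one_mul β).trans this); exact this.symm
        exact G.cyc.primN.ne_one G.cyc.hq.one_lt h6
      obtain ⟨g, hg, hge⟩ := hilbert90 G.cyc.hq σ hσ hσ1 hn1
      have hsg0 : σ g ≠ 0 := (map_ne_zero_iff _ σ.injective).2 hg
      have hdf : dv f = sg σ (dv g) - dv g := by
        rw [div_eq_iff hκ] at hge
        ext W
        rw [Finsupp.sub_apply, sg_dv hM, dv_apply hM, dv_apply hM, dv_apply hM, hge, z_mul _ (div_ne_zero hsg0 hg) hκ, hκz, z_div _ hsg0 hg]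
        ring
      have hinv : sg σ (E1 - dv g) = E1 - dv g := by
        rw [map_sub]
        have : sg σ E1 = E1 + (sg σ (dv g) - dv g) := by rw [← hdf, ← hfe]; abel
        rw [this]; abel
      obtain ⟨D, hD⟩ := G.ex_con hinv
      refine ⟨E1 - dv g, ⟨D, hdegC D ?_, hD⟩, g, hg, by abel⟩
      rw [hD, map_sub, degD_dv hM]
      have : degD k E1 = 0 := hE1
      rw [this, sub_zero])
    (x := E) hE0 ⟨d, hd, hE⟩
  obtain ⟨g, hg, hge⟩ := hFP
  have hEe : E = (sg σ F - F) + dv g := by rw [← hge]; abel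
  have h1 : G.con (dv d) = dv (nm q σ g) := by
    rw [← hE, hEe, map_add, map_sub, tD_sg hσ, sub_self, zero_add, tD_dv hM _ _ hg]
  obtain ⟨y, hy, hyg⟩ := hnmK g hg
  have hz : ∀ v : FFPrime K, v.z (d / y) = 0 := by
    intro v
    have h2 := DFunLike.congr_fun h1 (G.up v)
    rw [con_dv, dv_apply hM, dv_apply hM, ← hyg, (G.up_ov v).z, (G.up_ov v).z] at h2
    rw [z_div _ hd hy]
    linarith
  obtain ⟨κ, hκ, -, hκn⟩ := hconst (d / y) (div_ne_zero hd hy) hz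
  refine ⟨g * κ, mul_ne_zero hg hκ, ?_⟩
  rw [Cyc.nm_mul, hκn, ← hyg, ← map_mul, mul_div_cancel₀ _ hy]

end GS

end

noncomputable section
set_option linter.all false
open Finset IntermediateField FFPrime

/-- matrix of multiplication by `∑ y_i α^i`, `α^q = a` -/
def nsM {E : Type} [CommRing E] (q : ℕ) (a : E) (y : ℕ → E) : Matrix (Fin q) (Fin q) E :=
  fun l m => if l.1 ≤ m.1 then y (m.1 - l.1) else a * y (m.1 + q - l.1)

/-- norm equation solvable -/
def NS (q : ℕ) (E : Type) [Field E] (a c : E) : Prop := ∃ y : ℕ → E, (nsM q a y).det = c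

lemma nsM_map {E F : Type} [CommRing E] [CommRing F] (φ : E →+* F) (q : ℕ) (a : E) (y : ℕ → E) :
    φ (nsM q a y).det = (nsM q (φ a) (fun i => φ (y i))).det := by
  rw [RingHom.map_det]
  congr 1
  ext l m
  simp only [nsM, RingHom.mapMatrix_apply, Matrix.map_apply]
  split_ifs <;> simp

lemma nsM_mulVec {E : Type} [CommRing E] (q : ℕ) (a θ : E) (hθ : θ ^ q = a) (y : ℕ → E) (l : Fin q) :
    ∑ m : Fin q, nsM q a y l m * θ ^ m.1 = (∑ i ∈ range q, y i * θ ^ i) * θ ^ l.1 := by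
  have h1 : ∑ m : Fin q, nsM q a y l m * θ ^ m.1
      = ∑ m ∈ range q, (if l.1 ≤ m then y (m - l.1) else a * y (m + q - l.1)) * θ ^ m := by
    rw [Finset.sum_range]; rfl
  rw [h1, Finset.sum_mul]
  have hl := l.2
  symm
  apply Finset.sum_bij (fun i _ => if l.1 + i < q then l.1 + i else l.1 + i - q)
  · intro i hi
    simp only [mem_range] at hi ⊢
    split_ifs <;> omega
  · intro i hi j hj
    simp only [mem_range] at hi hj
    split_ifs <;> omega
  · intro m hm
    simp only [mem_range] at hm
    by_cases h : l.1 ≤ m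
    · refine ⟨m - l.1, by simp; omega, ?_⟩
      rw [if_pos (by omega)]; omega
    · refine ⟨m + q - l.1, by simp; omega, ?_⟩
      rw [if_neg (by omega)]; omega
  · intro i hi
    simp only [mem_range] at hi
    by_cases h : l.1 + i < q
    · rw [if_pos h, if_pos (by omega), show l.1 + i - l.1 = i by omega]; ring
    · rw [if_neg h, if_neg (by omega), show l.1 + i - q + q - l.1 = i by omega]
      have : θ ^ i * θ ^ l.1 = a * θ ^ (l.1 + i - q) := by
        rw [← hθ, ← pow_add, ← pow_add]; congr 1; omega
      rw [mul_assoc, this]; ring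

lemma nsM_det {E : Type} [Field E] {q : ℕ} {ζ : E} (hζ : IsPrimitiveRoot ζ q) {a θ : E} (hθ : θ ^ q = a) (h0 : θ ≠ 0)
    (y : ℕ → E) : (nsM q a y).det = ∏ j ∈ range q, ∑ i ∈ range q, y i * (ζ ^ j * θ) ^ i := by
  rw [Finset.prod_range]
  set V : Matrix (Fin q) (Fin q) E := (Matrix.vandermonde fun j : Fin q => ζ ^ j.1 * θ).transpose with hV
  have hV0 : V.det ≠ 0 := by
    rw [hV, Matrix.det_transpose, Matrix.det_vandermonde_ne_zero_iff]
    intro i j hij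
    simp only at hij
    have := mul_right_cancel₀ h0 hij
    exact Fin.ext (hζ.pow_inj i.2 j.2 this)
  have key : nsM q a y * V = V * Matrix.diagonal (fun j : Fin q => ∑ i ∈ range q, y i * (ζ ^ j.1 * θ) ^ i) := by
    ext l j
    rw [Matrix.mul_diagonal, Matrix.mul_apply]
    have : (ζ ^ j.1 * θ) ^ q = a := by rw [mul_pow, ← pow_mul, mul_comm, mul_comm j.1, pow_mul, hζ.pow_eq_one, one_pow, mul_one, hθ]
    have := nsM_mulVec q a _ this y l
    simp only [hV, Matrix.transpose_apply, Matrix.vandermonde_apply]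
    rw [this, mul_comm]
  have := congrArg Matrix.det key
  rw [Matrix.det_mul, Matrix.det_mul, Matrix.det_diagonal, mul_comm] at this
  exact mul_left_cancel₀ hV0 this

namespace Cyc
variable {q : ℕ} {K N : Type} [Field K] [Field N] [Algebra K N] {ζ : K} {τ : N ≃ₐ[K] N} {α : N}

lemma nm_ns (h : Cyc q K N ζ τ α) {a : K} (ha : algebraMap K N a = α ^ q) (y : ℕ → K) :
    algebraMap K N (nsM q a y).det = nm q τ (∑ j ∈ range q, algebraMap K N (y j) * α ^ j) := by
  rw [nsM_map, nsM_det h.primN ha.symm h.ne, nm]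
  apply Finset.prod_congr rfl
  intro i _
  rw [map_sum]
  apply Finset.sum_congr rfl
  intro j _
  rw [map_mul, AlgEquiv.commutes, map_pow, h.act_pow]

lemma ns_iff (h : Cyc q K N ζ τ α) {a c : K} (ha : algebraMap K N a = α ^ q) :
    NS q K a c ↔ ∃ Y : N, nm q τ Y = algebraMap K N c := by
  constructor
  · rintro ⟨y, rfl⟩
    exact ⟨_, (h.nm_ns ha y).symm⟩
  · rintro ⟨Y, hY⟩
    refine ⟨h.coef Y, ?_⟩
    apply (algebraMap K N).injective
    rw [h.nm_ns ha, ← h.expand, hY]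
end Cyc

end

noncomputable section
set_option linter.all false
open Finset IntermediateField FFPrime

/-- biquadratic-type tower -/
structure TW (q : ℕ) (K M N : Type) [Field K] [Field M] [Field N] [Algebra K M] [Algebra M N] [Algebra K N]
    [IsScalarTower K M N] (ζ : K) (s0 : M ≃ₐ[K] M) (β : M) (τ : N ≃ₐ[M] N) (α : N) (σ : N ≃ₐ[K] N) (a : K) : Prop where
  h1 : Cyc q K M ζ s0 β
  h2 : Cyc q M N (algebraMap K M ζ) τ α
  hs : ∀ m, σ (algebraMap M N m) = algebraMap M N (s0 m)
  ha : σ α = α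
  hα : algebraMap K N a = α ^ q

/-- local condition -/
def Loc (q : ℕ) {K : Type} [Field K] (v : FFPrime K) (a c : K) : Prop :=
  (∃ g, v.Ge 1 (a * g ^ q - 1)) ∨ (∃ g, v.Ge 1 (c * g ^ q - 1)) ∨ ((q : ℤ) ∣ v.z a ∧ (q : ℤ) ∣ v.z c)

lemma dvd_z_of_ge {K : Type} [Field K] {q : ℕ} {v : FFPrime K} {a g : K} (hq : q ≠ 0) (h : v.Ge 1 (a * g ^ q - 1)) : (q : ℤ) ∣ v.z a := by
  obtain ⟨h1, h2⟩ := z_unit_of_sub_one _ h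
  have ha : a ≠ 0 := left_ne_zero_of_mul h1
  have hg : g ≠ 0 := by rintro rfl; simp [hq] at h1
  rw [z_mul _ ha (pow_ne_zero _ hg), z_pow] at h2
  exact ⟨-v.z g, by linarith⟩

namespace TW
variable {p q : ℕ} {K M N : Type} [Field K] [Field M] [Field N] [Algebra K M] [Algebra M N] [Algebra K N]
    [IsScalarTower K M N] {ζ : K} {s0 : M ≃ₐ[K] M} {β : M} {τ : N ≃ₐ[M] N} {α : N} {σ : N ≃ₐ[K] N} {a : K}

lemma sig (T : TW q K M N ζ s0 β τ α σ a) (x : N) : σ x = ∑ j ∈ range q, algebraMap M N (s0 (T.h2.coef x j)) * α ^ j := by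
  conv_lhs => rw [T.h2.expand x]
  rw [map_sum]
  apply Finset.sum_congr rfl
  intro j _
  rw [map_mul, T.hs, map_pow, T.ha]

lemma hs_pow (T : TW q K M N ζ s0 β τ α σ a) (i : ℕ) (m : M) : (σ ^ i) (algebraMap M N m) = algebraMap M N ((s0 ^ i) m) := by
  induction i with
  | zero => rfl
  | succ i ih => rw [pow_succ', pow_succ', AlgEquiv.mul_apply, ih, T.hs]; rfl

lemma ha_pow (T : TW q K M N ζ s0 β τ α σ a) (i : ℕ) : (σ ^ i) α = α := by
  induction i with
  | zero => rfl
  | succ i ih => rw [pow_succ', AlgEquiv.mul_apply, ih, T.ha]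

lemma pow (T : TW q K M N ζ s0 β τ α σ a) : σ ^ q = 1 := by
  ext x
  rw [T.h2.expand x, map_sum, map_sum]
  apply Finset.sum_congr rfl
  intro j _
  rw [map_mul, T.hs_pow, map_pow, T.ha_pow, T.h1.pow]; rfl

lemma comm (T : TW q K M N ζ s0 β τ α σ a) (x : N) : σ (τ x) = τ (σ x) := by
  rw [T.h2.expand x]
  simp only [map_sum, map_mul, map_pow, T.hs, T.ha, T.h2.act, AlgEquiv.commutes]

lemma comm_pow (T : TW q K M N ζ s0 β τ α σ a) (i : ℕ) (x : N) : σ ((τ ^ i) x) = (τ ^ i) (σ x) := by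
  induction i with
  | zero => rfl
  | succ i ih => rw [pow_succ', AlgEquiv.mul_apply, AlgEquiv.mul_apply, T.comm, ih]

lemma comm_pow' (T : TW q K M N ζ s0 β τ α σ a) (i : ℕ) (x : N) : (σ ^ i) (τ x) = τ ((σ ^ i) x) := by
  induction i with
  | zero => rfl
  | succ i ih => rw [pow_succ', AlgEquiv.mul_apply, AlgEquiv.mul_apply, ih, T.comm]

lemma ne_one (T : TW q K M N ζ s0 β τ α σ a) : σ ≠ 1 := by
  rintro rfl
  have h := T.hs β
  rw [T.h1.act] at h
  have h2 := (algebraMap M N).injective h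
  simp only [AlgEquiv.one_apply] at h
  have h3 := (algebraMap M N).injective h
  have : algebraMap K M ζ = 1 := by
    have : (algebraMap K M ζ - 1) * β = 0 := by linear_combination -h3
    rcases mul_eq_zero.1 this with h | h
    · linear_combination h
    · exact absurd h T.h1.ne
  have h4 := T.h1.prim.ne_one T.h1.hq.one_lt
  exact h4 ((algebraMap K M).injective (by rw [this, map_one]))

lemma tne_one (h : Cyc q K M ζ s0 β) : s0 ≠ 1 := by
  rintro rfl
  have h3 := h.act
  simp only [AlgEquiv.one_apply] at h3
  have : algebraMap K M ζ = 1 := by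
    have : (algebraMap K M ζ - 1) * β = 0 := by linear_combination -h3
    rcases mul_eq_zero.1 this with h' | h'
    · linear_combination h'
    · exact absurd h' h.ne
  have h4 := h.prim.ne_one h.hq.one_lt
  exact h4 ((algebraMap K M).injective (by rw [this, map_one]))

lemma fixed (T : TW q K M N ζ s0 β τ α σ a) {x : N} (hx : σ x = x) : ∃ y : ℕ → K, x = ∑ j ∈ range q, algebraMap K N (y j) * α ^ j := by
  have h1 : ∀ j, ∃ y : K, j < q → algebraMap K M y = T.h2.coef x j := by
    intro j
    by_cases hj : j < q
    · have := T.sig x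
      rw [hx] at this
      have h3 := T.h2.coef_unique (fun j => s0 (T.h2.coef x j)) hj
      rw [← this] at h3
      obtain ⟨y, hy⟩ := T.h1.fix _ h3.symm
      exact ⟨y, fun _ => hy⟩
    · exact ⟨0, fun h => absurd h hj⟩
  choose y hy using h1
  refine ⟨y, ?_⟩
  conv_lhs => rw [T.h2.expand x]
  apply Finset.sum_congr rfl
  intro j hj
  rw [← hy j (by simpa using hj), ← IsScalarTower.algebraMap_apply]

lemma tau_nm (T : TW q K M N ζ s0 β τ α σ a) (x : N) : τ (nm q σ x) = nm q σ (τ x) := by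
  rw [nm, nm, map_prod]
  exact Finset.prod_congr rfl fun i _ => (T.comm_pow' i x).symm

lemma sig_nm (T : TW q K M N ζ s0 β τ α σ a) (x : N) : σ (nm q τ x) = nm q τ (σ x) := by
  rw [nm, nm, map_prod]
  exact Finset.prod_congr rfl fun i _ => T.comm_pow i x

lemma nm_map (T : TW q K M N ζ s0 β τ α σ a) (m : M) : nm q σ (algebraMap M N m) = algebraMap M N (nm q s0 m) := by
  rw [nm, nm, map_prod]
  exact Finset.prod_congr rfl fun i _ => T.hs_pow i m

lemma tau_nm_self {ξ : M} (h : Cyc q M N ξ τ α) (x : N) : τ (nm q τ x) = nm q τ x := by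
  obtain ⟨y, hy⟩ := h.exists_nm x
  rw [← hy, AlgEquiv.commutes]

lemma sig_nm_self (T : TW q K M N ζ s0 β τ α σ a) (x : N) : σ (nm q σ x) = nm q σ x := by
  rw [nm, map_prod]
  have h1 := Finset.prod_range_succ (fun i => (σ ^ i) x) q
  have h2 := Finset.prod_range_succ' (fun i => (σ ^ i) x) q
  rw [h1, T.pow, pow_zero] at h2
  by_cases hx : x = 0
  · subst hx; simp
  have := mul_right_cancel₀ (by simpa using hx) h2
  rw [this]
  exact Finset.prod_congr rfl fun i _ => by rw [pow_succ']; rfl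

/-- the descent, given the local statement -/
lemma descend (T : TW q K M N ζ s0 β τ α σ a) {c : K} (hc : c ≠ 0) {Y : N} (hY : nm q τ Y = algebraMap K N c)
    (H : ∀ z : N, z ≠ 0 → σ Y / Y = τ z / z → ∀ d : K, d ≠ 0 → algebraMap K N d = nm q σ z → ∃ m, m ≠ 0 ∧ nm q s0 m = algebraMap K M d) :
    NS q K a c := by
  have hq := T.h1.hq
  have hcN : algebraMap K N c ≠ 0 := by simpa using hc
  have hY0 : Y ≠ 0 := by
    rintro rfl
    apply hcN
    rw [← hY, nm]
    exact Finset.prod_eq_zero (i := 0) (by simpa using hq.pos) (by simp)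
  have e1 : nm q τ (σ Y / Y) = 1 := by
    rw [Cyc.nm_div, ← T.sig_nm, hY, AlgEquiv.commutes, div_self hcN]
  obtain ⟨z, hz, hzz⟩ := hilbert90 hq τ T.h2.pow (tne_one T.h2) e1
  have hn0 := Cyc.nm_ne q σ hz
  have e2 : τ (nm q σ z) = nm q σ z := by
    rw [T.tau_nm]
    have : nm q σ (τ z / z) = 1 := by
      rw [← hzz, Cyc.nm_div]
      have : nm q σ (σ Y) = nm q σ Y := by
        rw [← T.sig_nm_self Y, nm, nm, map_prod]
        refine Finset.prod_congr rfl fun i _ => ?_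
        rw [← AlgEquiv.mul_apply, ← AlgEquiv.mul_apply, ← pow_succ, ← pow_succ']
      rw [this, div_self (Cyc.nm_ne q σ hY0)]
    rw [Cyc.nm_div] at this
    exact (div_eq_one_iff_eq hn0).1 this
  obtain ⟨d1, hd1⟩ := T.h2.fix _ e2
  have e3 := T.sig_nm_self z
  rw [← hd1, T.hs] at e3
  obtain ⟨d, hd⟩ := T.h1.fix _ ((algebraMap M N).injective e3)
  have hdd : algebraMap K N d = nm q σ z := by rw [IsScalarTower.algebraMap_apply K M N, hd, hd1]
  have hd0 : d ≠ 0 := by rintro rfl; rw [map_zero] at hdd; exact hn0 hdd.symm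
  obtain ⟨m, hm, hmm⟩ := H z hz hzz d hd0 hdd
  have hm' : algebraMap M N m ≠ 0 := by simpa using hm
  have e4 : nm q σ (z / algebraMap M N m) = 1 := by
    rw [Cyc.nm_div, T.nm_map, hmm, ← IsScalarTower.algebraMap_apply, hdd, div_self hn0]
  obtain ⟨w, hw, hww⟩ := hilbert90 hq σ T.pow T.ne_one e4
  have hσY : σ Y = τ z / z * Y := by rw [← hzz]; field_simp
  have hσw : σ w = z / algebraMap M N m * w := by rw [hww]; field_simp
  have hτw : τ w ≠ 0 := by simpa using hw
  have hτz : τ z ≠ 0 := by simpa using hz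
  have e5 : σ (Y * (w / τ w)) = Y * (w / τ w) := by
    rw [map_mul, map_div₀, T.comm, hσY, hσw, map_mul, map_div₀, AlgEquiv.commutes]
    field_simp
  have e6 : nm q τ (Y * (w / τ w)) = algebraMap K N c := by
    have : nm q τ (τ w) = nm q τ w := by
      conv_rhs => rw [← tau_nm_self T.h2 w]
      rw [nm, nm, map_prod]
      refine Finset.prod_congr rfl fun i _ => ?_
      rw [← AlgEquiv.mul_apply, ← AlgEquiv.mul_apply, ← pow_succ, ← pow_succ']
    rw [Cyc.nm_mul, Cyc.nm_div, this, div_self (Cyc.nm_ne q τ hw), mul_one, hY]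
  obtain ⟨y, hy⟩ := T.fixed e5
  refine ⟨y, ?_⟩
  apply (algebraMap K N).injective
  rw [← e6, hy, IsScalarTower.algebraMap_apply K M N, nsM_map]
  have hα : algebraMap M N (algebraMap K M a) = α ^ q := by rw [← IsScalarTower.algebraMap_apply, T.hα]
  rw [T.h2.nm_ns hα]
  simp only [← IsScalarTower.algebraMap_apply]
end TW

end

noncomputable section
set_option linter.all false
open Finset IntermediateField FFPrime

namespace TW
variable {p q : ℕ} {K M N : Type} [Field K] [Field M] [Field N] [Algebra K M] [Algebra M N] [Algebra K N]
    [IsScalarTower K M N] {ζ : K} {s0 : M ≃ₐ[K] M} {β : M} {τ : N ≃ₐ[M] N} {α : N} {σ : N ≃ₐ[K] N} {a : K}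

lemma ov_sig (T : TW q K M N ζ s0 β τ α σ a) {X : FFPrime N} {W : FFPrime M} {e : ℤ} (hX : Ov X W e) (hW : W.cm s0 = W) :
    Ov (X.cm σ) W e := by
  refine ⟨hX.1, fun m => ?_⟩
  rw [cm_z, T.hs, hX.z]
  conv_rhs => rw [← hW, cm_z]

lemma sum_mul_mod {q s : ℕ} (hq : q.Prime) (hs0 : s ≠ 0) (hs : s < q) (f : ℕ → ℤ) (hf : ∀ n, f (n % q) = f n) :
    ∑ i ∈ range q, f (s * i) = ∑ i ∈ range q, f i := by
  have hco : Nat.Coprime s q := by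
    rw [Nat.coprime_comm, hq.coprime_iff_not_dvd]
    exact fun h => absurd (Nat.le_of_dvd (Nat.pos_of_ne_zero hs0) h) (by omega)
  rw [Finset.sum_congr rfl fun i _ => (hf (s * i)).symm]
  rw [← Finset.sum_image (f := f) (g := fun i => (s * i) % q) (s := range q)]
  · congr 1
    apply Finset.eq_of_subset_of_card_le
    · intro x hx
      simp only [Finset.mem_image, mem_range] at hx ⊢
      obtain ⟨i, _, rfl⟩ := hx
      exact Nat.mod_lt _ hq.pos
    · rw [Finset.card_image_of_injOn]
      intro i hi j hj hij
      simp only [Finset.coe_range, Set.mem_Iio] at hi hj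
      have h1 : i ≡ j [MOD q] := Nat.ModEq.cancel_left_of_coprime (by rw [Nat.coprime_comm] at hco; exact hco) hij
      exact Nat.ModEq.eq_of_lt_of_lt h1 hi hj
  · intro i hi j hj hij
    simp only [Finset.coe_range, Set.mem_Iio] at hi hj
    have h1 : i ≡ j [MOD q] := Nat.ModEq.cancel_left_of_coprime (by rw [Nat.coprime_comm] at hco; exact hco) hij
    exact Nat.ModEq.eq_of_lt_of_lt h1 hi hj

/-- unramified case -/
lemma locA (p : ℕ) [Fact p.Prime] [CharP N p] (T : TW q K M N ζ s0 β τ α σ a) {c : K} (hc : c ≠ 0) {Y : N} (hY0 : Y ≠ 0) (hY : nm q τ Y = algebraMap K N c)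
    {z : N} (hz : z ≠ 0) (hzz : σ Y / Y = τ z / z) {d : K} (hd : algebraMap K N d = nm q σ z)
    {v : FFPrime K} {W : FFPrime M} (hWv : Ov W v 1) (hW : W.cm s0 = W) (ha0 : a ≠ 0) (hloc : Loc q v a c)
    (hda : (q : ℤ) ∣ v.z a) : (q : ℤ) ∣ v.z d := by
  haveI := T.h2.finiteDim
  have hq := T.h1.hq
  obtain ⟨X, e, hX⟩ := exists_extend (L := N) W
  -- scale
  obtain ⟨n, hn⟩ := hda
  obtain ⟨g, hg0, hg⟩ := v.exists_z (-n)
  have hgM : algebraMap K M g ≠ 0 := by simpa using hg0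
  have hgN : algebraMap K N g ≠ 0 := by simpa using hg0
  have C := T.h2.twist (Nat.coprime_one_left q) hgM
  rw [pow_one, pow_one] at C
  rw [← IsScalarTower.algebraMap_apply] at C
  have hXv : Ov X v (e * 1) := hX.trans hWv
  have hαz : X.z (α * algebraMap K N g) = 0 := by
    have h1 : X.z ((α * algebraMap K N g) ^ q) = 0 := by
      rw [mul_pow, ← T.hα, ← map_pow, ← map_mul, hXv.z, z_mul _ ha0 (pow_ne_zero _ hg0), z_pow, hn, hg]; ring
    rw [z_pow] at h1
    rcases mul_eq_zero.1 h1 with h | h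
    · exact absurd (by exact_mod_cast h) hq.ne_zero
    · exact h
  have he : e = 1 := C.unram p hX hαz
  subst he
  obtain ⟨s, hsq, hs⟩ := T.h2.conj hX (T.ov_sig hX hW)
  have hs' : ∀ x, X.z (σ x) = X.z ((τ ^ s) x) := by
    intro x; rw [← cm_z, hs, cm_z]
  have hsi : ∀ i x, X.z ((σ ^ i) x) = X.z ((τ ^ (s * i)) x) := by
    intro i
    induction i with
    | zero => intro x; rfl
    | succ i ih =>
      intro x
      rw [pow_succ, AlgEquiv.mul_apply, ih, ← T.comm_pow, hs', ← AlgEquiv.mul_apply, ← pow_add]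
      congr 3; ring
  have hvd : v.z d = ∑ i ∈ range q, X.z ((τ ^ (s * i)) z) := by
    have := hXv.z d
    rw [hd, z_nm _ _ _ hz] at this
    rw [Finset.sum_congr rfl fun i _ => (hsi i z).symm, this]; ring
  by_cases hs0 : s = 0
  · subst hs0
    rw [hvd]; simp
  have hmod : ∀ n, X.z ((τ ^ (n % q)) z) = X.z ((τ ^ n) z) := fun n => by rw [T.h2.pow_mod]
  rw [hvd, sum_mul_mod hq hs0 hsq (fun i => X.z ((τ ^ i) z)) hmod, ← z_nm _ _ _ hz]
  -- r
  set r : N := ∏ j ∈ range s, (τ ^ j) Y with hr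
  have hr0 : r ≠ 0 := Finset.prod_ne_zero_iff.2 fun j _ => (map_ne_zero _).2 hY0
  have hτr : τ r * Y = (τ ^ s) Y * r := by
    have h1 := Finset.prod_range_succ (fun i => (τ ^ i) Y) s
    have h2 := Finset.prod_range_succ' (fun i => (τ ^ i) Y) s
    rw [h1, pow_zero] at h2
    rw [hr, map_prod, mul_comm ((τ ^ s) Y), h2]
    congr 1
    exact Finset.prod_congr rfl fun i _ => by rw [pow_succ']; rfl
  have hnr : nm q τ r = algebraMap K N c ^ s := by
    have : ∀ j, nm q τ ((τ ^ j) Y) = algebraMap K N c := by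
      intro j
      induction j with
      | zero => exact hY
      | succ j ih =>
        rw [← ih]
        conv_rhs => rw [← tau_nm_self T.h2]
        rw [nm, nm, map_prod]
        refine Finset.prod_congr rfl fun i _ => ?_
        rw [← AlgEquiv.mul_apply, ← AlgEquiv.mul_apply, ← AlgEquiv.mul_apply, ← pow_add, ← pow_succ', ← pow_add]
        congr 2; omega
    have h3 : ∀ n, nm q τ (∏ j ∈ range n, (τ ^ j) Y) = algebraMap K N c ^ n := by
      intro n
      induction n with
      | zero => simp [nm]
      | succ n ih => rw [Finset.prod_range_succ, Cyc.nm_mul, ih, this, pow_succ]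
    exact h3 s
  -- w = z / r
  have hw0 : z / r ≠ 0 := div_ne_zero hz hr0
  have hrel : ∀ k, X.z ((τ ^ k) (z / r)) = X.z (z / r) := by
    intro k
    induction k with
    | zero => rfl
    | succ k ih =>
      rw [← ih]
      have hτz : τ z = σ Y / Y * z := by rw [hzz]; field_simp
      have hσY0 : σ Y ≠ 0 := by simpa using hY0
      have htY0 : (τ ^ s) Y ≠ 0 := (map_ne_zero _).2 hY0
      have htr : τ r = (τ ^ s) Y * r / Y := by rw [← hτr]; field_simp
      have : τ (z / r) = σ Y / (τ ^ s) Y * (z / r) := by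
        rw [map_div₀, hτz, htr]; field_simp
      rw [pow_succ, AlgEquiv.mul_apply, this, map_mul, z_mul _ ((map_ne_zero _).2 (div_ne_zero hσY0 htY0)) ((map_ne_zero _).2 hw0), map_div₀,
        z_div _ ((map_ne_zero _).2 hσY0) ((map_ne_zero _).2 htY0), ← T.comm_pow, hs', ← AlgEquiv.mul_apply, ← AlgEquiv.mul_apply, ← pow_add, ← pow_add,
        add_comm s k]
      ring
  have hzn : X.z (nm q τ z) = s * v.z c + q * X.z (z / r) := by
    have : nm q τ z = nm q τ r * nm q τ (z / r) := by
      rw [← Cyc.nm_mul]; congr 1; field_simp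
    rw [this, z_mul _ (Cyc.nm_ne q τ hr0) (Cyc.nm_ne q τ hw0), hnr, z_pow, hXv.z, z_nm _ _ _ hw0, Finset.sum_congr rfl fun i _ => hrel i]
    simp
  rw [hzn]
  have hkey : (q : ℤ) ∣ v.z c := by
    rcases hloc with ⟨f, hf⟩ | ⟨f, hf⟩ | h
    · exfalso
      have hf0 : f ≠ 0 := by
        rintro rfl
        have := (z_unit_of_sub_one _ hf).1
        simp [hq.ne_zero] at this
      have hfN : algebraMap K N f ≠ 0 := by simpa using hf0
      set α' := α * algebraMap K N f with hα'
      have hα0 : α ≠ 0 := T.h2.ne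
      have hp : α' ^ q = algebraMap K N (a * f ^ q) := by rw [hα', mul_pow, ← T.hα, map_mul, map_pow]
      have hα'0 : X.z α' = 0 := by
        have h1 : X.z (α' ^ q) = 0 := by rw [hp, hXv.z, (z_unit_of_sub_one _ hf).2, mul_zero]
        rw [z_pow] at h1
        rcases mul_eq_zero.1 h1 with h | h
        · exact absurd (by exact_mod_cast h) hq.ne_zero
        · exact h
      have hge : X.Ge 1 (α' ^ q - 1 ^ q) := by
        rw [hp, one_pow, ← map_one (algebraMap K N), ← map_sub]
        exact (hXv.ge_one_iff _).2 hf
      have hα'ge : X.Ge 0 α' := (ge_iff X).2 (Or.inr hα'0.ge)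
      obtain ⟨i, hi⟩ := exists_root_ge hq T.h2.primN hα'ge (ge_one' X) hge
      rw [mul_one] at hi
      have hσ : σ (α' - (algebraMap M N (algebraMap K M ζ)) ^ i) = α' - (algebraMap M N (algebraMap K M ζ)) ^ i := by
        rw [← IsScalarTower.algebraMap_apply, hα', map_sub, map_mul, T.ha, map_pow, AlgEquiv.commutes, AlgEquiv.commutes]
      have h2 : (X.cm σ).Ge 1 (α' - (algebraMap M N (algebraMap K M ζ)) ^ i) := by
        rw [cm_ge, hσ]; exact hi
      rw [hs, cm_ge, map_sub, map_pow, AlgEquiv.commutes, hα', map_mul, T.h2.act_pow, IsScalarTower.algebraMap_apply K M N f, AlgEquiv.commutes] at h2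
      have h3 := h2.sub hi
      rw [hα', IsScalarTower.algebraMap_apply K M N f] at h3
      set ξ := algebraMap M N (algebraMap K M ζ) with hξ
      have h4 : X.Ge 1 ((ξ ^ s - 1) * α') := by
        convert h3 using 1
        rw [hα', IsScalarTower.algebraMap_apply K M N f]; ring
      have h5 : X.Ge 1 (ξ ^ s - 1) := by
        have hinv : X.Ge 0 α'⁻¹ := (ge_iff X).2 (Or.inr (by rw [z_inv, hα'0]; simp))
        have := h4.mul hinv
        have hα'n : α' ≠ 0 := mul_ne_zero hα0 hfN
        rw [mul_assoc, mul_inv_cancel₀ hα'n, mul_one, add_zero] at this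
        exact this
      have h6 : ξ ^ s = 1 := eq_one_of_ge p hq T.h2.qneN (by rw [← pow_mul, mul_comm, pow_mul, T.h2.primN.pow_eq_one, one_pow]) h5
      have := T.h2.primN.dvd_of_pow_eq_one s h6
      exact absurd (Nat.le_of_dvd (Nat.pos_of_ne_zero hs0) this) (by omega)
    · exact dvd_z_of_ge hq.ne_zero hf
    · exact h.2
  exact dvd_add (Dvd.dvd.mul_left hkey _) (dvd_mul_right _ _)
end TW

end

noncomputable section
set_option linter.all false
open Finset IntermediateField FFPrime

namespace TW
variable {p q : ℕ} {K M N : Type} [Field K] [Field M] [Field N] [Algebra K M] [Algebra M N] [Algebra K N]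
    [IsScalarTower K M N] {ζ : K} {s0 : M ≃ₐ[K] M} {β : M} {τ : N ≃ₐ[M] N} {α : N} {σ : N ≃ₐ[K] N} {a : K}

lemma ge_prod_sub {F : Type} [Field F] (X : FFPrime F) (f : ℕ → F) (y : F) (hy : X.Ge 0 y) (n : ℕ) (hf : ∀ i, X.Ge 1 (f i - y)) :
    X.Ge 1 ((∏ i ∈ range n, f i) - y ^ n) := by
  induction n with
  | zero => simpa using ge_zero' X 1
  | succ n ih =>
    have h1 : X.Ge 0 (f n) := by
      have := ((hf n).mono (m := 0) (by norm_num)).add hy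
      simpa using this
    have h2 := ih.mul h1
    have h3 := (hy.pow n).mul (hf n)
    have h4 := (h2.mono (m := 1) (by norm_num)).add (h3.mono (m := 1) (by norm_num))
    convert h4 using 1
    rw [Finset.prod_range_succ]; ring

/-- ramified case -/
lemma locB (p : ℕ) [Fact p.Prime] [CharP N p] (T : TW q K M N ζ s0 β τ α σ a) {c : K} (hc : c ≠ 0) {Y : N} (hY0 : Y ≠ 0) (hY : nm q τ Y = algebraMap K N c)
    {z : N} (hz : z ≠ 0) (hzz : σ Y / Y = τ z / z) {d : K} (hd : algebraMap K N d = nm q σ z)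
    {v : FFPrime K} {W : FFPrime M} (hWv : Ov W v 1) (hW : W.cm s0 = W) (ha0 : a ≠ 0) (hloc : Loc q v a c)
    (hda : ¬ (q : ℤ) ∣ v.z a) : (q : ℤ) ∣ v.z d := by
  haveI := T.h2.finiteDim
  have hq := T.h1.hq
  obtain ⟨X, e, hX⟩ := exists_extend (L := N) W
  have hg : ∃ g, v.Ge 1 (c * g ^ q - 1) := by
    rcases hloc with ⟨f, hf⟩ | h | h
    · exact absurd (dvd_z_of_ge hq.ne_zero hf) hda
    · exact h
    · exact absurd h.1 hda
  obtain ⟨g, hg⟩ := hg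
  obtain ⟨hcg0, hcgz⟩ := z_unit_of_sub_one _ hg
  have hg0 : g ≠ 0 := by rintro rfl; simp [hq.ne_zero] at hcg0
  -- choose i
  obtain ⟨i, n, hin⟩ : ∃ (i : ℕ) (n : ℤ), i * v.z a + q * n = 1 := by
    have hco : IsCoprime (q : ℤ) (v.z a) := by
      rw [Int.isCoprime_iff_nat_coprime, Int.natAbs_natCast, hq.coprime_iff_not_dvd]
      exact fun h => hda (Int.natCast_dvd.2 h)
    obtain ⟨x, y, hxy⟩ := hco
    have hq0 : (q : ℤ) ≠ 0 := by exact_mod_cast hq.ne_zero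
    refine ⟨(y % q).toNat, x + (y / q) * v.z a, ?_⟩
    rw [Int.toNat_of_nonneg (Int.emod_nonneg _ hq0)]
    have := Int.emod_add_mul_ediv y q
    linear_combination hxy + v.z a * this
  have hi : Nat.Coprime i q := by
    rw [← Nat.isCoprime_iff_coprime]
    exact ⟨v.z a, n, by linear_combination hin⟩
  obtain ⟨π, hπ0, hπ⟩ := v.exists_z n
  have hπM : algebraMap K M π ≠ 0 := by simpa using hπ0
  have C := T.h2.twist hi hπM
  set α' := α ^ i * algebraMap M N (algebraMap K M π) with hα'
  have hα'q : algebraMap M N (algebraMap K M (a ^ i * π ^ q)) = α' ^ q := by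
    rw [← IsScalarTower.algebraMap_apply, map_mul, map_pow, T.hα, hα', mul_pow, ← IsScalarTower.algebraMap_apply, map_pow, ← pow_mul, ← pow_mul, mul_comm i q]
  have hz1 : W.z (algebraMap K M (a ^ i * π ^ q)) = 1 := by
    rw [hWv.z, z_mul _ (pow_ne_zero _ ha0) (pow_ne_zero _ hπ0), z_pow, z_pow, hπ, hin]; ring
  obtain ⟨he, hα'z⟩ := C.ram_e hX hα'q hz1
  have hcm := C.ram_cm hX hα'q hz1
  have hram := C.ram_ge hX hα'q hz1
  subst he
  have hXv : Ov X v (q * 1) := hX.trans hWv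
  have hcms : X.cm σ = X := by
    obtain ⟨s, _, hs⟩ := T.h2.conj hX (T.ov_sig hX hW)
    rw [hs, cm_pow_of_eq hcm]
  have hgN : algebraMap K N g ≠ 0 := by simpa using hg0
  set Y1 := Y * algebraMap K N g with hY1
  have hY10 : Y1 ≠ 0 := mul_ne_zero hY0 hgN
  have hnY1 : nm q τ Y1 = algebraMap K N (c * g ^ q) := by
    rw [hY1, Cyc.nm_mul, hY, IsScalarTower.algebraMap_apply K M N g, Cyc.nm_algebraMap, map_mul, map_pow, ← IsScalarTower.algebraMap_apply]
  have hzY1 : X.z Y1 = 0 := by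
    have := z_nm_of_eq q hcm hY10
    rw [hnY1, hXv.z, hcgz, mul_zero] at this
    rcases mul_eq_zero.1 this.symm with h | h
    · exact absurd (by exact_mod_cast h) hq.ne_zero
    · exact h
  have hgeY1 : X.Ge 0 Y1 := (ge_iff X).2 (Or.inr hzY1.ge)
  have hcong : ∀ j, X.Ge 1 ((τ ^ j) Y1 - Y1) := by
    intro j
    induction j with
    | zero => simpa using ge_zero' X 1
    | succ j ih =>
      have h0 : X.Ge 0 ((τ ^ j) Y1) := by
        have := (ih.mono (m := 0) (by norm_num)).add hgeY1
        simpa using this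
      have := (hram _ h0).add ih
      rw [pow_succ', AlgEquiv.mul_apply]
      simpa using this
  have hpow : X.Ge 1 (Y1 ^ q - 1 ^ q) := by
    have h1 := ge_prod_sub X (fun j => (τ ^ j) Y1) Y1 hgeY1 q hcong
    change X.Ge 1 (nm q τ Y1 - Y1 ^ q) at h1
    rw [hnY1] at h1
    have h2 : X.Ge 1 (algebraMap K N (c * g ^ q - 1)) := (hXv.ge_one_iff _).2 hg
    have := h2.sub h1
    convert this using 1
    rw [map_sub, map_one]; ring
  obtain ⟨l, hl⟩ := exists_root_ge hq T.h2.primN hgeY1 (ge_one' X) hpow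
  rw [mul_one] at hl
  have hl2 : X.Ge 1 (σ Y1 - (algebraMap M N (algebraMap K M ζ)) ^ l) := by
    have h1 : (X.cm σ).Ge 1 (Y1 - (algebraMap M N (algebraMap K M ζ)) ^ l) := by rw [hcms]; exact hl
    rw [cm_ge, map_sub, map_pow, ← IsScalarTower.algebraMap_apply, AlgEquiv.commutes] at h1
    rw [← IsScalarTower.algebraMap_apply]; exact h1
  have hinv : X.Ge 0 Y1⁻¹ := (ge_iff X).2 (Or.inr (by rw [z_inv, hzY1]; simp))
  have hq1 : X.Ge 1 (σ Y / Y - 1) := by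
    have h1 := (hl2.sub hl).mul hinv
    rw [add_zero] at h1
    convert h1 using 1
    rw [hY1, map_mul, AlgEquiv.commutes]
    field_simp
    ring
  rw [hzz] at hq1
  -- n = z_X z
  set m := X.z z with hm
  have hα'0 : α' ≠ 0 := C.ne
  set ε := z / α' ^ m with hε
  have hε0 : ε ≠ 0 := div_ne_zero hz (zpow_ne_zero _ hα'0)
  have hεz : X.z ε = 0 := by rw [hε, z_div _ hz (zpow_ne_zero _ hα'0), z_zpow, hα'z, ← hm]; ring
  have hεge : X.Ge 0 ε := (ge_iff X).2 (Or.inr hεz.ge)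
  have hεinv : X.Ge 0 ε⁻¹ := (ge_iff X).2 (Or.inr (by rw [z_inv, hεz]; simp))
  have hε1 : X.Ge 1 (τ ε / ε - 1) := by
    have := (hram ε hεge).mul hεinv
    rw [add_zero] at this
    convert this using 1
    field_simp
  set η := (algebraMap M N ((algebraMap K M ζ) ^ i)) ^ m with hη
  have hzτ : τ z / z = η * (τ ε / ε) := by
    have h1 : z = ε * α' ^ m := by rw [hε]; field_simp
    rw [h1, map_mul, map_zpow₀, C.act, mul_zpow, ← hη]
    have : α' ^ m ≠ 0 := zpow_ne_zero _ hα'0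
    field_simp
  have hηq : η ^ q = 1 := by
    rw [hη, ← zpow_natCast, zpow_comm, zpow_natCast, ← map_pow, C.prim.pow_eq_one, map_one, one_zpow]
  have hηz : X.z η = 0 := z_of_pow_eq_one X hq.ne_zero hηq
  have hηge : X.Ge 0 η := (ge_iff X).2 (Or.inr hηz.ge)
  have hη1 : X.Ge 1 (η - 1) := by
    have h1 := hηge.mul hε1
    rw [zero_add] at h1
    have := hq1.sub h1
    convert this using 1
    rw [hzτ]; ring
  have hηe : η = 1 := eq_one_of_ge p hq T.h2.qneN hηq hη1
  have hqm : (q : ℤ) ∣ m := (C.primN.zpow_eq_one_iff_dvd m).1 hηe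
  have hzd := hXv.z d
  rw [hd, z_nm_of_eq q hcms hz, ← hm] at hzd
  have hq0 : (q : ℤ) ≠ 0 := by exact_mod_cast hq.ne_zero
  have : v.z d = m := by
    apply mul_left_cancel₀ hq0; linarith
  rw [this]; exact hqm

theorem step (p : ℕ) [Fact p.Prime] [CharP N p] [CharP M p] {k : Type} [Field k] [Finite k] [Algebra k K] [Algebra k M] [IsScalarTower k K M] {u : k}
    (T : TW q K M N ζ s0 β τ α σ a) (G : GS p q k K M ζ s0 β u) {c : K} (hc : c ≠ 0) (ha0 : a ≠ 0)
    (hloc : ∀ v, Loc q v a c) (h : NS q M (algebraMap K M a) (algebraMap K M c)) : NS q K a c := by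
  have hα : algebraMap M N (algebraMap K M a) = α ^ q := by rw [← IsScalarTower.algebraMap_apply, T.hα]
  obtain ⟨Y, hY⟩ := (T.h2.ns_iff hα).1 h
  rw [← IsScalarTower.algebraMap_apply] at hY
  have hY0 : Y ≠ 0 := by
    rintro rfl
    have hcN : algebraMap K N c ≠ 0 := by simpa using hc
    apply hcN
    rw [← hY, nm]
    exact Finset.prod_eq_zero (i := 0) (by simpa using T.h1.hq.pos) (by simp)
  apply T.descend hc hY
  intro z hz hzz d hd0 hd
  apply G.main hd0
  intro v W hWv hW
  by_cases hda : (q : ℤ) ∣ v.z a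
  · exact T.locA p hc hY0 hY hz hzz hd hWv hW ha0 (hloc v) hda
  · exact T.locB p hc hY0 hY hz hzz hd hWv hW ha0 (hloc v) hda
end TW

end

noncomputable section
set_option linter.all false
open Finset IntermediateField FFPrime

lemma exists_kummer {q : ℕ} (hq : q.Prime) {M : Type} [Field M] {a : M} (h : ∀ b : M, b ^ q ≠ a) :
    ∃ (N : Type) (_ : Field N) (_ : Algebra M N) (α : N), α ^ q = algebraMap M N a ∧ adjoin M {α} = ⊤ ∧
      ∀ (i : M ≃+* M), i a = a → ∃ σ : N →+* N, σ α = α ∧ ∀ m, σ (algebraMap M N m) = algebraMap M N (i m) := by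
  have hirr := X_pow_sub_C_irreducible_of_prime hq h
  haveI : Fact (Irreducible (Polynomial.X ^ q - Polynomial.C a : Polynomial M)) := ⟨hirr⟩
  have hroot : (AdjoinRoot.root (Polynomial.X ^ q - Polynomial.C a : Polynomial M)) ^ q = algebraMap M _ a := by
    have := AdjoinRoot.eval₂_root (Polynomial.X ^ q - Polynomial.C a : Polynomial M)
    rw [Polynomial.eval₂_sub, Polynomial.eval₂_pow, Polynomial.eval₂_X, Polynomial.eval₂_C] at this
    exact sub_eq_zero.1 this
  refine ⟨AdjoinRoot (Polynomial.X ^ q - Polynomial.C a : Polynomial M), inferInstance, inferInstance, AdjoinRoot.root _, hroot, ?_, ?_⟩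
  · rw [eq_top_iff]
    intro x _
    have h1 : x ∈ Algebra.adjoin M {AdjoinRoot.root (Polynomial.X ^ q - Polynomial.C a : Polynomial M)} := by
      rw [AdjoinRoot.adjoinRoot_eq_top]; trivial
    exact algebra_adjoin_le_adjoin M _ h1
  · intro i hi
    refine ⟨AdjoinRoot.lift ((algebraMap M _).comp (i : M →+* M)) (AdjoinRoot.root _) ?_, ?_, ?_⟩
    · rw [Polynomial.eval₂_sub, Polynomial.eval₂_pow, Polynomial.eval₂_X, Polynomial.eval₂_C, hroot]
      simp [hi]
    · exact AdjoinRoot.lift_root _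
    · intro m
      exact AdjoinRoot.lift_of _

/-- norm equation solvable, or trivial extension -/
def NS' (q : ℕ) (E : Type) [Field E] (a c : E) : Prop := (∃ g, g ^ q = a) ∨ NS q E a c

theorem GS.step {p q : ℕ} {k K M : Type} [Field k] [Finite k] [Field K] [Field M] [Algebra k K] [Algebra k M] [Algebra K M] [IsScalarTower k K M]
    {ζ : K} {s0 : M ≃ₐ[K] M} {β : M} {u : k} [Fact p.Prime] [CharP M p]
    (G : GS p q k K M ζ s0 β u) {a c : K} (hc : c ≠ 0) (ha0 : a ≠ 0)
    (hloc : ∀ v, Loc q v a c) (h : NS' q M (algebraMap K M a) (algebraMap K M c)) : NS' q K a c := by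
  by_cases hK : ∃ g, g ^ q = a
  · exact Or.inl hK
  right
  have hq := G.cyc.hq
  by_cases hM : ∃ g, g ^ q = algebraMap K M a
  · obtain ⟨g, hg⟩ := hM
    have hg0 : g ≠ 0 := by
      rintro rfl
      rw [zero_pow hq.ne_zero] at hg
      exact ha0 ((map_eq_zero _).1 hg.symm)
    -- s0 g = ζ^i g
    have h1 : (s0 g / g) ^ q = 1 := by
      rw [div_pow, ← map_pow, hg, AlgEquiv.commutes, div_self]
      simpa using ha0
    haveI : NeZero q := ⟨hq.ne_zero⟩
    obtain ⟨i, hi, hi2⟩ := G.cyc.primN.eq_pow_of_pow_eq_one h1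
    have h2 : s0 g = (algebraMap K M ζ) ^ i * g := by rw [hi2]; field_simp
    have hβ := G.cyc.ne
    have hz0 : algebraMap K M ζ ≠ 0 := by simpa using G.cyc.zne
    have h3 : s0 (g / β ^ i) = g / β ^ i := by
      rw [map_div₀, map_pow, G.cyc.act, h2, mul_pow]; field_simp
    obtain ⟨r, hr⟩ := G.cyc.fix _ h3
    have hr0 : r ≠ 0 := by
      rintro rfl
      rw [map_zero] at hr
      exact (div_ne_zero hg0 (pow_ne_zero _ hβ)) hr.symm
    have hgr : g = β ^ i * algebraMap K M r := by rw [hr]; field_simp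
    have hi0 : i ≠ 0 := by
      rintro rfl
      apply hK
      refine ⟨r, (algebraMap K M).injective ?_⟩
      rw [map_pow, ← hg, hgr]; ring
    have hco : Nat.Coprime i q := by
      rw [Nat.coprime_comm, hq.coprime_iff_not_dvd]
      exact fun h => absurd (Nat.le_of_dvd (Nat.pos_of_ne_zero hi0) h) (by omega)
    have C := G.cyc.twist hco hr0
    rw [← hgr] at C
    rw [C.ns_iff hg.symm]
    have : ∃ m, m ≠ 0 ∧ nm q s0 m = algebraMap K M c := by
      apply G.main hc
      intro v W hWv hW
      rcases hloc v with ⟨f, hf⟩ | ⟨f, hf⟩ | hh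
      · exfalso
        have hf0 : f ≠ 0 := by
          rintro rfl
          have := (z_unit_of_sub_one _ hf).1
          simp [hq.ne_zero] at this
        have C2 := C.twist (Nat.coprime_one_left q) hf0
        rw [pow_one, pow_one] at C2
        have hp : algebraMap K M (a * f ^ q) = (g * algebraMap K M f) ^ q := by
          rw [mul_pow, hg, map_mul, map_pow]
        have hzz : W.z (g * algebraMap K M f) = 0 := by
          have h1 : W.z ((g * algebraMap K M f) ^ q) = 0 := by rw [← hp, hWv.z, (z_unit_of_sub_one _ hf).2, mul_zero]
          rw [z_pow] at h1
          rcases mul_eq_zero.1 h1 with h | h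
          · exact absurd (by exact_mod_cast h) hq.ne_zero
          · exact h
        refine C2.cm_ne_of_residue p hWv hzz hp (r := 1) ?_ hW
        have := hf.neg
        convert this using 1; ring
      · exact dvd_z_of_ge hq.ne_zero hf
      · exact hh.2
    obtain ⟨m, _, hm⟩ := this
    exact ⟨m, hm⟩
  · push Not at hM
    have hNS : NS q M (algebraMap K M a) (algebraMap K M c) := by
      rcases h with ⟨g, hg⟩ | h
      · exact absurd hg (hM g)
      · exact h
    obtain ⟨N, _, _, α, hα, htop, hσ⟩ := exists_kummer hq hM
    letI : Algebra K N := ((algebraMap M N).comp (algebraMap K M)).toAlgebra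
    haveI : IsScalarTower K M N := IsScalarTower.of_algebraMap_eq fun x => rfl
    haveI : CharP N p := charP_of_injective_algebraMap (algebraMap M N).injective p
    obtain ⟨τ, hτ⟩ := Cyc.of_root hq G.cyc.primN hα htop (by simpa using ha0) hM
    haveI := hτ.finiteDim
    haveI := G.cyc.finiteDim
    haveI : FiniteDimensional K N := FiniteDimensional.trans K M N
    obtain ⟨s, hs1, hs2⟩ := hσ (s0 : M ≃+* M) (by simp)
    have hcomm : ∀ x : K, s (algebraMap K N x) = algebraMap K N x := by
      intro x
      change s (algebraMap M N (algebraMap K M x)) = algebraMap M N (algebraMap K M x)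
      rw [hs2]; simp
    let s' : N →ₐ[K] N := { s with commutes' := hcomm }
    have hbij : Function.Bijective s' := ⟨s'.toRingHom.injective, (LinearMap.injective_iff_surjective (f := s'.toLinearMap)).1 s'.toRingHom.injective⟩
    let σ : N ≃ₐ[K] N := AlgEquiv.ofBijective s' hbij
    have T : TW q K M N ζ s0 β τ α σ a := ⟨G.cyc, hτ, fun m => hs2 m, hs1, by rw [hα]; rfl⟩
    exact T.step p G hc ha0 hloc hNS

end

noncomputable section
set_option linter.all false

section ZeroLemma
open MvPolynomial
variable {ι k : Type} [Field k]

open Classical in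
def killHom (k : Type) [Field k] (ι : Type) (s : Finset ι) :
    MvPolynomial ι k →ₐ[k] MvPolynomial ι k :=
  aeval (fun i => if i ∈ s then 0 else X i)

theorem kill_height [Finite ι] (s : Finset ι) :
    (s.card : ℕ∞) ≤ (RingHom.ker (killHom k ι s)).height := by
  classical
  induction s using Finset.induction_on with
  | empty => simp
  | insert i s hi ih =>
    have hlt : RingHom.ker (killHom k ι s) < RingHom.ker (killHom k ι (insert i s)) := by
      refine lt_of_le_of_ne ?_ ?_
      · intro f hf
        rw [RingHom.mem_ker] at hf ⊢
        have : killHom k ι (insert i s) = (killHom k ι {i}).comp (killHom k ι s) := by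
          apply MvPolynomial.algHom_ext
          intro j
          simp only [killHom, aeval_X, AlgHom.comp_apply, Finset.mem_insert]
          by_cases h1 : j ∈ s
          · simp [h1]
          · by_cases h2 : j = i
            · simp [h1, h2, hi]
            · simp [h1, h2]
        rw [this, AlgHom.comp_apply, hf, map_zero]
      · intro h
        have h1 : (X i : MvPolynomial ι k) ∈ RingHom.ker (killHom k ι (insert i s)) := by
          rw [RingHom.mem_ker]; simp [killHom]
        rw [← h, RingHom.mem_ker] at h1
        simp [killHom, hi] at h1
    rw [Finset.card_insert_of_notMem hi]
    push_cast
    have h1 : (RingHom.ker (killHom k ι s)).IsPrime := RingHom.ker_isPrime _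
    have h2 : (RingHom.ker (killHom k ι (insert i s))).IsPrime := RingHom.ker_isPrime _
    calc (s.card : ℕ∞) + 1 ≤ (RingHom.ker (killHom k ι s)).height + 1 := by gcongr
      _ ≤ _ := Ideal.height_add_one_le_of_lt_of_isPrime hlt

theorem zero_lemma [IsAlgClosed k] [Fintype ι] {κ : Type} [Fintype κ]
    (hc : Fintype.card κ < Fintype.card ι) (F : κ → MvPolynomial ι k)
    (hF : ∀ j, eval 0 (F j) = 0) : ∃ x : ι → k, x ≠ 0 ∧ ∀ j, eval x (F j) = 0 := by
  classical
  by_contra hcon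
  push Not at hcon
  set P := RingHom.ker (killHom k ι Finset.univ) with hP
  have hmem : ∀ f, f ∈ P ↔ eval 0 f = 0 := by
    intro f
    rw [hP, RingHom.mem_ker]
    have : killHom k ι Finset.univ f = C (eval 0 f) := by
      simp only [killHom, Finset.mem_univ, if_true]
      rw [← MvPolynomial.algebraMap_eq, aeval_def, ← MvPolynomial.coe_aeval_eq_eval]
      have := MvPolynomial.aeval_algebraMap_apply (A := k) (MvPolynomial ι k) (0 : ι → k) f
      simp only [aeval_def] at this ⊢
      convert this using 1
      · simp [Function.comp_def]
      · rfl
    rw [this]; simp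
  have hPp : P.IsPrime := RingHom.ker_isPrime _
  set s := Finset.univ.image F
  have hs : P ∈ (Ideal.span (s : Set (MvPolynomial ι k))).minimalPrimes := by
    refine ⟨⟨hPp, ?_⟩, ?_⟩
    · rw [Ideal.span_le]
      intro f hf
      simp only [s, Finset.coe_image, Set.mem_image, Finset.coe_univ, Set.mem_univ, true_and] at hf
      obtain ⟨j, rfl⟩ := hf
      exact (hmem _).2 (hF j)
    · rintro Q ⟨hQ, hsQ⟩ hQP
      intro f hf
      have := hQ
      rw [← MvPolynomial.IsPrime.vanishingIdeal_zeroLocus (K := k) Q, mem_vanishingIdeal_iff]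
      intro x hx
      have hx0 : x = 0 := by
        by_contra h0
        obtain ⟨j, hj⟩ := hcon x h0
        apply hj
        have h1 : F j ∈ Q := hsQ (Ideal.subset_span (by simp [s]))
        have := mem_zeroLocus_iff.1 hx _ h1
        simpa [MvPolynomial.coe_aeval_eq_eval] using this
      rw [hx0]
      have := (hmem f).1 hf
      simpa [MvPolynomial.coe_aeval_eq_eval] using this
  have h1 := Ideal.height_le_card_of_mem_minimalPrimes_span_finset hs
  have h2 := kill_height (k := k) (Finset.univ : Finset ι)
  have h3 : ((Finset.univ : Finset ι).card : ℕ∞) ≤ s.card := h2.trans h1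
  have h4 : (Finset.univ : Finset ι).card ≤ s.card := by exact_mod_cast h3
  have h5 : s.card ≤ Fintype.card κ := Finset.card_image_le
  rw [Finset.card_univ] at h4
  omega
end ZeroLemma

end

noncomputable section
set_option linter.all false
open Finset IntermediateField FFPrime

section consts
variable {k K Ω : Type} [Field k] [Field K] [Field Ω] [Algebra k K] [Algebra K Ω] [Algebra k Ω] [IsScalarTower k K Ω]

open Polynomial in
lemma minpoly_const (hex : ∀ x : K, IsAlgebraic k x → ∃ c, algebraMap k K c = x) {θ : Ω} (hθ : IsIntegral k θ) :
    minpoly K θ = (minpoly k θ).map (algebraMap k K) := by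
  have hd := minpoly.dvd_map_of_isScalarTower k K θ
  have hm : (minpoly K θ).Monic := minpoly.monic hθ.tower_top
  have hlift : minpoly K θ ∈ lifts (algebraMap k K) := by
    rw [lifts_iff_coeff_lifts]
    intro n
    have := Polynomial.isIntegral_coeff_of_dvd (minpoly k θ) (minpoly K θ) (minpoly.monic hθ) hm hd n
    obtain ⟨c, hc⟩ := hex _ this.isAlgebraic
    exact ⟨c, hc⟩
  obtain ⟨P, hP, hPd, hPm⟩ := lifts_and_natDegree_eq_and_monic hlift hm
  have h1 : minpoly k θ ∣ P := by
    apply minpoly.dvd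
    rw [← aeval_map_algebraMap K, hP, minpoly.aeval]
  have h2 : P ∣ minpoly k θ := by
    rw [← hP] at hd
    exact (Polynomial.map_dvd_map' _).1 hd
  rw [← hP, Polynomial.eq_of_monic_of_associated hPm (minpoly.monic hθ) (associated_of_dvd_dvd h2 h1)]

open Polynomial in
lemma mem_adjoin_poly {θ : Ω} (hθ : IsIntegral k θ) {x : Ω} (hx : x ∈ k⟮θ⟯) :
    ∃ f : k[X], f.degree < (minpoly k θ).degree ∧ aeval θ f = x := by
  obtain ⟨f, hf⟩ := (adjoin.powerBasis hθ).exists_eq_aeval' ⟨x, hx⟩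
  have h1 : x = aeval θ f := by
    have := congrArg (algebraMap k⟮θ⟯ Ω) hf
    rw [← aeval_algebraMap_apply] at this
    simpa [adjoin.powerBasis_gen] using this
  refine ⟨f %ₘ minpoly k θ, degree_modByMonic_lt _ (minpoly.monic hθ), ?_⟩
  rw [h1, aeval_modByMonic_eq_self_of_root (minpoly.aeval k θ)]

open Polynomial in
/-- linear disjointness -/
lemma const_indep (hex : ∀ x : K, IsAlgebraic k x → ∃ c, algebraMap k K c = x) {θ : Ω} (hθ : IsIntegral k θ)
    {ι : Type} [Fintype ι] {e : ι → K} (he : LinearIndependent k e) {x : ι → Ω} (hx : ∀ i, x i ∈ k⟮θ⟯)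
    (h : ∑ i, x i * algebraMap K Ω (e i) = 0) : ∀ i, x i = 0 := by
  choose f hf hfx using fun i => mem_adjoin_poly hθ (hx i)
  set Q : K[X] := ∑ i, C (e i) * (f i).map (algebraMap k K) with hQ
  have hQ0 : Q = 0 := by
    by_contra h0
    have h1 : aeval θ Q = 0 := by
      rw [hQ, map_sum, ← h]
      apply Finset.sum_congr rfl
      intro i _
      rw [map_mul, aeval_C, aeval_map_algebraMap, hfx, mul_comm]
    have h2 := minpoly.degree_le_of_ne_zero K θ h0 h1
    rw [minpoly_const hex hθ, degree_map] at h2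
    have hm : (⊥ : WithBot ℕ) < (minpoly k θ).degree := by
      rw [bot_lt_iff_ne_bot, Ne, degree_eq_bot]; exact minpoly.ne_zero hθ
    have h3 : Q.degree < (minpoly k θ).degree := by
      apply (degree_sum_le _ _).trans_lt
      rw [Finset.sup_lt_iff hm]
      intro i _
      refine lt_of_le_of_lt ?_ (hf i)
      refine (degree_mul_le _ _).trans ?_
      rw [degree_map]
      calc _ ≤ 0 + (f i).degree := by gcongr; exact degree_C_le
        _ = _ := zero_add _
    exact absurd h2 (not_le.2 h3)
  intro i
  rw [← hfx i]
  have : f i = 0 := by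
    ext n
    have h1 : ∑ i, (f i).coeff n • e i = 0 := by
      have := congrArg (fun P => coeff P n) hQ0
      simp only [hQ, finset_sum_coeff, coeff_C_mul, coeff_map, coeff_zero] at this
      rw [← this]
      exact Finset.sum_congr rfl fun i _ => by rw [Algebra.smul_def, mul_comm]
    simpa using Fintype.linearIndependent_iff.1 he _ h1 i
  rw [this, map_zero]

/-- finitely many constants generate a simple extension -/
lemma exists_theta [Finite k] {ι : Type} [Finite ι] (x : ι → Ω) (hx : ∀ i, IsIntegral k (x i)) :
    ∃ θ : Ω, IsIntegral k θ ∧ ∀ i, x i ∈ k⟮θ⟯ := by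
  haveI : FiniteDimensional k (adjoin k (Set.range x)) :=
    finiteDimensional_adjoin (by rintro _ ⟨i, rfl⟩; exact hx i)
  obtain ⟨α, hα⟩ := Field.exists_primitive_element_of_finite_bot k (adjoin k (Set.range x))
  refine ⟨α, ?_, ?_⟩
  · exact (Algebra.IsIntegral.isIntegral (R := k) α).algebraMap
  · intro i
    have h1 : (⟨x i, subset_adjoin k _ ⟨i, rfl⟩⟩ : adjoin k (Set.range x)) ∈ (⊤ : IntermediateField k (adjoin k (Set.range x))) := trivial
    rw [← hα] at h1
    have h2 := IntermediateField.lift_adjoin_simple k (adjoin k (Set.range x)) α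
    rw [← h2]
    exact ⟨_, h1, rfl⟩

open MvPolynomial in
/-- Lang–Tsen reduction -/
lemma tsen_zero [IsAlgClosed Ω] {ι : Type} [Fintype ι] (V : Submodule k K) [FiniteDimensional k V]
    (hV : Module.finrank k V < Fintype.card ι) (P : MvPolynomial ι K) (hP : ∀ s, coeff s P ∈ V)
    (hP0 : constantCoeff P = 0) :
    ∃ x : ι → Ω, x ≠ 0 ∧ (∀ i, IsIntegral k (x i)) ∧ aeval x P = 0 := by
  classical
  let f := Module.finBasis k V
  let kb := algebraicClosure k Ω
  haveI : IsAlgClosed kb := IsAlgClosure.isAlgClosed k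
  let F : Fin (Module.finrank k V) → MvPolynomial ι k := fun j =>
    ∑ s ∈ P.support, monomial s (f.repr ⟨coeff s P, hP s⟩ j)
  have hPF : P = ∑ j, C (f j : K) * MvPolynomial.map (algebraMap k K) (F j) := by
    have h1 : ∀ s, coeff s P = ∑ j, algebraMap k K (f.repr ⟨coeff s P, hP s⟩ j) * (f j : K) := by
      intro s
      have := congrArg (fun x : V => (x : K)) (f.sum_repr ⟨coeff s P, hP s⟩)
      simp only [Submodule.coe_sum, Submodule.coe_smul] at this
      refine this.symm.trans ?_
      exact Finset.sum_congr rfl fun i _ => by rw [Algebra.smul_def]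
    conv_lhs => rw [P.as_sum]
    simp only [F, map_sum, Finset.mul_sum, map_monomial, C_mul_monomial]
    rw [Finset.sum_comm]
    apply Finset.sum_congr rfl
    intro s _
    conv_lhs => rw [h1 s]
    rw [map_sum]
    exact Finset.sum_congr rfl fun i _ => by rw [mul_comm]
  have hF0 : ∀ j, eval 0 (MvPolynomial.map (algebraMap k kb) (F j)) = 0 := by
    intro j
    have h1 : constantCoeff (F j) = 0 := by
      simp only [F, map_sum]
      apply Finset.sum_eq_zero
      intro s _
      rw [constantCoeff_monomial]
      split_ifs with h
      · subst h
        have : (⟨coeff 0 P, hP 0⟩ : V) = 0 := Subtype.ext hP0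
        rw [this]; simp
      · rfl
    rw [MvPolynomial.eval_zero, constantCoeff_map, h1, map_zero]
  obtain ⟨x, hx0, hx⟩ := zero_lemma (k := kb) (ι := ι) (κ := Fin (Module.finrank k V)) (by simpa using hV) _ hF0
  refine ⟨fun i => (x i : Ω), ?_, ?_, ?_⟩
  · intro h
    apply hx0
    ext i
    simpa using congrFun h i
  · intro i
    exact (mem_algebraicClosure_iff.1 (x i).2).isIntegral
  · rw [hPF, map_sum]
    apply Finset.sum_eq_zero
    intro j _
    have h1 := congrArg (algebraMap kb Ω) (hx j)
    rw [map_zero, eval_map, ← aeval_def, ← aeval_algebraMap_apply] at h1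
    rw [map_mul, aeval_map_algebraMap]
    have h2 : aeval (fun i => (x i : Ω)) (F j) = 0 := h1
    rw [h2, mul_zero]
end consts

end

noncomputable section
set_option linter.all false
open Finset IntermediateField FFPrime

section tsen
variable {k K : Type} [Field k] [Finite k] [Field K] [Algebra k K]

lemma mul_mem_LL {D E : FFPrime K →₀ ℤ} {x y : K} (hx : x ∈ LL k D) (hy : y ∈ LL k E) : x * y ∈ LL k (D + E) := by
  intro v hv
  refine ((hx v hv).mul (hy v hv)).mono ?_
  simp

lemma LL_mono {D D' : FFPrime K →₀ ℤ} (h : D ≤ D') {x : K} (hx : x ∈ LL k D) : x ∈ LL k D' := LP_mono h hx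

variable (k) in
/-- coefficients in a Riemann–Roch space -/
def Cf {ι : Type} (D : FFPrime K →₀ ℤ) (P : MvPolynomial ι K) : Prop := ∀ s, MvPolynomial.coeff s P ∈ LL k D

namespace Cf
variable {ι : Type} {D E : FFPrime K →₀ ℤ} {P Q : MvPolynomial ι K}

lemma mul (hP : Cf k D P) (hQ : Cf k E Q) : Cf k (D + E) (P * Q) := by
  classical
  intro s
  rw [MvPolynomial.coeff_mul]
  exact Submodule.sum_mem _ fun i _ => mul_mem_LL (hP _) (hQ _)

lemma mono (h : D ≤ E) (hP : Cf k D P) : Cf k E P := fun s => LL_mono h (hP s)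

lemma sum {α : Type} (s : Finset α) (f : α → MvPolynomial ι K) (h : ∀ i ∈ s, Cf k D (f i)) : Cf k D (∑ i ∈ s, f i) := by
  intro t
  rw [MvPolynomial.coeff_sum]
  exact Submodule.sum_mem _ fun i hi => h i hi t

lemma sub (hP : Cf k D P) (hQ : Cf k D Q) : Cf k D (P - Q) := fun s => by
  rw [MvPolynomial.coeff_sub]; exact Submodule.sub_mem _ (hP s) (hQ s)

lemma monomial {x : K} (hx : x ∈ LL k D) (s : ι →₀ ℕ) : Cf k D (MvPolynomial.monomial s x) := by
  classical
  intro t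
  rw [MvPolynomial.coeff_monomial]
  split_ifs
  · exact hx
  · exact Submodule.zero_mem _

lemma one : Cf k (0 : FFPrime K →₀ ℤ) (1 : MvPolynomial ι K) := by
  have : (1 : K) ∈ LL k (0 : FFPrime K →₀ ℤ) := by
    intro v _
    simpa using v.ge_one'
  exact monomial this 0

lemma prod {α : Type} (s : Finset α) (f : α → MvPolynomial ι K) (h : ∀ i ∈ s, Cf k D (f i)) :
    Cf k (s.card • D) (∏ i ∈ s, f i) := by
  classical
  induction s using Finset.induction_on with
  | empty => simpa using one
  | insert i s hi ih =>
    rw [Finset.prod_insert hi, Finset.card_insert_of_notMem hi, succ_nsmul']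
    exact (h i (by simp)).mul (ih fun j hj => h j (by simp [hj]))

lemma pow (h : Cf k D P) (n : ℕ) : Cf k (n • D) (P ^ n) := by
  have := prod (range n) (fun _ => P) (fun _ _ => h)
  simpa using this

lemma smul_int (h : Cf k D P) (u : ℤˣ) : Cf k D (u • P) := by
  rcases Int.units_eq_one_or u with rfl | rfl
  · simpa using h
  · intro s
    have := Submodule.neg_mem _ (h s)
    simpa using this

lemma det {n : ℕ} (M : Matrix (Fin n) (Fin n) (MvPolynomial ι K)) (h : ∀ i j, Cf k D (M i j)) :
    Cf k (n • D) M.det := by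
  rw [Matrix.det_apply]
  apply sum
  intro σ _
  apply smul_int
  have := prod (Finset.univ : Finset (Fin n)) (fun i => M (σ i) i) (fun i _ => h _ _)
  simpa using this
end Cf

lemma exists_mem_LL (h : FFd k K) {x : K} (hx : x ≠ 0) : ∃ A : FFPrime K →₀ ℤ, 0 ≤ A ∧ x ∈ LL k A := by
  refine ⟨(- dv x) ⊔ 0, le_sup_right, ?_⟩
  rw [mem_LL h hx]
  intro v
  simp [dv_apply h]
  have : -(v.z x) ≤ max (-(v.z x)) 0 := le_max_left _ _
  omega

/-- alternative form of a zero of the norm form -/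
lemma NS'_of_zero {q : ℕ} (hq : q.Prime) {E : Type} [Field E] {ζ : E} (hζ : IsPrimitiveRoot ζ q) {a c : E} (ha : a ≠ 0)
    (y : ℕ → E) (z : E) (h : (nsM q a y).det = c * z ^ q) (hne : z ≠ 0 ∨ ∃ i < q, y i ≠ 0) : NS' q E a c := by
  by_cases hz : z = 0
  · left
    by_contra hcon
    push Not at hcon
    obtain ⟨N, _, _, α, hα, htop, -⟩ := exists_kummer hq hcon
    obtain ⟨τ, hc⟩ := Cyc.of_root hq hζ hα htop ha hcon
    have h1 := hc.nm_ns hα.symm y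
    rw [h, hz, zero_pow hq.ne_zero, mul_zero, map_zero] at h1
    have h2 : ∑ j ∈ range q, algebraMap E N (y j) * α ^ j = 0 := by
      by_contra h0
      exact Cyc.nm_ne q τ h0 h1.symm
    obtain ⟨i, hi, hyi⟩ := hne.resolve_left (fun h => h hz)
    apply hyi
    have h3 := hc.coef_unique y hi
    have h4 := hc.coef_unique (fun _ => 0) hi
    rw [h2] at h3
    simp only [map_zero, zero_mul, Finset.sum_const_zero] at h4
    rw [← h3, h4]
  · right
    refine ⟨fun i => z⁻¹ * y i, ?_⟩
    have : nsM q a (fun i => z⁻¹ * y i) = z⁻¹ • nsM q a y := by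
      ext l m
      simp only [nsM, Matrix.smul_apply, smul_eq_mul]
      split_ifs <;> ring
    rw [this, Matrix.det_smul, h]
    rw [Fintype.card_fin, inv_pow]
    have : z ^ q ≠ 0 := pow_ne_zero _ hz
    field_simp

open MvPolynomial in
theorem tsen {Ω : Type} [Field Ω] [IsAlgClosed Ω] [Algebra K Ω] [Algebra k Ω] [IsScalarTower k K Ω]
    (h : FFd k K) (hex : ∀ x : K, IsAlgebraic k x → ∃ c, algebraMap k K c = x) {q : ℕ} (hq : q.Prime)
    {ζ : K} (hζ : IsPrimitiveRoot ζ q) {a c : K} (ha : a ≠ 0) (hc : c ≠ 0) :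
    ∃ θ : Ω, IsIntegral k θ ∧ NS' q K⟮θ⟯ (algebraMap K K⟮θ⟯ a) (algebraMap K K⟮θ⟯ c) := by
  classical
  obtain ⟨v, -⟩ := exists_place h
  obtain ⟨A, hA, haA⟩ := exists_mem_LL h ha
  obtain ⟨C', hC, hcC⟩ := exists_mem_LL h hc
  obtain ⟨c0, R, hRR⟩ := RR h
  have hd := deg_pos h v
  set δ : ℤ := (deg k v : ℤ) with hδ
  have hδ1 : 1 ≤ δ := by omega
  -- choose s
  obtain ⟨s, hs0, hs1, hs2, hs3⟩ : ∃ s : ℤ, 0 ≤ s ∧ c0 ≤ s ∧ q * R + q * degD k A + degD k C' < s ∧ 0 ≤ s := by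
    refine ⟨|c0| + |q * R + q * degD k A + degD k C'| + 1, by positivity, ?_, ?_, by positivity⟩
    · have := le_abs_self c0; have := abs_nonneg (q * R + q * degD k A + degD k C'); omega
    · have := le_abs_self (q * R + q * degD k A + degD k C'); have := abs_nonneg c0; omega
  have hsδ : s ≤ s * δ := by nlinarith
  set D : FFPrime K →₀ ℤ := Finsupp.single v s with hD
  have hD0 : 0 ≤ D := Finsupp.single_nonneg.2 hs0
  have hdD : degD k D = s * δ := degD_single v s
  set D' : FFPrime K →₀ ℤ := q • (D + A) + C' with hD'
  have hdD' : degD k D' = q * (s * δ + degD k A) + degD k C' := by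
    rw [hD', map_add, map_nsmul, map_add, hdD, nsmul_eq_mul]
  have hA0 : 0 ≤ degD k A := degD_nonneg hA
  have hC0 : 0 ≤ degD k C' := degD_nonneg hC
  have hq1 : (1 : ℤ) ≤ q := by exact_mod_cast hq.one_lt.le
  have e1 : ell k D = s * δ - R := by rw [hRR D (by rw [hdD]; omega), hdD]
  have e2 : ell k D' = q * (s * δ + degD k A) + degD k C' - R := by
    rw [hRR D' (by rw [hdD']; nlinarith), hdD']
  have hcount : ell k D' < (q + 1) * ell k D := by
    rw [e1, e2]; nlinarith
  haveI := fin_LL h D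
  haveI := fin_LL h D'
  set r := Module.finrank k (LL k D) with hr
  let e := Module.finBasis k (LL k D)
  let ι := Fin (q + 1) × Fin r
  have hcard : Module.finrank k (LL k D') < Fintype.card ι := by
    simp only [ι, Fintype.card_prod, Fintype.card_fin]
    have : ((Module.finrank k (LL k D') : ℕ) : ℤ) < (q + 1) * (r : ℤ) := hcount
    exact_mod_cast this
  let Y : ℕ → MvPolynomial ι K := fun i => if hi : i < q + 1 then
    ∑ m : Fin r, monomial (Finsupp.single ((⟨i, hi⟩, m) : ι) 1) (e m : K) else 0
  have hY : ∀ i, Cf k D (Y i) := by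
    intro i
    simp only [Y]
    split_ifs with hi
    · exact Cf.sum _ _ fun m _ => Cf.monomial (e m).2 _
    · intro s; simp
  let P : MvPolynomial ι K := (nsM q (C a) Y).det - C c * Y q ^ q
  have hP : Cf k D' P := by
    apply Cf.sub
    · apply Cf.mono (D := q • (D + A))
      · rw [hD']; exact le_add_of_nonneg_right hC
      · apply Cf.det
        intro i j
        simp only [nsM]
        split_ifs
        · exact (hY _).mono (le_add_of_nonneg_right hA)
        · rw [add_comm]; exact (Cf.monomial haA 0).mul (hY _)
    · have := (Cf.monomial hcC 0).mul ((hY q).pow q)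
      refine Cf.mono ?_ this
      rw [hD', add_comm]
      gcongr
      exact le_add_of_nonneg_right hA
  have hq0 := hq.ne_zero
  have hY0 : ∀ i, constantCoeff (Y i) = 0 := by
    intro i
    simp only [Y]
    split_ifs
    · rw [map_sum]
      apply Finset.sum_eq_zero
      intro m _
      rw [constantCoeff_monomial, if_neg]
      simp
    · simp
  have hP0 : constantCoeff P = 0 := by
    simp only [P, map_sub, map_mul, map_pow, hY0, zero_pow hq0, mul_zero, sub_zero]
    rw [nsM_map]
    simp only [hY0]
    haveI : Nonempty (Fin q) := ⟨⟨0, hq.pos⟩⟩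
    have : nsM q (constantCoeff (C (σ := ι) a)) (fun _ => (0 : K)) = 0 := by
      ext l m; simp [nsM]
    rw [this, Matrix.det_zero]
  obtain ⟨x, hx0, hxi, hx⟩ := tsen_zero (Ω := Ω) (LL k D') hcard P hP hP0
  obtain ⟨θ, hθ, hxθ⟩ := exists_theta x hxi
  refine ⟨θ, hθ, ?_⟩
  -- values
  have hmem : ∀ i, x i ∈ K⟮θ⟯ := by
    intro i
    have : k⟮θ⟯ ≤ (K⟮θ⟯).restrictScalars k := by
      rw [adjoin_simple_le_iff]; exact mem_adjoin_simple_self K θ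
    exact this (hxθ i)
  let yv : ℕ → K⟮θ⟯ := fun i => if hi : i < q + 1 then
    ∑ m : Fin r, algebraMap K K⟮θ⟯ (e m : K) * (⟨x (⟨i, hi⟩, m), hmem _⟩ : K⟮θ⟯) else 0
  have hyv : ∀ i, algebraMap K⟮θ⟯ Ω (yv i) = aeval x (Y i) := by
    intro i
    simp only [yv, Y]
    split_ifs with hi
    · rw [map_sum, map_sum]
      apply Finset.sum_congr rfl
      intro m _
      rw [aeval_monomial, map_mul]
      simp
    · simp
  have hζ' : IsPrimitiveRoot (algebraMap K K⟮θ⟯ ζ) q := hζ.map_of_injective (algebraMap K K⟮θ⟯).injective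
  refine NS'_of_zero hq hζ' (by simpa using ha) yv (yv q) ?_ ?_
  · apply (algebraMap K⟮θ⟯ Ω).injective
    rw [nsM_map, map_mul, map_pow]
    simp only [hyv]
    have h1 : aeval x P = 0 := hx
    simp only [P, map_sub, map_mul, map_pow] at h1
    have h2 := nsM_map ((aeval x : MvPolynomial ι K →ₐ[K] Ω) : MvPolynomial ι K →+* Ω) q (C a) Y
    simp only [RingHom.coe_coe, aeval_C] at h2 h1
    rw [h2] at h1
    exact sub_eq_zero.1 h1
  · by_contra hcon
    push Not at hcon
    apply hx0
    have hli : LinearIndependent k (fun m : Fin r => (e m : K)) :=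
      e.linearIndependent.map' (LL k D).subtype (Submodule.ker_subtype _)
    ext ⟨i, m⟩
    have hyi : yv i = 0 := by
      by_cases hi : i.1 < q
      · exact hcon.2 i hi
      · have : i.1 = q := by have := i.2; omega
        rw [this]; exact hcon.1
    refine const_indep hex hθ hli (x := fun m => x (i, m)) (fun m => hxθ _) ?_ m
    have h1 := congrArg (algebraMap K⟮θ⟯ Ω) hyi
    simp only [yv, i.2, dif_pos, map_sum, map_mul, map_zero] at h1
    rw [← h1]
    apply Finset.sum_congr rfl
    intro m _
    rw [mul_comm]
    rfl
end tsen

end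

noncomputable section
set_option linter.all false
open Finset IntermediateField FFPrime

section p8
lemma consts_spec {F K : Type} [Field F] [Finite F] [Field K] [Algebra F K] (h : FFd F K) :
    Finite (algebraicClosure F K) ∧ FFd (algebraicClosure F K) K ∧
      ∀ x : K, IsAlgebraic (algebraicClosure F K) x → ∃ c, algebraMap (algebraicClosure F K) K c = x := by
  refine ⟨?_, ?_, ?_⟩
  · haveI := fin_LL h (0 : FFPrime K →₀ ℤ)
    haveI : Finite (LL F (0 : FFPrime K →₀ ℤ)) := Module.finite_of_finite F
    refine Finite.of_injective (β := LL F (0 : FFPrime K →₀ ℤ))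
      (fun x => ⟨x, fun v _ => by simpa using ge_of_algebraic (k := F) v (mem_algebraicClosure_iff.1 x.2)⟩) ?_
    intro x y hxy
    exact Subtype.ext (congrArg (fun z : LL F (0 : FFPrime K →₀ ℤ) => (z : K)) hxy)
  · obtain ⟨t, ht, hf⟩ := h
    refine ⟨t, ht.algebraicClosure, ?_⟩
    set k := algebraicClosure F K
    have hle : F⟮t⟯ ≤ (k⟮t⟯).restrictScalars F := by
      rw [adjoin_simple_le_iff]; exact mem_adjoin_simple_self k t
    let f : F⟮t⟯ →+* k⟮t⟯ := (inclusion hle).toRingHom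
    letI : Algebra F⟮t⟯ k⟮t⟯ := f.toAlgebra
    haveI : IsScalarTower F⟮t⟯ k⟮t⟯ K := IsScalarTower.of_algebraMap_eq' (by
      ext x
      rfl)
    exact Module.Finite.of_restrictScalars_finite F⟮t⟯ k⟮t⟯ K
  · intro x hx
    have : IsAlgebraic F x := hx.restrictScalars F
    exact ⟨⟨x, mem_algebraicClosure_iff.2 this⟩, rfl⟩

lemma Loc.lift {q : ℕ} {K L : Type} [Field K] [Field L] [Algebra K L] {v : FFPrime K} {w : FFPrime L} {e : ℤ}
    (h : Ov w v e) {a c : K} (hl : Loc q v a c) : Loc q w (algebraMap K L a) (algebraMap K L c) := by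
  rcases hl with ⟨g, hg⟩ | ⟨g, hg⟩ | ⟨h1, h2⟩
  · left
    refine ⟨algebraMap K L g, ?_⟩
    rw [← h.ge_one_iff] at hg
    simpa using hg
  · right; left
    refine ⟨algebraMap K L g, ?_⟩
    rw [← h.ge_one_iff] at hg
    simpa using hg
  · right; right
    rw [h.z, h.z]
    exact ⟨h1.mul_left _, h2.mul_left _⟩

lemma NS'.map {q : ℕ} {E E' : Type} [Field E] [Field E'] (φ : E →+* E') {a c : E} (h : NS' q E a c) : NS' q E' (φ a) (φ c) := by
  rcases h with ⟨g, hg⟩ | ⟨y, hy⟩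
  · exact Or.inl ⟨φ g, by rw [← hg, map_pow]⟩
  · exact Or.inr ⟨fun i => φ (y i), by rw [← nsM_map, hy]⟩

lemma pow_cop {K : Type} [Field K] {q n : ℕ} (hq : q.Prime) (hn : n.Coprime q) {a g : K} (ha : a ≠ 0) (h : a ^ n = g ^ q) :
    ∃ r, r ^ q = a := by
  obtain ⟨m, -, hm⟩ := Nat.exists_mul_mod_eq_one_of_coprime hn hq.one_lt
  obtain ⟨j, h1⟩ : ∃ j, n * m = q * j + 1 := ⟨n * m / q, by
    have := Nat.div_add_mod (n * m) q
    omega⟩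
  refine ⟨g ^ m / a ^ j, ?_⟩
  rw [div_pow, ← pow_mul, ← pow_mul, mul_comm m q, pow_mul g, ← h, ← pow_mul, h1, pow_succ,
    mul_comm j q, mul_comm, mul_div_assoc, div_self (pow_ne_zero _ ha), mul_one]

/-- prime-to-q degree -/
lemma NS'_coprime {q : ℕ} (hq : q.Prime) {K E : Type} [Field K] [Field E] [Algebra K E] [FiniteDimensional K E]
    {ζ : K} (hζ : IsPrimitiveRoot ζ q) {a c : K} (ha : a ≠ 0) (hc : c ≠ 0) (hn : (Module.finrank K E).Coprime q)
    (h : NS' q E (algebraMap K E a) (algebraMap K E c)) : NS' q K a c := by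
  by_cases hK : ∃ g, g ^ q = a
  · exact Or.inl hK
  right
  have hE : ∀ g, g ^ q ≠ algebraMap K E a := by
    intro g hg
    apply hK
    apply pow_cop hq hn ha (g := Algebra.norm K g)
    rw [← Algebra.norm_algebraMap, ← hg, map_pow]
  obtain h | h := h
  · obtain ⟨g, hg⟩ := h; exact absurd hg (hE g)
  push Not at hK
  obtain ⟨N, _, _, β, hβ, htop, -⟩ := exists_kummer hq hE
  obtain ⟨τ, hcy⟩ := Cyc.of_root hq (hζ.map_of_injective (algebraMap K E).injective) hβ htop (by simpa using ha) hE
  letI : Algebra K N := ((algebraMap E N).comp (algebraMap K E)).toAlgebra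
  haveI : IsScalarTower K E N := IsScalarTower.of_algebraMap_eq' rfl
  haveI := hcy.finiteDim
  haveI : FiniteDimensional K N := FiniteDimensional.trans K E N
  obtain ⟨Y, hY⟩ := (hcy.ns_iff hβ.symm).1 h
  have hY' : Algebra.norm E Y = algebraMap K E c := by
    apply (algebraMap E N).injective
    rw [hcy.norm_eq, hY]
  have hβ' : (AdjoinSimple.gen K β) ^ q = algebraMap K K⟮β⟯ a := by
    apply (algebraMap K⟮β⟯ N).injective
    rw [map_pow, AdjoinSimple.algebraMap_gen, hβ]
    rfl
  obtain ⟨τ', hcy'⟩ := Cyc.of_root hq hζ hβ' (adjoin_gen_top β) ha hK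
  rw [hcy'.ns_iff hβ'.symm]
  have h1 : Algebra.norm K (Algebra.norm K⟮β⟯ Y) = c ^ Module.finrank K E := by
    rw [Algebra.norm_norm, ← Algebra.norm_norm (S := E), hY', Algebra.norm_algebraMap]
  obtain ⟨m, -, hm⟩ := Nat.exists_mul_mod_eq_one_of_coprime hn hq.one_lt
  set n := Module.finrank K E
  obtain ⟨j, h2⟩ : ∃ j, n * m = q * j + 1 := ⟨n * m / q, by
    have := Nat.div_add_mod (n * m) q
    omega⟩
  have h3 := hcy'.norm_eq (Algebra.norm K⟮β⟯ Y)
  rw [h1] at h3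
  refine ⟨(Algebra.norm K⟮β⟯ Y) ^ m * algebraMap K K⟮β⟯ (c⁻¹ ^ j), ?_⟩
  rw [← hcy'.norm_eq, map_mul, map_pow, h1]
  congr 1
  have h4 : Algebra.norm K (algebraMap K K⟮β⟯ (c⁻¹ ^ j)) = (c⁻¹ ^ j) ^ q := by
    apply (algebraMap K K⟮β⟯).injective
    rw [hcy'.norm_eq, Cyc.nm_algebraMap, ← map_pow]
  rw [h4, ← pow_mul, h2, ← pow_mul, mul_comm _ q, pow_succ, inv_pow]
  have := pow_ne_zero (q * j) hc
  field_simp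
end p8

end

noncomputable section
set_option linter.all false
open Finset IntermediateField FFPrime

section p8
/-- nonresidue in `k`, its root in `k(θ)` -/
lemma exists_beta {k Ω : Type} [Field k] [Finite k] [Field Ω] [Algebra k Ω] {q : ℕ} (hq : q.Prime)
    {z : k} (hz : IsPrimitiveRoot z q) {θ : Ω} (hθ : IsIntegral k θ) (hn : q ∣ Module.finrank k k⟮θ⟯) :
    ∃ (u : k) (β : Ω), u ≠ 0 ∧ (∀ r : k, r ^ q ≠ u) ∧ β ∈ k⟮θ⟯ ∧ β ^ q = algebraMap k Ω u := by
  classical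
  haveI := Fintype.ofFinite k
  haveI : FiniteDimensional k k⟮θ⟯ := adjoin.finiteDimensional hθ
  haveI : Finite k⟮θ⟯ := Module.finite_of_finite k
  have hQ : 0 < Nat.card k := Nat.card_pos
  have hcu : Nat.card kˣ = Nat.card k - 1 := by rw [Nat.card_units]
  have hq1 : q ∣ Nat.card k - 1 := by
    rw [← hcu]
    haveI : NeZero q := ⟨hq.ne_zero⟩
    have h1 : IsPrimitiveRoot (hz.toRootsOfUnity : kˣ) q := by
      have := hz
      rw [← IsPrimitiveRoot.coe_units_iff]
      simpa using hz
    rw [h1.eq_orderOf]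
    exact orderOf_dvd_natCard _
  obtain ⟨g, hg⟩ := IsCyclic.exists_generator (α := kˣ)
  have hog := orderOf_eq_card_of_forall_mem_zpowers hg
  obtain ⟨t, ht⟩ := card_units_div hQ hq1 hn
  refine ⟨g, ?_⟩
  have hcE : Nat.card (k⟮θ⟯)ˣ = q * ((Nat.card k - 1) * t) := by
    rw [Nat.card_units, Module.natCard_eq_pow_finrank (K := k) (V := k⟮θ⟯), ht]
  obtain ⟨r, hr⟩ := pow_crit hcE (Units.map (algebraMap k k⟮θ⟯).toMonoidHom g) (by
    rw [← map_pow, pow_mul, ← hcu, pow_card_eq_one', one_pow, map_one])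
  refine ⟨((r : k⟮θ⟯) : Ω), g.ne_zero, ?_, SetLike.coe_mem _, ?_⟩
  · intro r hr
    have hr0 : r ≠ 0 := by
      rintro rfl; rw [zero_pow hq.ne_zero] at hr; exact g.ne_zero hr.symm
    have h1 : (Units.mk0 r hr0) ^ q = g := Units.ext (by simpa using hr)
    obtain ⟨m, hm⟩ := hq1
    have hm0 : 0 < m := by
      rcases Nat.eq_zero_or_pos m with rfl | h
      · have : 0 < Nat.card kˣ := Nat.card_pos
        rw [hcu, hm] at this; simp at this
      · exact h
    have h2 : g ^ m = 1 := by
      rw [← h1, ← pow_mul, ← hm, ← hcu, pow_card_eq_one']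
    have h3 := Nat.le_of_dvd hm0 (orderOf_dvd_of_pow_eq_one h2)
    rw [hog, hcu, hm] at h3
    have := hq.two_le
    nlinarith
  · have := congrArg (fun x : (k⟮θ⟯)ˣ => ((x : k⟮θ⟯) : Ω)) hr
    simpa using this

theorem descend_const {p q : ℕ} [Fact p.Prime] (hq : q.Prime) {F : Type} [Field F] [Finite F] [CharP F p] (n : ℕ) :
    ∀ (K Ω : Type) [Field K] [Field Ω] [Algebra F K] [Algebra K Ω] [Algebra F Ω] [IsScalarTower F K Ω]
      (ζ : K) (a c : K) (θ : Ω), FFd F K → IsPrimitiveRoot ζ q → a ≠ 0 → c ≠ 0 → IsIntegral F θ →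
      Module.finrank K K⟮θ⟯ = n → (∀ v, Loc q v a c) →
      NS' q K⟮θ⟯ (algebraMap K K⟮θ⟯ a) (algebraMap K K⟮θ⟯ c) → NS' q K a c := by
  induction n using Nat.strong_induction_on with
  | _ n ih =>
  intro K Ω _ _ _ _ _ _ ζ a c θ hF hζ ha hc hθ hn hloc hNS
  haveI : FiniteDimensional K K⟮θ⟯ := adjoin.finiteDimensional hθ.tower_top
  by_cases hqn : q ∣ n
  · obtain ⟨hfin, hff, hex⟩ := consts_spec hF
    set k := algebraicClosure F K with hk
    haveI := hfin
    have hθk : IsIntegral k θ := hθ.tower_top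
    have hmp := minpoly_const hex hθk
    have hdeg : Module.finrank k k⟮θ⟯ = n := by
      rw [adjoin.finrank hθk, ← hn, adjoin.finrank hθ.tower_top, hmp, Polynomial.natDegree_map]
    obtain ⟨z, hz⟩ := hex ζ (by
      have : IsAlgebraic k (ζ ^ q) := by rw [hζ.pow_eq_one]; exact isAlgebraic_one
      exact this.of_pow hq.pos)
    have hzp : IsPrimitiveRoot z q := by
      rw [← hz] at hζ
      exact IsPrimitiveRoot.of_map_of_injective hζ (algebraMap k K).injective
    obtain ⟨u, β, hu0, hnr, hβθ, hβ⟩ := exists_beta hq hzp hθk (by rw [hdeg]; exact hqn)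
    have hnrK : ∀ r : K, r ^ q ≠ algebraMap k K u := by
      intro r hr
      obtain ⟨s, rfl⟩ := hex r (by
        have : IsAlgebraic k (r ^ q) := by rw [hr]; exact isAlgebraic_algebraMap u
        exact this.of_pow hq.pos)
      exact hnr s ((algebraMap k K).injective (by rw [map_pow, hr]))
    have hβ' : (AdjoinSimple.gen K β) ^ q = algebraMap K K⟮β⟯ (algebraMap k K u) := by
      apply (algebraMap K⟮β⟯ Ω).injective
      rw [map_pow, AdjoinSimple.algebraMap_gen, hβ]
      rfl
    obtain ⟨σ, hcy⟩ := Cyc.of_root hq hζ hβ' (adjoin_gen_top β) (by simpa using hu0) hnrK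
    haveI := hcy.finiteDim
    have hrank : 1 < Module.finrank K K⟮β⟯ := by
      by_contra hle
      have h1 : Module.finrank K K⟮β⟯ = 1 := by
        have : 0 < Module.finrank K K⟮β⟯ := Module.finrank_pos
        omega
      obtain ⟨r, hr⟩ := mem_bot.1 (show β ∈ (⊥ : IntermediateField K Ω) by
        rw [← finrank_adjoin_simple_eq_one_iff]; exact h1)
      apply hnrK r
      apply (algebraMap K Ω).injective
      rw [map_pow, hr, hβ]; rfl
    have hβK : β ∈ K⟮θ⟯ := by
      have : k⟮θ⟯ ≤ (K⟮θ⟯).restrictScalars k := by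
        rw [adjoin_simple_le_iff]; exact mem_adjoin_simple_self K θ
      exact this hβθ
    have hle : K⟮β⟯ ≤ K⟮θ⟯ := by rw [adjoin_simple_le_iff]; exact hβK
    have heq : (adjoin K⟮β⟯ {θ}).restrictScalars K = K⟮θ⟯ := by
      apply le_antisymm
      · intro x hx
        have : adjoin K⟮β⟯ {θ} ≤ extendScalars hle := by
          rw [adjoin_simple_le_iff]; exact mem_adjoin_simple_self K θ
        exact this hx
      · rw [adjoin_simple_le_iff]; exact mem_adjoin_simple_self K⟮β⟯ θ
    have hfr : Module.finrank K K⟮β⟯ * Module.finrank K⟮β⟯ (adjoin K⟮β⟯ {θ}) = n := by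
      rw [Module.finrank_mul_finrank, ← hn]
      exact congrArg (fun I : IntermediateField K Ω => Module.finrank K I) heq
    have hpos : 0 < n := by rw [← hn]; exact Module.finrank_pos
    have hlt : Module.finrank K⟮β⟯ (adjoin K⟮β⟯ {θ}) < n := by
      rw [← hfr]
      have : 0 < Module.finrank K⟮β⟯ (adjoin K⟮β⟯ {θ}) := by
        rcases Nat.eq_zero_or_pos (Module.finrank K⟮β⟯ (adjoin K⟮β⟯ {θ})) with h | h
        · rw [h] at hfr; omega
        · exact h
      nlinarith
    haveI : CharP K⟮β⟯ p := charP_of_injective_algebraMap (algebraMap F K⟮β⟯).injective p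
    have hFM : FFd F K⟮β⟯ := hF.ext
    let φ : K⟮θ⟯ →+* adjoin K⟮β⟯ {θ} := (inclusion heq.ge).toRingHom
    haveI : IsScalarTower F K⟮β⟯ Ω := IsScalarTower.of_algebraMap_eq (fun x => by
      rw [IsScalarTower.algebraMap_apply F K Ω, IsScalarTower.algebraMap_apply F K K⟮β⟯, ← IsScalarTower.algebraMap_apply K K⟮β⟯ Ω])
    have hM : NS' q K⟮β⟯ (algebraMap K K⟮β⟯ a) (algebraMap K K⟮β⟯ c) := by
      refine ih _ hlt K⟮β⟯ Ω (algebraMap K K⟮β⟯ ζ) _ _ θ hFM (hζ.map_of_injective (algebraMap K K⟮β⟯).injective)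
        (by simpa using ha) (by simpa using hc) hθ rfl ?_ ?_
      · intro w
        obtain ⟨v, e, hv⟩ := exists_restrict (K := K) w
        exact (hloc v).lift hv
      · exact hNS.map φ
    have G : GS p q k K K⟮β⟯ ζ σ (AdjoinSimple.gen K β) u := ⟨hff, hex, hcy, hβ'⟩
    exact G.step hc ha hloc hM
  · exact NS'_coprime hq hζ ha hc (by rw [hn]; exact (hq.coprime_iff_not_dvd.2 hqn).symm) hNS

theorem local_global {p q : ℕ} [Fact p.Prime] (hq : q.Prime) {F : Type} [Field F] [Finite F] [CharP F p]
    {K : Type} [Field K] [Algebra F K] {ζ a c : K} (hF : FFd F K) (hζ : IsPrimitiveRoot ζ q) (ha : a ≠ 0) (hc : c ≠ 0)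
    (hloc : ∀ v, Loc q v a c) : NS' q K a c := by
  obtain ⟨hfin, hff, hex⟩ := consts_spec hF
  haveI := hfin
  obtain ⟨θ, hθ, h⟩ := tsen (k := algebraicClosure F K) (K := K) (Ω := AlgebraicClosure K) hff hex hq hζ ha hc
  have hθF : IsIntegral F θ := isIntegral_trans θ hθ
  exact descend_const (p := p) hq (F := F) _ K (AlgebraicClosure K) ζ a c θ hF hζ ha hc hθF rfl hloc h
end p8

end

noncomputable section
set_option linter.all false
open Finset IntermediateField FFPrime

section p10
lemma finiteDim_of_root {q : ℕ} (hq : q.Prime) {K M : Type} [Field K] [Field M] [Algebra K M] {u : K} {α : M}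
    (h : α ^ q = algebraMap K M u) (ht : adjoin K {α} = ⊤) : FiniteDimensional K M := by
  have hi : IsIntegral K α := by
    refine IsIntegral.of_pow hq.pos ?_
    rw [h]; exact isIntegral_algebraMap
  haveI : FiniteDimensional K K⟮α⟯ := adjoin.finiteDimensional hi
  rw [ht] at this
  exact Module.Finite.equiv (IntermediateField.topEquiv (F := K) (E := M)).toLinearEquiv

lemma dvd_z_of_root {q : ℕ} {M : Type} [Field M] (W : FFPrime M) {α u : M} (h : α ^ q = u) : (q : ℤ) ∣ W.z u := by
  rw [← h, z_pow]; exact Dvd.intro _ rfl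

lemma loc_of {q : ℕ} (hq : q.Prime) {K M : Type} [Field K] [Field M] [Algebra K M] [Algebra.IsAlgebraic K M]
    {S : Set (FFPrime K)} {x a b : K} (hx : x ≠ 0) (hi : ∀ v : FFPrime K, v ∉ S → 0 ≤ v.ord x)
    (haS : ∀ v ∈ S, 0 < v.ord (a - 1)) (ha : a ≠ 0) (hc : b * x ^ q + b ^ q ≠ 0)
    {α1 α3 α4 : M} (h1 : α1 ^ q = algebraMap K M (1 + (b * x ^ q + b ^ q)⁻¹))
    (h3 : α3 ^ q = algebraMap K M (1 + x⁻¹)) (h4 : α4 ^ q = algebraMap K M (1 + (a + a⁻¹) * x⁻¹)) (W : FFPrime M) :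
    Loc q W (algebraMap K M a) (algebraMap K M (b * x ^ q + b ^ q)) := by
  obtain ⟨v, e, hv⟩ := exists_restrict (K := K) W
  have hq2 := hq.two_le
  have hb : b ≠ 0 := by
    rintro rfl; apply hc; simp [hq.ne_zero]
  by_cases hvS : v ∈ S
  · refine Loc.lift hv (Or.inl ⟨1, ?_⟩)
    simpa using (v.ge_pos_iff).2 (haS v hvS)
  have hx0 : 0 ≤ v.z x := (v.ge_iff' hx).1 ((v.ge_nonneg_iff).2 (hi v hvS))
  by_cases hb0 : v.z b < 0
  · refine Loc.lift hv (Or.inr (Or.inl ⟨b⁻¹, ?_⟩))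
    have e1 : (b * x ^ q + b ^ q) * b⁻¹ ^ q - 1 = x ^ q * (b * b⁻¹ ^ q) := by
      have h : b ^ q * b⁻¹ ^ q = 1 := by rw [← mul_pow, mul_inv_cancel₀ hb, one_pow]
      linear_combination h
    rw [e1, ge_iff' v (by positivity), z_mul v (by positivity) (by positivity), z_mul v hb (by positivity), z_pow, z_pow, z_inv]
    have : (2:ℤ) ≤ q := by exact_mod_cast hq2
    nlinarith
  push Not at hb0
  right; right
  set c := b * x ^ q + b ^ q with hcd
  have hc0 : 0 ≤ v.z c := by
    rw [← ge_iff' v hc]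
    have hb' : v.Ge 0 b := (v.ge_iff' hb).2 hb0
    have hx' : v.Ge 0 x := (v.ge_iff' hx).2 hx0
    have := hb'.mul (hx'.pow q)
    have h2 := hb'.pow q
    simp only [mul_zero, add_zero] at this h2
    exact this.add h2
  have key : ∀ {u : K} {α : M}, α ^ q = algebraMap K M (1 + u) → v.z u < 0 → (q:ℤ) ∣ W.z (algebraMap K M u) := by
    intro u α h hu
    have := dvd_z_of_root W h
    rwa [hv.z, (z_one_add_of_neg v hu).2, ← hv.z] at this
  have kx : (q : ℤ) ∣ W.z (algebraMap K M x) := by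
    rcases hx0.eq_or_lt with h | h
    · rw [hv.z, ← h]; simp
    · have := key h3 (by rw [z_inv]; omega)
      rwa [map_inv₀, z_inv, dvd_neg] at this
  refine ⟨?_, ?_⟩
  · by_cases ha0 : v.z a = 0
    · rw [hv.z, ha0]; simp
    · rcases lt_or_gt_of_ne ha0 with h | h
      · have hz := z_add_eq v ha (y := a⁻¹) ((v.ge_iff' (inv_ne_zero ha)).2 (by rw [z_inv]; omega))
        have hz2 : v.z ((a + a⁻¹) * x⁻¹) = v.z a - v.z x := by
          rw [z_mul v hz.1 (inv_ne_zero hx), hz.2, z_inv]; ring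
        have := key h4 (by rw [hz2]; omega)
        rw [hv.z, hz2, mul_sub, ← hv.z, ← hv.z] at this
        exact (dvd_sub_left kx).1 this
      · have hz := z_add_eq v (inv_ne_zero ha) (y := a) ((v.ge_iff' ha).2 (by rw [z_inv]; omega))
        rw [add_comm] at hz
        have hz2 : v.z ((a + a⁻¹) * x⁻¹) = -(v.z a + v.z x) := by
          rw [z_mul v hz.1 (inv_ne_zero hx), hz.2, z_inv, z_inv]; ring
        have := key h4 (by rw [hz2]; omega)
        rw [hv.z, hz2, mul_neg, dvd_neg, mul_add, ← hv.z, ← hv.z] at this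
        exact (dvd_add_left kx).1 this
  · rcases hc0.eq_or_lt with h | h
    · rw [hv.z, ← h]; simp
    · have := key h1 (by rw [z_inv]; omega)
      rwa [map_inv₀, z_inv, dvd_neg] at this

lemma norm_of_NS' {q : ℕ} (hq : q.Prime) {K M : Type} [Field K] [Field M] [Algebra K M] {ζ a c : K} {α : M}
    (hζ : IsPrimitiveRoot ζ q) (ha : a ≠ 0) (h : α ^ q = algebraMap K M a) (ht : adjoin K {α} = ⊤) (hn : NS' q K a c) :
    ∃ y : M, Algebra.norm K y = c := by
  by_cases hg : ∃ g, g ^ q = a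
  · obtain ⟨g, hg⟩ := hg
    haveI : NeZero q := ⟨hq.ne_zero⟩
    have hg0 : algebraMap K M g ≠ 0 := by
      rw [Ne, map_eq_zero]; rintro rfl; exact ha (by rw [← hg, zero_pow hq.ne_zero])
    have hz : (α / algebraMap K M g) ^ q = 1 := by
      rw [div_pow, h, ← map_pow, hg, div_self]; rwa [Ne, map_eq_zero]
    obtain ⟨i, -, hi⟩ := (hζ.map_of_injective (algebraMap K M).injective).eq_pow_of_pow_eq_one hz
    have hα : α = algebraMap K M (ζ ^ i * g) := by
      rw [map_mul, map_pow, hi, div_mul_cancel₀ _ hg0]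
    have hb : (⊥ : IntermediateField K M) = ⊤ := by
      rw [← ht, hα]; exact (adjoin_simple_eq_bot_iff.2 (IntermediateField.algebraMap_mem _ _)).symm
    have hf : Module.finrank K M = 1 := by
      rw [← IntermediateField.finrank_top', ← hb, IntermediateField.finrank_bot]
    exact ⟨algebraMap K M c, by rw [Algebra.norm_algebraMap, hf, pow_one]⟩
  · have hns : NS q K a c := hn.resolve_left hg
    push Not at hg
    obtain ⟨τ, hcy⟩ := Cyc.of_root hq hζ h ht ha hg
    obtain ⟨Y, hY⟩ := (hcy.ns_iff h.symm).1 hns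
    exact ⟨Y, (algebraMap K M).injective (by rw [hcy.norm_eq, hY])⟩

theorem partA {p q : ℕ} [Fact p.Prime] (hq : q.Prime) {F : Type} [Field F] [Finite F] [CharP F p]
    {K : Type} [Field K] [Algebra F K] {ζ : K} (hF : FFd F K) (hζ : IsPrimitiveRoot ζ q)
    {S : Set (FFPrime K)} {x a b : K} (hx : x ≠ 0) (hi : ∀ v : FFPrime K, v ∉ S → 0 ≤ v.ord x)
    (haS : ∀ v ∈ S, 0 < v.ord (a - 1)) (ha : a ≠ 0) (hc : b * x ^ q + b ^ q ≠ 0) : NormTower4Solvable q K a b x := by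
  intro M1 _ _ α1 h1 t1 M3 _ _ α3 h3 t3 M4 _ _ α4 h4 t4 M5 _ _ α5 h5 t5
  haveI := finiteDim_of_root hq h1 t1
  haveI := finiteDim_of_root hq h3 t3
  haveI := finiteDim_of_root hq h4 t4
  letI : Algebra K M3 := ((algebraMap M1 M3).comp (algebraMap K M1)).toAlgebra
  haveI : IsScalarTower K M1 M3 := IsScalarTower.of_algebraMap_eq (fun _ => rfl)
  letI : Algebra K M4 := ((algebraMap M3 M4).comp (algebraMap K M3)).toAlgebra
  haveI : IsScalarTower K M3 M4 := IsScalarTower.of_algebraMap_eq (fun _ => rfl)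
  haveI : FiniteDimensional K M3 := FiniteDimensional.trans K M1 M3
  haveI : FiniteDimensional K M4 := FiniteDimensional.trans K M3 M4
  letI : Algebra F M4 := ((algebraMap K M4).comp (algebraMap F K)).toAlgebra
  haveI : IsScalarTower F K M4 := IsScalarTower.of_algebraMap_eq (fun _ => rfl)
  have hF4 : FFd F M4 := hF.ext
  have hζ4 : IsPrimitiveRoot (algebraMap K M4 ζ) q := hζ.map_of_injective (algebraMap K M4).injective
  have ha4 : algebraMap K M4 a ≠ 0 := by rwa [Ne, map_eq_zero]
  have hc4 : algebraMap K M4 (b * x ^ q + b ^ q) ≠ 0 := by rwa [Ne, map_eq_zero]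
  have hloc := loc_of (M := M4) hq hx hi haS ha hc
    (α1 := algebraMap M3 M4 (algebraMap M1 M3 α1)) (α3 := algebraMap M3 M4 α3) (α4 := α4)
    (by rw [← map_pow, ← map_pow, h1]; rfl) (by rw [← map_pow, h3]; rfl) h4
  have := local_global hq hF4 hζ4 ha4 hc4 hloc
  exact norm_of_NS' hq hζ4 ha4 h5 t5 this
end p10

end

noncomputable section
set_option linter.all false
open Finset IntermediateField FFPrime

section p11
/-- an unramified extension of places with trivial residue extension -/
def Imm {K M : Type} [Field K] [Field M] [Algebra K M] (W : FFPrime M) (v : FFPrime K) : Prop :=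
  Ov W v 1 ∧ ∀ r, W.Ge 0 r → ∃ r' : K, v.Ge 0 r' ∧ W.Ge 1 (r - algebraMap K M r')

lemma exists_layer {q : ℕ} (hq : q.Prime) {K : Type} [Field K] (u : K) :
    ∃ (M : Type) (_ : Field M) (_ : Algebra K M) (α : M), α ^ q = algebraMap K M u ∧ adjoin K {α} = ⊤ := by
  by_cases h : ∃ g, g ^ q = u
  · obtain ⟨g, hg⟩ := h
    refine ⟨K, inferInstance, inferInstance, g, by rw [hg]; rfl, ?_⟩
    exact eq_top_iff.2 (fun x _ => (IntermediateField.algebraMap_mem (adjoin K {g}) x : algebraMap K K x ∈ _))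
  · push Not at h
    obtain ⟨M, i1, i2, α, h1, h2, -⟩ := exists_kummer hq h
    exact ⟨M, i1, i2, α, h1, h2⟩

lemma exists_imm {p q : ℕ} [Fact p.Prime] (hq : q.Prime) {K M : Type} [Field K] [CharP K p] [Field M] [Algebra K M]
    {ζ u : K} {α : M} (hζ : IsPrimitiveRoot ζ q) (h : α ^ q = algebraMap K M u) (ht : adjoin K {α} = ⊤) {v : FFPrime K}
    (hu : v.Ge 1 (u - 1)) : ∃ W : FFPrime M, Imm W v := by
  haveI := finiteDim_of_root hq h ht
  haveI : NeZero q := ⟨hq.ne_zero⟩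
  haveI : CharP M p := charP_of_injective_algebraMap (algebraMap K M).injective p
  obtain ⟨W, e, hW⟩ := exists_extend (L := M) v
  have hu0 := z_unit_of_sub_one v hu
  by_cases hg : ∃ g, g ^ q = u
  · obtain ⟨g, hg⟩ := hg
    have hg0 : algebraMap K M g ≠ 0 := by
      rw [Ne, map_eq_zero]; rintro rfl; exact hu0.1 (by rw [← hg, zero_pow hq.ne_zero])
    have hz : (α / algebraMap K M g) ^ q = 1 := by
      rw [div_pow, h, ← map_pow, hg, div_self]; rw [Ne, map_eq_zero]; exact hu0.1
    obtain ⟨i, -, hi⟩ := (hζ.map_of_injective (algebraMap K M).injective).eq_pow_of_pow_eq_one hz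
    have hα : α = algebraMap K M (ζ ^ i * g) := by
      rw [map_mul, map_pow, hi, div_mul_cancel₀ _ hg0]
    have hb : (⊥ : IntermediateField K M) = ⊤ := by
      rw [← ht, hα]; exact (adjoin_simple_eq_bot_iff.2 (IntermediateField.algebraMap_mem _ _)).symm
    have hs : ∀ r : M, ∃ r' : K, algebraMap K M r' = r := fun r => by
      have : r ∈ (⊥ : IntermediateField K M) := by rw [hb]; trivial
      exact mem_bot.1 this
    have he : e = 1 := by
      obtain ⟨r, hr0, hr⟩ := W.exists_z 1
      obtain ⟨r', rfl⟩ := hs r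
      rw [hW.z] at hr
      exact Int.eq_one_of_mul_eq_one_right hW.1.le hr
    subst he
    refine ⟨W, hW, fun r hr => ?_⟩
    obtain ⟨r', rfl⟩ := hs r
    exact ⟨r', (hW.ge_zero_iff r').1 hr, by rw [sub_self]; exact ge_zero' _ _⟩
  · push Not at hg
    obtain ⟨τ, hcy⟩ := Cyc.of_root hq hζ h ht hu0.1 hg
    have hα : W.z α = 0 := by
      have : W.z (α ^ q) = 0 := by rw [h, hW.z, hu0.2, mul_zero]
      rw [z_pow] at this
      exact (mul_eq_zero.1 this).resolve_left (by exact_mod_cast hq.ne_zero)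
    have he := hcy.unram p hW hα
    subst he
    have hα0 : W.Ge 0 α := (W.ge_iff).2 (Or.inr hα.ge)
    obtain ⟨i, hi⟩ := exists_root_ge hq (hζ.map_of_injective (algebraMap K M).injective) (W := W) (x := α) (y := 1)
      hα0 (ge_one' W) (by
        rw [h, one_pow, ← map_one (algebraMap K M), ← map_sub]; exact (hW.ge_one_iff _).2 hu)
    rw [mul_one, ← map_pow] at hi
    have hζi : v.Ge 0 (ζ ^ i) := by
      refine (v.ge_iff).2 (Or.inr ?_)
      rw [z_pow, z_of_pow_eq_one v hq.ne_zero hζ.pow_eq_one, mul_zero]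
    refine ⟨W, hW, fun r hr => ?_⟩
    obtain ⟨c, hc, hcr⟩ := hcy.residue p hW hα hr
    refine ⟨∑ j ∈ range q, c j * (ζ ^ i) ^ j, ?_, ?_⟩
    · refine Ge.sum (fun j _ => ?_)
      have := (hc j).mul (hζi.pow j)
      simpa using this
    · have e1 : r - algebraMap K M (∑ j ∈ range q, c j * (ζ ^ i) ^ j) =
          (r - ∑ j ∈ range q, algebraMap K M (c j) * α ^ j) +
            ∑ j ∈ range q, algebraMap K M (c j) * (α ^ j - (algebraMap K M (ζ ^ i)) ^ j) := by
        rw [map_sum]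
        simp only [mul_sub, sum_sub_distrib, map_mul, map_pow]
        ring
      rw [e1]
      refine hcr.add (Ge.sum fun j _ => ?_)
      have h1 := Ge.pow_sub hi hα0 ((hW.ge_zero_iff _).2 hζi) j
      have h2 := ((hW.ge_zero_iff _).2 (hc j)).mul h1
      simpa using h2

lemma Imm.z {K M : Type} [Field K] [Field M] [Algebra K M] {W : FFPrime M} {v : FFPrime K} (h : Imm W v) (x : K) :
    W.z (algebraMap K M x) = v.z x := by rw [h.1.z, one_mul]

/-- non-residues stay non-residues -/
lemma Imm.nonres {q : ℕ} (hq : q.Prime) {K M : Type} [Field K] [Field M] [Algebra K M] {W : FFPrime M} {v : FFPrime K} (h : Imm W v) {a : K}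
    (ha : v.Ge 0 a) (hn : ∀ r, ¬ v.Ge 1 (r ^ q - a)) (r : M) : ¬ W.Ge 1 (r ^ q - algebraMap K M a) := by
  intro hr
  have ha' : W.Ge 0 (algebraMap K M a) := (h.1.ge_zero_iff _).2 ha
  have hr0 : W.Ge 0 r := by
    have : W.Ge 0 (r ^ q) := by
      have := (hr.mono (m := 0) (by norm_num)).add ha'
      rwa [sub_add_cancel] at this
    rw [ge_iff] at this ⊢
    rcases this with h0 | h0
    · left; exact pow_eq_zero_iff hq.ne_zero |>.1 h0
    · right
      rw [z_pow] at h0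
      have : (0:ℤ) < q := by exact_mod_cast hq.pos
      nlinarith
  obtain ⟨r', hr', hrr⟩ := h.2 r hr0
  apply hn r'
  rw [← h.1.ge_one_iff, map_sub, map_pow]
  have h1 := Ge.pow_sub hrr hr0 ((h.1.ge_zero_iff _).2 hr') q
  have := hr.sub h1
  simpa using this

lemma exists_nonres {p q : ℕ} [Fact p.Prime] (hq : q.Prime) {F : Type} [Field F] [Finite F]
    {K : Type} [Field K] [CharP K p] [Algebra F K] {ζ : K} (hF : FFd F K) (hζ : IsPrimitiveRoot ζ q) (hq0 : (q : K) ≠ 0) (v : FFPrime K) :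
    ∃ d : K, v.Ge 0 d ∧ ∀ r, ¬ v.Ge 1 (r ^ q - d) := by
  by_contra hcon
  push Not at hcon
  haveI := kap_finite hF v
  have hζ0 : v.Ge 0 ζ := (v.ge_iff).2 (Or.inr (z_of_pow_eq_one v hq.ne_zero hζ.pow_eq_one).ge)
  have hsurj : Function.Surjective (fun y : kap F v => y ^ q) := by
    intro y
    obtain ⟨d, rfl⟩ := rmk_surj F v y
    obtain ⟨r, hr⟩ := hcon d d.2
    have hr0 : v.Ge 0 r := by
      have : v.Ge 0 (r ^ q) := by
        have := (hr.mono (m := 0) (by norm_num)).add d.2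
        rwa [sub_add_cancel] at this
      rw [ge_iff] at this ⊢
      rcases this with h0 | h0
      · left; exact pow_eq_zero_iff hq.ne_zero |>.1 h0
      · right
        rw [z_pow] at h0
        have : (0:ℤ) < q := by exact_mod_cast hq.pos
        nlinarith
    refine ⟨rmk F v ⟨r, hr0⟩, ?_⟩
    show rmk F v ⟨r, hr0⟩ ^ q = _
    rw [← map_pow]
    exact (rmk_eq F _ _).2 hr
  have hinj := Finite.injective_iff_surjective.2 hsurj
  have h1 : rmk F v ⟨ζ, hζ0⟩ = rmk F v 1 := by
    apply hinj
    show rmk F v ⟨ζ, hζ0⟩ ^ q = rmk F v 1 ^ q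
    rw [← map_pow, ← map_pow]
    congr 1
    exact Subtype.ext (by simpa using hζ.pow_eq_one)
  have h2 := (rmk_eq F _ _).1 h1
  have h3 := eq_one_of_ge p hq hq0 hζ.pow_eq_one h2
  exact hζ.ne_one hq.one_lt h3

theorem partB {p q : ℕ} [Fact p.Prime] (hq : q.Prime) {F : Type} [Field F] [Finite F]
    {K : Type} [Field K] [CharP K p] [Algebra F K] {ζ : K} (hF : FFd F K) (hζ : IsPrimitiveRoot ζ q) (hq0 : (q : K) ≠ 0)
    {S : Set (FFPrime K)} (hS : S.Finite) {x : K} (hx : x ≠ 0)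
    (H : ∀ a b : K, (∀ v ∈ S, 0 < v.ord (a - 1)) → (∀ v ∈ S, v.ord b = 0) →
        a ≠ 0 → b * x ^ q + b ^ q ≠ 0 → NormTower4Solvable q K a b x) (v : FFPrime K) (hv : v ∉ S) : 0 ≤ v.ord x := by
  classical
  by_contra hneg
  have hxz : v.z x < 0 := by
    by_contra h
    push Not at h
    exact hneg ((v.ge_nonneg_iff).1 ((v.ge_iff).2 (Or.inr h)))
  obtain ⟨d, hd0, hd⟩ := exists_nonres (p := p) hq hF hζ hq0 v
  let T : Finset (FFPrime K) := insert v hS.toFinset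
  obtain ⟨a, haT⟩ := approx T (fun w => if w = v then d else 1) 1
  obtain ⟨b, hb0, hbT⟩ := exists_z_finset T (fun w => if w = v then 1 else 0)
  have hav : v.Ge 1 (a - d) := by simpa using haT v (mem_insert_self _ _)
  have hbv : v.z b = 1 := by simpa using hbT v (mem_insert_self _ _)
  have hne : ∀ w ∈ S, w ≠ v := fun w hw h => hv (h ▸ hw)
  have hmem : ∀ w ∈ S, w ∈ T := fun w hw => mem_insert_of_mem (hS.mem_toFinset.2 hw)
  have haS : ∀ w ∈ S, 0 < w.ord (a - 1) := fun w hw => by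
    have := haT w (hmem w hw)
    rw [if_neg (hne w hw)] at this
    exact (w.ge_pos_iff).1 this
  have hbS : ∀ w ∈ S, w.ord b = 0 := fun w hw => by
    have := hbT w (hmem w hw)
    rw [if_neg (hne w hw)] at this
    exact (w.ord_eq_zero_iff).2 ⟨hb0, this⟩
  have ha0 : v.Ge 0 a := by
    have := (hav.mono (m := 0) (by norm_num)).add hd0
    rwa [sub_add_cancel] at this
  have han : ∀ r, ¬ v.Ge 1 (r ^ q - a) := fun r hr => hd r (by
    have := hr.add hav
    rwa [sub_add_sub_cancel] at this)
  have ha1 : ¬ v.Ge 1 a := fun h => han 0 (by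
    rw [zero_pow hq.ne_zero, zero_sub]; exact h.neg)
  have ha : a ≠ 0 := by
    rintro rfl; exact ha1 (ge_zero' _ _)
  have haz : v.z a = 0 := by
    rw [ge_iff' v ha] at ha0 ha1; omega
  have hq2 : (2:ℤ) ≤ q := by exact_mod_cast hq.two_le
  have hz1 : v.z (b * x ^ q) = 1 + q * v.z x := by
    rw [z_mul v hb0 (pow_ne_zero _ hx), z_pow, hbv]
  obtain ⟨hc, hcz⟩ := z_add_eq v (mul_ne_zero hb0 (pow_ne_zero q hx)) (y := b ^ q)
    ((v.ge_iff' (pow_ne_zero _ hb0)).2 (by rw [hz1, z_pow, hbv]; nlinarith))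
  rw [hz1] at hcz
  have hsol := H a b haS hbS ha hc
  set c := b * x ^ q + b ^ q with hcd
  have hxi : v.Ge 1 x⁻¹ := (v.ge_iff' (inv_ne_zero hx)).2 (by rw [z_inv]; omega)
  have hci : v.Ge 1 c⁻¹ := (v.ge_iff' (inv_ne_zero hc)).2 (by rw [z_inv, hcz]; nlinarith)
  have hai : v.Ge 1 ((a + a⁻¹) * x⁻¹) := by
    have h1 : v.Ge 0 a⁻¹ := (v.ge_iff' (inv_ne_zero ha)).2 (by rw [z_inv, haz]; rfl)
    have := (ha0.add h1).mul hxi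
    simpa using this
  obtain ⟨M1, _, _, α1, h1, t1⟩ := exists_layer hq (1 + c⁻¹)
  obtain ⟨M3, _, _, α3, h3, t3⟩ := exists_layer hq (algebraMap K M1 (1 + x⁻¹))
  obtain ⟨M4, _, _, α4, h4, t4⟩ := exists_layer hq (algebraMap M1 M3 (algebraMap K M1 (1 + (a + a⁻¹) * x⁻¹)))
  haveI : CharP M1 p := charP_of_injective_algebraMap (algebraMap K M1).injective p
  haveI : CharP M3 p := charP_of_injective_algebraMap (algebraMap M1 M3).injective p
  haveI : CharP M4 p := charP_of_injective_algebraMap (algebraMap M3 M4).injective p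
  have hζ1 := hζ.map_of_injective (algebraMap K M1).injective
  have hζ3 := hζ1.map_of_injective (algebraMap M1 M3).injective
  have hζ4 := hζ3.map_of_injective (algebraMap M3 M4).injective
  obtain ⟨W1, i1⟩ := exists_imm (p := p) hq hζ h1 t1 (v := v) (by simpa using hci)
  obtain ⟨W3, i3⟩ := exists_imm (p := p) hq hζ1 h3 t3 (v := W1) (by
    rw [← map_one (algebraMap K M1), ← map_sub, i1.1.ge_one_iff]; simpa using hxi)
  obtain ⟨W4, i4⟩ := exists_imm (p := p) hq hζ3 h4 t4 (v := W3) (by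
    rw [← map_one (algebraMap M1 M3), ← map_sub, i3.1.ge_one_iff,
      ← map_one (algebraMap K M1), ← map_sub, i1.1.ge_one_iff]; simpa using hai)
  set a4 := algebraMap M3 M4 (algebraMap M1 M3 (algebraMap K M1 a)) with ha4
  have n1 := i1.nonres hq ha0 han
  have g1 := (i1.1.ge_zero_iff a).2 ha0
  have n3 := i3.nonres hq g1 n1
  have g3 := (i3.1.ge_zero_iff _).2 g1
  have n4 := i4.nonres hq g3 n3
  have hroot : ∀ r, r ^ q ≠ a4 := fun r hr => n4 r (by
    rw [hr, ha4, sub_self]; exact ge_zero' _ _)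
  obtain ⟨M5, _, _, α5, h5, t5, -⟩ := exists_kummer hq hroot
  have ha40 : a4 ≠ 0 := by
    rw [ha4]; simpa using ha
  obtain ⟨τ, hcy⟩ := Cyc.of_root hq hζ4 h5 t5 ha40 hroot
  obtain ⟨y, hy⟩ := hsol M1 α1 h1 t1 M3 α3 h3 t3 M4 α4 h4 t4 M5 α5 h5 t5
  haveI : CharP M5 p := charP_of_injective_algebraMap (algebraMap M4 M5).injective p
  haveI := hcy.finiteDim
  obtain ⟨W5, e, hW5⟩ := exists_extend (L := M5) W4
  have hα : W5.z α5 = 0 := by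
    have : W5.z (α5 ^ q) = 0 := by rw [h5, hW5.z, ha4, i4.z, i3.z, i1.z, haz, mul_zero]
    rw [z_pow] at this
    exact (mul_eq_zero.1 this).resolve_left (by exact_mod_cast hq.ne_zero)
  have he := hcy.unram p hW5 hα
  subst he
  have hcm : W5.cm τ = W5 := by
    by_contra hcm
    obtain ⟨r, hr⟩ := hcy.residue_pow hW5 hα hcm h5.symm
    exact n4 r hr
  have hnm := hcy.norm_eq y
  rw [hy] at hnm
  have hy0 : y ≠ 0 := by
    rintro rfl
    rw [Algebra.norm_zero] at hy
    have : algebraMap M3 M4 (algebraMap M1 M3 (algebraMap K M1 c)) ≠ 0 := by simpa using hc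
    exact this hy.symm
  have hz := z_nm_of_eq q hcm hy0
  rw [← hnm, hW5.z, i4.z, i3.z, i1.z, hcz, one_mul] at hz
  have : (q:ℤ) ∣ 1 := ⟨W5.z y - v.z x, by rw [mul_sub, ← hz]; ring⟩
  have := Int.le_of_dvd one_pos this
  omega
end p11

end

noncomputable section
set_option linter.all false
open Finset IntermediateField FFPrime

section p12
lemma ratFunc_transc (F : Type) [Field F] : Transcendental F (RatFunc.X : RatFunc F) := by
  rw [← RatFunc.algebraMap_X]
  exact (transcendental_algebraMap_iff (IsFractionRing.injective (Polynomial F) (RatFunc F))).2 (Polynomial.transcendental_X F)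

lemma ratFunc_top (F : Type) [Field F] : adjoin F {(RatFunc.X : RatFunc F)} = ⊤ := by
  rw [eq_top_iff]
  intro f _
  have hp : ∀ P : Polynomial F, algebraMap (Polynomial F) (RatFunc F) P ∈ adjoin F {(RatFunc.X : RatFunc F)} := by
    intro P
    have : algebraMap (Polynomial F) (RatFunc F) P = Polynomial.aeval (RatFunc.X : RatFunc F) P := by
      rw [← RatFunc.algebraMap_X, Polynomial.aeval_algebraMap_apply, Polynomial.aeval_X_left_apply]
    rw [this]
    exact algebra_adjoin_le_adjoin F _ (Polynomial.aeval_mem_adjoin_singleton F _)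
  rw [← RatFunc.num_div_denom f]
  exact div_mem (hp _) (hp _)

lemma ratFunc_FFd (F : Type) [Field F] : FFd F (RatFunc F) := by
  refine ⟨RatFunc.X, ratFunc_transc F, ?_⟩
  rw [ratFunc_top]
  refine Module.Finite.of_surjective (LinearMap.toSpanSingleton (⊤ : IntermediateField F (RatFunc F)) (RatFunc F) 1) ?_
  intro y
  exact ⟨⟨y, trivial⟩, by simp [Algebra.smul_def]⟩
end p12

end

/-- For a global function field `K` containing a primitive `q`-th
root of unity and a nonempty finite set `S` of primes of `K`, an element `x ∈ K^×` is
an `S`-integer if and only if for all `a ∈ 𝒱_{K,S}` and `b ∈ U_{K,S}` (with the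
inverted elements nonzero) the norm equation `N_{L₄(a^{1/q})/L₄}(y) = b x^q + b^q`
is solvable. -/
theorem statement9 (p q : ℕ) [Fact p.Prime] (hq : q.Prime) (hqp : q ≠ p)
    (K : Type) [Field K] [Algebra (RatFunc (ZMod p)) K]
    [FiniteDimensional (RatFunc (ZMod p)) K]
    (ζ : K) (hζ : IsPrimitiveRoot ζ q)
    (S : Set (FFPrime K)) (hSfin : S.Finite) (hSne : S.Nonempty)
    (x : K) (hx : x ≠ 0) :
    (∀ v : FFPrime K, v ∉ S → 0 ≤ v.ord x) ↔
      ∀ a b : K, (∀ v ∈ S, 0 < v.ord (a - 1)) → (∀ v ∈ S, v.ord b = 0) →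
        a ≠ 0 → b * x ^ q + b ^ q ≠ 0 →
        NormTower4Solvable q K a b x := by
  haveI : Fact q.Prime := ⟨hq⟩
  letI : Algebra (ZMod p) K := ((algebraMap (RatFunc (ZMod p)) K).comp (algebraMap (ZMod p) (RatFunc (ZMod p)))).toAlgebra
  haveI : IsScalarTower (ZMod p) (RatFunc (ZMod p)) K := IsScalarTower.of_algebraMap_eq (fun _ => rfl)
  haveI : CharP K p := charP_of_injective_algebraMap (algebraMap (ZMod p) K).injective p
  have hF : FFd (ZMod p) K := (ratFunc_FFd (ZMod p)).ext
  have hq0 : (q : K) ≠ 0 := by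
    rw [Ne, CharP.cast_eq_zero_iff K p q, Nat.prime_dvd_prime_iff_eq Fact.out hq]
    exact fun h => hqp h.symm
  constructor
  · intro hi a b haS hbS ha hc
    exact partA (p := p) hq hF hζ hx hi haS ha hc
  · intro H v hv
    exact partB (p := p) hq hF hζ hq0 hSfin hx H v hv
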